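/- arXiv:quant-ph/0107129 — 2 statements merged into one kernel-verified Lean document; each statement's English description precedes it below -/
import Mathlib

section
/- Let q be a prime power, n a positive integer, and let C be an F_q-linear subspace of F_q^{2n} with the swap-invariance property that (x_1, …, x_{2n}) ∈ C if and only if (x_{n+1}, …, x_{2n}, x_1, …, x_n) ∈ C. Then the orthogonal space of C with respect to the bilinear form ⟨x,y⟩_b = Σ_{i=1}^n x_i y_i − Σ_{i=n+1}^{2n} x_i y_i coincides with the symplectic orthogonal space C^{⊥s}; that is, {x ∈ F_q^{2n} : ⟨x,y⟩_b = 0 for all y ∈ C} = {x ∈ F_q^{2n} : ⟨x,y⟩_s = 0 for all y ∈ C}. -/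
/-- The standard symplectic form on `F^{2n}`, with coordinates indexed by
`ι ⊕ ι` (`Sum.inl i` is `x_i`, `Sum.inr i` is `x_{n+i}`):
`⟨x,y⟩_s = ∑ x_i y_{n+i} - ∑ x_{n+i} y_i`. -/
def sympForm {F : Type*} [Field F] {ι : Type*} [Fintype ι]
    (x y : (ι ⊕ ι) → F) : F :=
  ∑ i, x (Sum.inl i) * y (Sum.inr i) - ∑ i, x (Sum.inr i) * y (Sum.inl i)

/-- The symplectic orthogonal space `C^{⊥s}` of a set of vectors. -/
def sympOrth {F : Type*} [Field F] {ι : Type*} [Fintype ι]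
    (C : Set ((ι ⊕ ι) → F)) : Set ((ι ⊕ ι) → F) :=
  {x | ∀ y ∈ C, sympForm x y = 0}

/-- If a linear subspace `C ⊆ F_q^{2n}` is invariant under swapping the two
halves of coordinates, then the orthogonal space of `C` with respect to the
bilinear form `⟨x,y⟩_b = ∑_{i=1}^n x_i y_i - ∑_{i=n+1}^{2n} x_i y_i`
coincides with the symplectic orthogonal space `C^{⊥s}`. -/
theorem bilinear_orth_eq_symplectic_orth
    {F : Type*} [Field F] [Fintype F] (n : ℕ) (hn : 0 < n)
    (C : Submodule F ((Fin n ⊕ Fin n) → F))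
    (hswap : ∀ x : (Fin n ⊕ Fin n) → F,
      x ∈ C ↔ (Sum.elim (fun j => x (Sum.inr j)) (fun j => x (Sum.inl j))) ∈ C) :
    {x : (Fin n ⊕ Fin n) → F | ∀ y ∈ C,
        (∑ i, x (Sum.inl i) * y (Sum.inl i)) - (∑ i, x (Sum.inr i) * y (Sum.inr i)) = 0}
      = sympOrth (C : Set ((Fin n ⊕ Fin n) → F)) := by
  ext x
  simp only [sympOrth, sympForm, Set.mem_setOf_eq, SetLike.mem_coe]
  constructor
  · intro h y hy
    simpa using h _ ((hswap y).1 hy)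
  · intro h y hy
    simpa using h _ ((hswap y).1 hy)
end

section
/- Let m ≥ 2 be an integer, q = 2^m, and let R be a real number with 0 ≤ R ≤ 1. There exists a sequence of F_{q^2}-linear subspaces C_i ⊆ F_{q^2}^{2n_i} with C_i^{⊥s} ⊆ C_i such that, writing k_i = dim_{F_{q^2}} C_i − n_i and d_i = d(C_i \ C_i^{⊥s}), one has: lim_{i→∞} n_i = ∞, liminf_{i→∞} k_i/n_i ≥ R, and liminf_{i→∞} d_i/n_i ≥ (1 − R − 2/(2^m − 1))/2. -/
open Filter

/-- The symplectic weight `w(x) = #{i : (x_i, x_{n+i}) ≠ (0,0)}`. -/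
noncomputable def sympWeight {F : Type*} [Field F] {ι : Type*}
    (x : (ι ⊕ ι) → F) : ℕ :=
  Set.ncard {i : ι | x (Sum.inl i) ≠ 0 ∨ x (Sum.inr i) ≠ 0}

/-- The minimum distance `d(C \ C^{⊥s}) = min{w(x) : x ∈ C \ C^{⊥s}}`. -/
noncomputable def minSympDist {F : Type*} [Field F] {ι : Type*} [Fintype ι]
    (C : Set ((ι ⊕ ι) → F)) : ℕ :=
  sInf (sympWeight '' (C \ sympOrth C))


namespace GS

/-- A field with an integer valued weight (pole order) function with one-dimensional leading terms. -/
structure WtF (F K : Type*) [Field F] [Field K] [Algebra F K] where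
  wt : K → ℤ
  mul' : ∀ f g : K, f ≠ 0 → g ≠ 0 → wt (f * g) = wt f + wt g
  add' : ∀ f g : K, f ≠ 0 → g ≠ 0 → f + g ≠ 0 → wt (f + g) ≤ max (wt f) (wt g)
  alg' : ∀ c : F, c ≠ 0 → wt (algebraMap F K c) = 0
  lead' : ∀ f g : K, f ≠ 0 → g ≠ 0 → wt f = wt g → ∃ c : F, f - c • g = 0 ∨ wt (f - c • g) < wt f

section basic
variable {F K : Type*} [Field F] [Field K] [Algebra F K] (w : WtF F K)

lemma WtF.one : w.wt 1 = 0 := by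
  have := w.alg' 1 one_ne_zero
  simpa using this

lemma WtF.neg (f : K) : w.wt (-f) = w.wt f := by
  by_cases hf : f = 0
  · simp [hf]
  have h := w.mul' (-1) f (by simp) hf
  have h1 := w.alg' (-1) (by simp)
  simp only [map_neg, map_one] at h1
  rw [neg_one_mul] at h
  linarith

lemma WtF.smul (c : F) (hc : c ≠ 0) (f : K) (hf : f ≠ 0) : w.wt (c • f) = w.wt f := by
  rw [Algebra.smul_def, w.mul' _ _ (by simpa using hc) hf, w.alg' c hc, zero_add]

lemma WtF.pow (f : K) (hf : f ≠ 0) (n : ℕ) : w.wt (f ^ n) = n * w.wt f := by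
  induction n with
  | zero => simp [w.one]
  | succ n ih => rw [pow_succ, w.mul' _ _ (pow_ne_zero _ hf) hf, ih]; push_cast; ring

lemma WtF.inv (f : K) (hf : f ≠ 0) : w.wt f⁻¹ = - w.wt f := by
  have := w.mul' f f⁻¹ hf (inv_ne_zero hf)
  rw [mul_inv_cancel₀ hf, w.one] at this
  linarith

lemma WtF.add_of_lt (f g : K) (hf : f ≠ 0) (h : g = 0 ∨ w.wt g < w.wt f) :
    f + g ≠ 0 ∧ w.wt (f + g) = w.wt f := by
  rcases h with h | h
  · simp [h, hf]
  by_cases hg : g = 0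
  · simp [hg, hf]
  have h0 : f + g ≠ 0 := by
    intro h0
    have : g = -f := by linear_combination h0
    rw [this, w.neg] at h
    exact lt_irrefl _ h
  refine ⟨h0, le_antisymm ((w.add' f g hf hg h0).trans (max_le le_rfl h.le)) ?_⟩
  have h1 := w.add' (f + g) (-g) h0 (neg_ne_zero.2 hg) (by simpa using hf)
  rw [add_neg_cancel_right, w.neg] at h1
  rcases le_max_iff.1 h1 with h2 | h2
  · exact h2
  · omega

/-- sums with all terms of smaller weight -/
lemma WtF.sum_le {ι : Type*} (s : Finset ι) (f : ι → K) (n : ℤ)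
    (h : ∀ i ∈ s, f i = 0 ∨ w.wt (f i) ≤ n) : ∑ i ∈ s, f i = 0 ∨ w.wt (∑ i ∈ s, f i) ≤ n := by
  classical
  induction s using Finset.induction_on with
  | empty => simp
  | insert a s ha ih =>
    rw [Finset.sum_insert ha]
    have h1 := h a (by simp)
    have h2 := ih fun i hi => h i (by simp [hi])
    by_cases h3 : f a = 0
    · simpa [h3] using h2
    by_cases h4 : ∑ i ∈ s, f i = 0
    · simpa [h4] using h1
    by_cases h5 : f a + ∑ i ∈ s, f i = 0
    · exact Or.inl h5
    · right
      have := w.add' _ _ h3 h4 h5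
      refine this.trans (max_le (h1.resolve_left h3) (h2.resolve_left h4))

/-- sums with pairwise distinct weights -/
lemma WtF.sum_distinct {ι : Type*} (s : Finset ι) (f : ι → K)
    (h : ∀ i ∈ s, ∀ j ∈ s, f i ≠ 0 → f j ≠ 0 → w.wt (f i) = w.wt (f j) → i = j)
    (hne : ∃ i ∈ s, f i ≠ 0) :
    ∃ i ∈ s, f i ≠ 0 ∧ ∑ j ∈ s, f j ≠ 0 ∧ w.wt (∑ j ∈ s, f j) = w.wt (f i) ∧
      ∀ j ∈ s, f j ≠ 0 → w.wt (f j) ≤ w.wt (f i) := by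
  classical
  let t := s.filter fun i => f i ≠ 0
  have ht : t.Nonempty := by
    obtain ⟨i, hi, h0⟩ := hne
    exact ⟨i, by simp [t, hi, h0]⟩
  obtain ⟨i, hi, hmax⟩ := t.exists_max_image (fun i => w.wt (f i)) ht
  have hi' : i ∈ s ∧ f i ≠ 0 := by simpa [t] using hi
  have hmax' : ∀ j ∈ s, f j ≠ 0 → w.wt (f j) ≤ w.wt (f i) :=
    fun j hj h0 => hmax j (by simp [t, hj, h0])
  have key := w.sum_le (s.erase i) f (w.wt (f i) - 1) (by
    intro j hj
    have hj' := Finset.mem_erase.1 hj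
    by_cases h0 : f j = 0
    · exact Or.inl h0
    · right
      have h1 := hmax' j hj'.2 h0
      have h2 : w.wt (f j) ≠ w.wt (f i) := fun e => hj'.1 (h j hj'.2 i hi'.1 h0 hi'.2 e)
      omega)
  rw [← Finset.add_sum_erase s f hi'.1]
  have := w.add_of_lt (f i) _ hi'.2 (key.imp id fun h => by omega)
  exact ⟨i, hi'.1, hi'.2, this.1, this.2, hmax'⟩

def Good (κ : ℕ) (V : Submodule F K) : Prop := ∀ v ∈ V, v ≠ 0 → ∃ l : ℕ, w.wt v = κ * l

def gaps (κ : ℕ) (V : Submodule F K) : Set ℕ := {l | ¬ ∃ v ∈ V, v ≠ 0 ∧ w.wt v = κ * l}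

lemma gaps_anti {κ : ℕ} {W V : Submodule F K} (h : W ≤ V) : gaps w κ V ⊆ gaps w κ W := by
  intro l hl ⟨v, hv, h1⟩
  exact hl ⟨v, h hv, h1⟩

theorem dim_quot {κ : ℕ} (hκ : 0 < κ) {W V : Submodule F K} (hWV : W ≤ V) (hV : Good w κ V)
    (hfin : (gaps w κ W).Finite) :
    FiniteDimensional F (V ⧸ W.submoduleOf V) ∧
    Module.finrank F (V ⧸ W.submoduleOf V) + (gaps w κ V).ncard = (gaps w κ W).ncard := by
  classical
  let S : Set ℕ := gaps w κ W \ gaps w κ V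
  have hS : S.Finite := hfin.subset Set.sdiff_subset
  have hex : ∀ l : S, ∃ v ∈ V, v ≠ 0 ∧ w.wt v = κ * (l : ℕ) := by
    rintro ⟨l, h1, h2⟩
    simpa [gaps] using h2
  choose v hvV hv0 hvw using hex
  have : Fintype S := hS.fintype
  let b : S → (V ⧸ W.submoduleOf V) := fun l => Submodule.Quotient.mk ⟨v l, hvV l⟩
  have hli : LinearIndependent F b := by
    rw [Fintype.linearIndependent_iff]
    intro c hc
    by_contra! hne
    have hmem : ∑ l, c l • v l ∈ W := by
      have : Submodule.Quotient.mk (p := W.submoduleOf V) (∑ l, c l • (⟨v l, hvV l⟩ : V)) = 0 := by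
        rw [← hc, ← Submodule.mkQ_apply, map_sum]; rfl
      rw [Submodule.Quotient.mk_eq_zero, Submodule.submoduleOf, Submodule.mem_comap] at this
      simpa using this
    obtain ⟨i, hi⟩ := hne
    obtain ⟨j, -, hj0, hs0, hsw, -⟩ := w.sum_distinct Finset.univ (fun l => c l • v l) (by
      intro i _ j _ hi hj hij
      have hi' : c i ≠ 0 := by rintro h; simp [h] at hi
      have hj' : c j ≠ 0 := by rintro h; simp [h] at hj
      rw [w.smul _ hi' _ (hv0 i), w.smul _ hj' _ (hv0 j), hvw, hvw] at hij
      have : (κ : ℤ) ≠ 0 := by positivity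
      have := mul_left_cancel₀ this hij
      exact Subtype.ext (by exact_mod_cast this)) ⟨i, Finset.mem_univ _, smul_ne_zero hi (hv0 i)⟩
    have hj' : c j ≠ 0 := by rintro h; simp [h] at hj0
    rw [w.smul _ hj' _ (hv0 j), hvw] at hsw
    exact j.2.1 ⟨_, hmem, hs0, hsw⟩
  have hspan : ∀ N : ℕ, ∀ l < N, ∀ u (hu : u ∈ V), u ≠ 0 → w.wt u = κ * l →
      (Submodule.Quotient.mk ⟨u, hu⟩ : V ⧸ W.submoduleOf V) ∈ Submodule.span F (Set.range b) := by
    intro N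
    induction N with
    | zero => intro l hl; omega
    | succ N ih =>
      intro l hl u hu hu0 huw
      have step : ∀ g (hg : g ∈ V), g ≠ 0 → w.wt g = κ * l →
          (Submodule.Quotient.mk ⟨g, hg⟩ : V ⧸ W.submoduleOf V) ∈ Submodule.span F (Set.range b) →
          (Submodule.Quotient.mk ⟨u, hu⟩ : V ⧸ W.submoduleOf V) ∈ Submodule.span F (Set.range b) := by
        intro g hg hg0 hgw hgs
        obtain ⟨c, hc⟩ := w.lead' u g hu0 hg0 (huw.trans hgw.symm)
        have hd : u - c • g ∈ V := V.sub_mem hu (V.smul_mem _ hg)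
        have e : (Submodule.Quotient.mk ⟨u, hu⟩ : V ⧸ W.submoduleOf V) =
            Submodule.Quotient.mk ⟨u - c • g, hd⟩ + c • Submodule.Quotient.mk ⟨g, hg⟩ := by
          rw [← Submodule.Quotient.mk_smul, ← Submodule.Quotient.mk_add]
          congr 1
          ext; simp
        rw [e]
        refine Submodule.add_mem _ ?_ (Submodule.smul_mem _ _ hgs)
        by_cases h0 : u - c • g = 0
        · have : (⟨u - c • g, hd⟩ : V) = 0 := Subtype.ext h0
          rw [this]; simp
        · obtain ⟨l', hl'⟩ := hV _ hd h0
          have hlt := hc.resolve_left h0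
          rw [hl', huw] at hlt
          have : l' < l := by
            have := lt_of_mul_lt_mul_left hlt (by positivity)
            exact_mod_cast this
          exact ih l' (by omega) _ hd h0 hl'
      by_cases hlW : l ∈ gaps w κ W
      · have hlS : l ∈ S := ⟨hlW, fun h => h ⟨u, hu, hu0, huw⟩⟩
        exact step (v ⟨l, hlS⟩) (hvV _) (hv0 _) (hvw _) (Submodule.subset_span ⟨⟨l, hlS⟩, rfl⟩)
      · simp only [gaps, Set.mem_ofPred_eq, not_not] at hlW
        obtain ⟨g, hgW, hg0, hgw⟩ := hlW
        refine step g (hWV hgW) hg0 hgw ?_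
        have : (Submodule.Quotient.mk ⟨g, hWV hgW⟩ : V ⧸ W.submoduleOf V) = 0 := by
          rw [Submodule.Quotient.mk_eq_zero]
          exact hgW
        rw [this]; exact Submodule.zero_mem _
  have hsp : ⊤ ≤ Submodule.span F (Set.range b) := by
    intro z _
    obtain ⟨⟨u, hu⟩, rfl⟩ := Submodule.Quotient.mk_surjective _ z
    by_cases h0 : u = 0
    · subst h0
      have : (⟨0, hu⟩ : V) = 0 := rfl
      rw [this]; simp
    · obtain ⟨l, hl⟩ := hV u hu h0
      exact hspan (l + 1) l (by omega) u hu h0 hl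
  let B := Module.Basis.mk hli hsp
  refine ⟨Module.Finite.of_basis B, ?_⟩
  rw [Module.finrank_eq_card_basis B, ← Set.toFinset_card, ← Set.ncard_eq_toFinset_card']
  exact Set.ncard_sdiff_add_ncard_of_subset (gaps_anti w hWV) hfin

end basic
end GS


namespace GS
section code
variable {F : Type*} [Field F]

lemma minSympDist_le (n : ℕ) (C : Set ((Fin n ⊕ Fin n) → F)) : minSympDist C ≤ n := by
  unfold minSympDist
  by_cases h : (sympWeight '' (C \ sympOrth C)).Nonempty
  · obtain ⟨x, -, hx⟩ := Nat.sInf_mem h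
    rw [← hx, sympWeight]
    exact (Set.ncard_le_card _).trans (by simp)
  · rw [Set.not_nonempty_iff_eq_empty.1 h]; simp

lemma dot_nondeg (n : ℕ) :
    (dotProductBilin F F : LinearMap.BilinForm F (Fin n → F)).Nondegenerate := by
  constructor
  · intro x h
    exact dotProduct_eq_zero_iff.1 h
  · intro x h
    exact dotProduct_eq_zero_iff.1 fun w => by rw [dotProduct_comm]; exact h w

lemma dot_refl (n : ℕ) :
    (dotProductBilin F F : LinearMap.BilinForm F (Fin n → F)).IsRefl := by
  intro x y h
  have h : x ⬝ᵥ y = 0 := h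
  rw [dotProduct_comm] at h
  exact h

theorem code_pair (n : ℕ) (E₁ E₂ : Submodule F (Fin n → F)) (hlt : E₂ < E₁) (d : ℕ)
    (h1 : ∀ x ∈ E₁, x ≠ 0 → d ≤ Set.ncard {i | x i ≠ 0})
    (h2 : ∀ y : Fin n → F, (∀ e ∈ E₂, e ⬝ᵥ y = 0) → y ≠ 0 → d ≤ Set.ncard {i | y i ≠ 0}) :
    ∃ C : Submodule F ((Fin n ⊕ Fin n) → F), sympOrth (C : Set ((Fin n ⊕ Fin n) → F)) ⊆ C ∧
      Module.finrank F C + Module.finrank F E₂ = n + Module.finrank F E₁ ∧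
      d ≤ minSympDist (C : Set ((Fin n ⊕ Fin n) → F)) := by
  classical
  let B : LinearMap.BilinForm F (Fin n → F) := dotProductBilin F F
  have hB : ∀ x y, B x y = x ⬝ᵥ y := fun _ _ => rfl
  let P := B.orthogonal E₂
  have hP : ∀ y, y ∈ P ↔ ∀ e ∈ E₂, e ⬝ᵥ y = 0 := fun y => LinearMap.BilinForm.mem_orthogonal_iff
  have hPP : ∀ x, (∀ y ∈ P, y ⬝ᵥ x = 0) → x ∈ E₂ := by
    intro x hx
    rw [← LinearMap.BilinForm.orthogonal_orthogonal (dot_nondeg n)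
      (fun x y h => dot_refl n x y h) E₂]
    exact LinearMap.BilinForm.mem_orthogonal_iff.2 hx
  let e := LinearEquiv.sumArrowLequivProdArrow (Fin n) (Fin n) F F
  let C : Submodule F ((Fin n ⊕ Fin n) → F) := (E₁.prod P).comap e.toLinearMap
  have hC : ∀ x, x ∈ C ↔ (fun i => x (Sum.inl i)) ∈ E₁ ∧ (fun i => x (Sum.inr i)) ∈ P := by
    intro x; rfl
  have hform : ∀ x y : (Fin n ⊕ Fin n) → F, sympForm x y =
      (fun i => x (Sum.inl i)) ⬝ᵥ (fun i => y (Sum.inr i)) -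
      (fun i => x (Sum.inr i)) ⬝ᵥ (fun i => y (Sum.inl i)) := fun x y => rfl
  have horth : ∀ x, x ∈ sympOrth (C : Set ((Fin n ⊕ Fin n) → F)) ↔
      (fun i => x (Sum.inl i)) ∈ E₂ ∧ ∀ y ∈ E₁, y ⬝ᵥ (fun i => x (Sum.inr i)) = 0 := by
    intro x
    constructor
    · intro hx
      constructor
      · apply hPP
        intro y hy
        have := hx (Sum.elim 0 y) ((hC _).2 ⟨E₁.zero_mem, by simpa using hy⟩)
        rw [hform] at this
        rw [dotProduct_comm]
        simpa [dotProduct] using this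
      · intro y hy
        have := hx (Sum.elim y 0) ((hC _).2 ⟨by simpa using hy, P.zero_mem⟩)
        rw [hform] at this
        rw [dotProduct_comm]
        simpa [dotProduct] using this
    · rintro ⟨ha, hb⟩ y hy
      obtain ⟨hy1, hy2⟩ := (hC y).1 hy
      rw [hform, (hP _).1 hy2 _ ha, dotProduct_comm, hb _ hy1, sub_zero]
  refine ⟨C, ?_, ?_, ?_⟩
  · intro x hx
    obtain ⟨ha, hb⟩ := (horth x).1 hx
    exact (hC x).2 ⟨hlt.le ha, (hP _).2 fun e he => hb e (hlt.le he)⟩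
  · have e1 : Module.finrank F C = Module.finrank F (E₁.prod P) :=
      (LinearEquiv.ofSubmodule' e (E₁.prod P)).finrank_eq
    have e2 : Module.finrank F (E₁.prod P) = Module.finrank F E₁ + Module.finrank F P := by
      let ee : (E₁.prod P) ≃ₗ[F] E₁ × P :=
        { toFun := fun x => (⟨x.1.1, x.2.1⟩, ⟨x.1.2, x.2.2⟩)
          invFun := fun x => ⟨(x.1.1, x.2.1), x.1.2, x.2.2⟩
          map_add' := fun x y => rfl
          map_smul' := fun c x => rfl
          left_inv := fun x => rfl
          right_inv := fun x => rfl }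
      rw [ee.finrank_eq, Module.finrank_prod]
    have e3 : Module.finrank F P = n - Module.finrank F E₂ := by
      have := LinearMap.BilinForm.finrank_orthogonal (dot_nondeg (F := F) n) E₂
      simpa using this
    have e4 : Module.finrank F E₂ ≤ n := by simpa using E₂.finrank_le
    omega
  · unfold minSympDist
    apply le_csInf
    · obtain ⟨x, hx1, hx2⟩ := SetLike.exists_of_lt hlt
      refine ⟨_, Sum.elim x 0, ⟨(hC _).2 ⟨by simpa using hx1, P.zero_mem⟩, ?_⟩, rfl⟩
      intro h
      exact hx2 (by simpa using ((horth _).1 h).1)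
    · rintro _ ⟨x, ⟨hx, hx'⟩, rfl⟩
      obtain ⟨ha, hb⟩ := (hC x).1 hx
      unfold sympWeight
      by_cases h0 : (fun i => x (Sum.inl i)) = 0
      · have h0' : (fun i => x (Sum.inr i)) ≠ 0 := by
          intro h0'
          apply hx'
          rw [horth, h0, h0']
          exact ⟨E₂.zero_mem, fun y _ => by simp⟩
        exact (h2 _ ((hP _).1 hb) h0').trans
          (Set.ncard_le_ncard (fun i hi => Or.inr hi) (Set.toFinite _))
      · exact (h1 _ ha h0).trans
          (Set.ncard_le_ncard (fun i hi => Or.inl hi) (Set.toFinite _))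

end code
end GS


namespace GS
section agcode
variable {F K : Type*} [Field F] [Field K] [Algebra F K] (w : WtF F K)
  (A : Subalgebra F K)

/-- functions of weight at most `b` -/
def Lb (b : ℕ) : Submodule F A where
  carrier := {f | (f : K) = 0 ∨ w.wt f ≤ b}
  zero_mem' := Or.inl rfl
  add_mem' := by
    intro f g hf hg
    have := w.sum_le Finset.univ (fun i : Bool => cond i (f : K) (g : K)) b (by
      intro i _; cases i
      · exact hg
      · exact hf)
    rw [Fintype.sum_bool] at this
    exact this
  smul_mem' := by
    intro c f hf
    by_cases hc : c = 0
    · left; simp [hc]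
    · rcases hf with hf | hf
      · left; simp [hf]
      · by_cases h0 : (f : K) = 0
        · left; simp [h0]
        · right
          rw [Subalgebra.coe_smul, w.smul c hc _ h0]; exact hf

lemma ev_surj {ι : Type*} [Fintype ι] (ψ : ι → (A →ₐ[F] F)) (hψ : Function.Injective ψ)
    (v : ι → F) : ∃ f : A, ∀ i, ψ i f = v i := by
  classical
  let ev : A →ₗ[F] (ι → F) := LinearMap.pi fun i => (ψ i).toLinearMap
  suffices h : LinearMap.range ev = ⊤ by
    obtain ⟨f, hf⟩ := LinearMap.range_eq_top.1 h v
    exact ⟨f, fun i => congrFun hf i⟩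
  by_contra hne
  obtain ⟨φ, hφ, hker⟩ := Submodule.exists_le_ker_of_lt_top _ (lt_top_iff_ne_top.2 hne)
  have hli := linearIndependent_monoidHom A F
  have hinj : Function.Injective fun i => (ψ i : A →* F) := by
    intro i j h
    apply hψ
    ext f
    exact DFunLike.congr_fun h f
  have hli2 := hli.comp _ hinj
  rw [Fintype.linearIndependent_iff] at hli2
  have key := hli2 (fun i => φ fun j => if i = j then 1 else 0) (by
    ext f
    have h1 : φ (ev f) = 0 := hker ⟨f, rfl⟩
    rw [LinearMap.pi_apply_eq_sum_univ] at h1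
    simp only [Finset.sum_apply, Pi.smul_apply, Function.comp, smul_eq_mul, Pi.zero_apply]
    refine Eq.trans ?_ h1
    refine Finset.sum_congr rfl fun i _ => ?_
    rw [smul_eq_mul, mul_comm]; rfl)
  apply hφ
  refine LinearMap.ext fun v => ?_
  rw [LinearMap.pi_apply_eq_sum_univ]
  simp [key]

variable {A} {ι : Type*} [Fintype ι] (ψ : ι → (A →ₐ[F] F)) (hψ : Function.Injective ψ)
  (hG : Good w 1 A.toSubmodule) (hfin : (gaps w 1 A.toSubmodule).Finite)

include hψ hG hfin in
/-- a function of weight `a` has at most `a` zeros -/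
lemma zeros_le (f : A) (hf : (f : K) ≠ 0) (a : ℕ) (ha : w.wt f = a) (S : Finset ι)
    (hS : ∀ i ∈ S, ψ i f = 0) : S.card ≤ a := by
  classical
  let W : Submodule F K := A.toSubmodule.map (LinearMap.mulLeft F (f : K))
  have hW : W ≤ A.toSubmodule := by
    rintro _ ⟨g, hg, rfl⟩
    exact A.mul_mem f.2 hg
  have hgap : gaps w 1 W ⊆ (Set.Iio a) ∪ (fun l => a + l) '' gaps w 1 A.toSubmodule := by
    intro l hl
    by_cases h : l < a
    · exact Or.inl h
    · right
      refine ⟨l - a, ?_, by beta_reduce; omega⟩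
      rintro ⟨v, hv, hv0, hvw⟩
      refine hl ⟨f * v, ⟨v, hv, rfl⟩, mul_ne_zero hf hv0, ?_⟩
      rw [w.mul' _ _ hf hv0, ha, hvw]
      push Not at h
      push_cast [h]
      ring
  have hfin1 : ((fun l => a + l) '' gaps w 1 A.toSubmodule).Finite := hfin.image _
  have hfin2 : (gaps w 1 W).Finite := ((Set.finite_Iio a).union hfin1).subset hgap
  have hcard : (gaps w 1 W).ncard ≤ a + (gaps w 1 A.toSubmodule).ncard := by
    refine (Set.ncard_le_ncard hgap ((Set.finite_Iio a).union hfin1)).trans ?_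
    refine (Set.ncard_union_le _ _).trans ?_
    refine add_le_add ?_ (Set.ncard_image_le hfin)
    rw [Set.ncard_eq_toFinset_card']; simp
  obtain ⟨hfd, hdim⟩ := dim_quot w one_pos hW hG hfin2
  have hle : Module.finrank F (A.toSubmodule ⧸ W.submoduleOf A.toSubmodule) ≤ a := by omega
  refine le_trans ?_ hle
  let ev : A.toSubmodule →ₗ[F] (S → F) := LinearMap.pi fun i => (ψ i).toLinearMap
  have hker : W.submoduleOf A.toSubmodule ≤ LinearMap.ker ev := by
    rintro ⟨v, hv⟩ hvW
    obtain ⟨g, hg, hgv⟩ : v ∈ W := hvW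
    have hv' : (⟨v, hv⟩ : A) = f * ⟨g, hg⟩ := Subtype.ext hgv.symm
    rw [LinearMap.mem_ker]
    ext i
    change ψ i (⟨v, hv⟩ : A) = 0
    rw [hv', map_mul, hS i i.2, zero_mul]
  have hsurj : Function.Surjective ((W.submoduleOf A.toSubmodule).liftQ ev hker) := by
    intro v
    obtain ⟨g, hg⟩ := ev_surj A (fun i : S => ψ i) (hψ.comp Subtype.val_injective) v
    refine ⟨Submodule.Quotient.mk g, ?_⟩
    ext i
    exact hg i
  have := LinearMap.finrank_le_finrank_of_surjective hsurj
  simpa using this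

include hfin in
lemma pairs_card (l : ℕ) : ∃ T : Finset ℕ, l + 1 ≤ T.card + 2 * (gaps w 1 A.toSubmodule).ncard ∧
    ∀ μ ∈ T, μ ≤ l ∧ μ ∉ gaps w 1 A.toSubmodule ∧ l - μ ∉ gaps w 1 A.toSubmodule := by
  classical
  let G := hfin.toFinset
  have hGc : G.card = (gaps w 1 A.toSubmodule).ncard := (Set.ncard_eq_toFinset_card _ hfin).symm
  refine ⟨(Finset.range (l + 1) \ G) \ (G.image fun g => l - g), ?_, ?_⟩
  · have h1 := Finset.le_card_sdiff G (Finset.range (l + 1))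
    have h2 := Finset.le_card_sdiff (G.image fun g => l - g) (Finset.range (l + 1) \ G)
    have h3 := Finset.card_image_le (s := G) (f := fun g => l - g)
    rw [Finset.card_range] at h1
    omega
  · intro μ hμ
    simp only [Finset.mem_sdiff, Finset.mem_range, Finset.mem_image, not_exists, not_and] at hμ
    obtain ⟨⟨h1, h2⟩, h3⟩ := hμ
    refine ⟨by omega, fun h => h2 (hfin.mem_toFinset.2 h), fun h => ?_⟩
    exact h3 _ (hfin.mem_toFinset.2 h) (by omega)

include hfin in
lemma mem_semigroup (l : ℕ) (hl : 2 * (gaps w 1 A.toSubmodule).ncard ≤ l) :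
    ∃ f : A, (f : K) ≠ 0 ∧ w.wt f = l := by
  obtain ⟨T, hT, hT2⟩ := pairs_card w hfin l
  have : 0 < T.card := by omega
  obtain ⟨μ, hμ⟩ := Finset.card_pos.1 this
  obtain ⟨h1, h2, h3⟩ := hT2 μ hμ
  simp only [gaps, Set.mem_ofPred_eq, not_not] at h2 h3
  obtain ⟨f, hf, hf0, hfw⟩ := h2
  obtain ⟨g, hg, hg0, hgw⟩ := h3
  refine ⟨⟨f * g, A.mul_mem hf hg⟩, mul_ne_zero hf0 hg0, ?_⟩
  change w.wt (f * g) = l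
  rw [w.mul' _ _ hf0 hg0, hfw, hgw]
  push_cast [h1]
  ring

include hfin in
/-- weights above the conductor are realised in the vanishing ideal of few points -/
lemma ideal_weight (S : Finset ι) (l : ℕ) (hl : S.card + 2 * (gaps w 1 A.toSubmodule).ncard ≤ l) :
    ∃ f : A, (∀ i ∈ S, ψ i f = 0) ∧ (f : K) ≠ 0 ∧ w.wt f = l := by
  classical
  by_contra! hcon
  obtain ⟨T, hT, hT2⟩ := pairs_card w hfin l
  have hex : ∀ μ : T, ∃ f : A, (f : K) ≠ 0 ∧ w.wt f = (μ : ℕ) := by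
    intro μ
    have := (hT2 μ μ.2).2.1
    simp only [gaps, Set.mem_ofPred_eq, not_not] at this
    obtain ⟨v, hv, h0, hw⟩ := this
    exact ⟨⟨v, hv⟩, h0, by simpa using hw⟩
  choose f hf0 hfw using hex
  let ev : A →ₗ[F] (S → F) := LinearMap.pi fun i => (ψ i).toLinearMap
  have hli : LinearIndependent F fun μ => ev (f μ) := by
    rw [Fintype.linearIndependent_iff]
    intro c hc
    by_contra! hne
    obtain ⟨i, hi⟩ := hne
    obtain ⟨j, -, hj0, hs0, hsw, -⟩ := w.sum_distinct Finset.univ (fun μ => c μ • (f μ : K)) (by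
      intro i _ j _ hi hj hij
      have hi' : c i ≠ 0 := by rintro h; simp [h] at hi
      have hj' : c j ≠ 0 := by rintro h; simp [h] at hj
      rw [w.smul _ hi' _ (hf0 i), w.smul _ hj' _ (hf0 j), hfw, hfw] at hij
      exact Subtype.ext (by exact_mod_cast hij)) ⟨i, Finset.mem_univ _, smul_ne_zero hi (hf0 i)⟩
    have hj' : c j ≠ 0 := by rintro h; simp [h] at hj0
    rw [w.smul _ hj' _ (hf0 j), hfw] at hsw
    have h3 := (hT2 j j.2).2.2
    have h1 := (hT2 j j.2).1
    simp only [gaps, Set.mem_ofPred_eq, not_not] at h3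
    obtain ⟨g, hg, hg0, hgw⟩ := h3
    let s : A := ∑ μ, c μ • f μ
    have hs : (s : K) = ∑ μ, c μ • (f μ : K) := by simp [s]
    have hev : ev s = 0 := by
      simp only [s, map_sum, map_smul]; exact hc
    refine hcon (s * ⟨g, hg⟩) ?_ ?_ ?_
    · intro i hi
      have : ψ i s = 0 := congrFun hev ⟨i, hi⟩
      rw [map_mul, this, zero_mul]
    · change (s : K) * g ≠ 0
      rw [hs]; exact mul_ne_zero hs0 hg0
    · change w.wt ((s : K) * g) = l
      rw [hs, w.mul' _ _ hs0 hg0, hsw, hgw]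
      push_cast [h1]
      ring
  have := hli.fintype_card_le_finrank
  simp at this
  omega

include hψ hG hfin in
lemma ev_Lb_surj (S : Finset ι) (b : ℕ)
    (hb : S.card + 2 * (gaps w 1 A.toSubmodule).ncard ≤ b + 1) (v : ι → F) :
    ∃ f ∈ Lb w A b, ∀ i ∈ S, ψ i f = v i := by
  have key : ∀ N : ℕ, ∀ f : A, (f : K) = 0 ∨ w.wt f < N → ∃ f' ∈ Lb w A b, ∀ i ∈ S, ψ i f' = ψ i f := by
    intro N
    induction N with
    | zero =>
      intro f hf
      refine ⟨f, ?_, fun _ _ => rfl⟩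
      exact hf.imp id fun h => by push_cast at h; omega
    | succ N ih =>
      intro f hf
      by_cases h0 : (f : K) = 0
      · exact ⟨f, Or.inl h0, fun _ _ => rfl⟩
      by_cases hle : w.wt f ≤ b
      · exact ⟨f, Or.inr hle, fun _ _ => rfl⟩
      have hlt := hf.resolve_left h0
      obtain ⟨l, hl⟩ := hG f f.2 h0
      obtain ⟨g, hgS, hg0, hgw⟩ := ideal_weight w ψ hfin S l (by push_cast at hl; omega)
      obtain ⟨c, hc⟩ := w.lead' f g h0 hg0 (by rw [hl, hgw]; push_cast; ring)
      obtain ⟨f', hf', hf2⟩ := ih (f - c • g) (by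
        refine hc.imp (fun h => by simpa using h) fun h => ?_
        have : ((f - c • g : A) : K) = f - c • (g : K) := by simp
        rw [this]; push_cast at hlt; omega)
      refine ⟨f', hf', fun i hi => ?_⟩
      rw [hf2 i hi, map_sub, map_smul, hgS i hi, smul_zero, sub_zero]
  obtain ⟨f, hf⟩ := ev_surj A ψ hψ v
  by_cases h0 : (f : K) = 0
  · exact ⟨f, Or.inl h0, fun i _ => hf i⟩
  obtain ⟨l, hl⟩ := hG f f.2 h0
  obtain ⟨f', h1, h2⟩ := key (l + 1) f (Or.inr (by rw [hl]; push_cast; omega))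
  exact ⟨f', h1, fun i hi => (h2 i hi).trans (hf i)⟩

end agcode

section agcode2
variable {F K : Type*} [Field F] [Field K] [Algebra F K] (w : WtF F K)
  (A : Subalgebra F K)

theorem ag_code (n : ℕ) (ψ : Fin n → (A →ₐ[F] F)) (hψ : Function.Injective ψ)
    (hG : Good w 1 A.toSubmodule) (hfin : (gaps w 1 A.toSubmodule).Finite) (g a b d : ℕ)
    (hg : (gaps w 1 A.toSubmodule).ncard ≤ g) (hba : b < a) (han : a + d ≤ n) (hd : 0 < d)
    (hb : d + 2 * g ≤ b + 2) :
    ∃ C : Submodule F ((Fin n ⊕ Fin n) → F), sympOrth (C : Set ((Fin n ⊕ Fin n) → F)) ⊆ C ∧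
      n + a ≤ Module.finrank F C + b ∧
      d ≤ minSympDist (C : Set ((Fin n ⊕ Fin n) → F)) := by
  classical
  let ev : A →ₗ[F] (Fin n → F) := LinearMap.pi fun i => (ψ i).toLinearMap
  have hev : ∀ f i, ev f i = ψ i f := fun _ _ => rfl
  let E : ℕ → Submodule F (Fin n → F) := fun b => (Lb w A b).map ev
  have hstep : ∀ l, b ≤ l → l < a → E l < E (l + 1) := by
    intro l hbl hla
    have hle : E l ≤ E (l + 1) := by
      apply Submodule.map_mono
      intro f hf
      exact Or.imp id (fun h => by push_cast; omega) hf
    refine lt_of_le_of_ne hle fun heq => ?_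
    obtain ⟨f, hf0, hfw⟩ := mem_semigroup w hfin (l + 1) (by omega)
    have hmem : ev f ∈ E l := by
      rw [heq]; exact ⟨f, Or.inr hfw.le, rfl⟩
    obtain ⟨f', hf', he⟩ := hmem
    have h1 := w.add_of_lt (f : K) (-f' : K) hf0 (by
      rw [w.neg]
      exact Or.imp (fun h => by simpa using h) (fun h => by omega) hf')
    have h2 : ((f - f' : A) : K) = f + -f' := by simp [sub_eq_add_neg]
    have := zeros_le w ψ hψ hG hfin (f - f') (by rw [h2]; exact h1.1) (l + 1)
      (by rw [h2, h1.2, hfw]) Finset.univ (by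
        intro i _
        have := congrFun he i
        rw [hev, hev] at this
        rw [map_sub, this, sub_self])
    simp at this
    omega
  have hdim : ∀ t, b + t ≤ a → Module.finrank F (E b) + t ≤ Module.finrank F (E (b + t)) ∧
      (0 < t → E b < E (b + t)) := by
    intro t
    induction t with
    | zero => intro _; simp
    | succ t ih =>
      intro ht
      have h1 := ih (by omega)
      have h2 := hstep (b + t) (by omega) (by omega)
      have h3 := Submodule.finrank_lt_finrank_of_lt h2
      refine ⟨by rw [← add_assoc b]; omega, fun _ => ?_⟩
      rcases Nat.eq_zero_or_pos t with h0 | h0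
      · subst h0; simpa using h2
      · exact (h1.2 h0).trans h2
  obtain ⟨t, rfl⟩ := Nat.exists_eq_add_of_lt hba
  obtain ⟨hd1, hd2⟩ := hdim (t + 1) (by omega)
  obtain ⟨C, hC1, hC2, hC3⟩ := code_pair n (E (b + t + 1)) (E b) (hd2 (by omega)) d (by
      rintro _ ⟨f, hf, rfl⟩ hne
      have hf0 : (f : K) ≠ 0 := by
        intro h
        apply hne
        have : f = 0 := Subtype.ext h
        rw [this, map_zero]
      obtain ⟨l, hl⟩ := hG f f.2 hf0
      have hla := Or.resolve_left hf hf0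
      have := zeros_le w ψ hψ hG hfin f hf0 l (by rw [hl]; simp) (Finset.univ.filter fun i => ψ i f = 0)
        (by simp)
      have h3 := Finset.card_filter_add_card_filter_not (s := (Finset.univ : Finset (Fin n))) (fun i => ψ i f = 0)
      have h4 : {i | ev f i ≠ 0} = ((Finset.univ.filter fun i => ¬ ψ i f = 0 : Finset (Fin n)) : Set (Fin n)) := by
        ext i; simp [hev]
      rw [h4, Set.ncard_coe_finset]
      simp only [Finset.card_univ, Fintype.card_fin] at h3
      omega) (by
      intro y hy hy0
      by_contra! hlt
      set S := (Finset.univ.filter fun i => y i ≠ 0 : Finset (Fin n)) with hS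
      have h4 : {i | y i ≠ 0} = (S : Set (Fin n)) := by
        ext i; simp [S]
      rw [h4, Set.ncard_coe_finset] at hlt
      apply hy0
      ext i
      obtain ⟨f, hf, hfi⟩ := ev_Lb_surj w ψ hψ hG hfin S b (by omega) (Pi.single i 1)
      have := hy (ev f) ⟨f, hf, rfl⟩
      have h5 : ev f ⬝ᵥ y = Pi.single i 1 ⬝ᵥ y := by
        unfold dotProduct
        refine Finset.sum_congr rfl fun j _ => ?_
        by_cases hj : y j = 0
        · rw [hj, mul_zero, mul_zero]
        · rw [hev, hfi j (by simp [S, hj])]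
      rw [h5] at this
      simpa using this)
  exact ⟨C, hC1, by rw [← add_assoc b] at hd1; omega, hC3⟩

end agcode2
end GS

open Filter
namespace GS

lemma real_final {F : Type*} [Field F] (q : ℕ) (hq : 4 ≤ q) (R : ℝ) (hR0 : 0 ≤ R) (hR1 : R ≤ 1)
    (n g : ℕ → ℕ) (hg : ∀ i, n i = (q - 1) * g i) (hg1 : ∀ i, 1 ≤ g i)
    (hn : Tendsto n atTop atTop)
    (H : ∀ i a b d : ℕ, b < a → a + d ≤ n i → 0 < d → d + 2 * g i ≤ b + 2 →
      ∃ C : Submodule F ((Fin (n i) ⊕ Fin (n i)) → F),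
        sympOrth (C : Set ((Fin (n i) ⊕ Fin (n i)) → F)) ⊆ C ∧
        n i + a ≤ Module.finrank F C + b ∧
        d ≤ minSympDist (C : Set ((Fin (n i) ⊕ Fin (n i)) → F))) :
    ∃ (n : ℕ → ℕ) (C : (i : ℕ) → Submodule F ((Fin (n i) ⊕ Fin (n i)) → F)),
      (∀ i, sympOrth ((C i : Set ((Fin (n i) ⊕ Fin (n i)) → F)))
              ⊆ (C i : Set ((Fin (n i) ⊕ Fin (n i)) → F))) ∧
      Tendsto n atTop atTop ∧
      R ≤ liminf (fun i =>
            ((Module.finrank F (C i) : ℝ) - (n i : ℝ)) / (n i : ℝ)) atTop ∧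
      (1 - R - 2 / ((q : ℝ) - 1)) / 2
        ≤ liminf (fun i =>
            ((minSympDist (C i : Set ((Fin (n i) ⊕ Fin (n i)) → F)) : ℝ))
              / (n i : ℝ)) atTop := by
  set δ : ℝ := (1 - R - 2 / ((q : ℝ) - 1)) / 2 with hδ
  have hq1 : (0 : ℝ) < (q : ℝ) - 1 := by
    have : (4 : ℝ) ≤ q := by exact_mod_cast hq
    linarith
  have hnpos : ∀ i, 1 ≤ n i := by
    intro i
    rw [hg i]
    exact Nat.mul_pos (by omega) (hg1 i)
  have hnR : ∀ i, (0 : ℝ) < n i := fun i => by exact_mod_cast hnpos i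
  have hnq : ∀ i, (n i : ℝ) = ((q : ℝ) - 1) * g i := by
    intro i
    rw [hg i]
    push_cast [show 1 ≤ q by omega]
    ring
  have key : ∀ i, ∃ C : Submodule F ((Fin (n i) ⊕ Fin (n i)) → F),
        sympOrth (C : Set ((Fin (n i) ⊕ Fin (n i)) → F)) ⊆ C ∧
        R * n i ≤ (Module.finrank F C : ℝ) - n i ∧
        δ * n i ≤ minSympDist (C : Set ((Fin (n i) ⊕ Fin (n i)) → F)) := by
    intro i
    by_cases hδ0 : δ ≤ 0
    · refine ⟨⊤, fun _ _ => Submodule.mem_top, ?_, ?_⟩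
      · rw [finrank_top]
        simp only [Module.finrank_fintype_fun_eq_card, Fintype.card_sum, Fintype.card_fin]
        push_cast
        nlinarith [hnR i]
      · exact (mul_nonpos_of_nonpos_of_nonneg hδ0 (hnR i).le).trans (by positivity)
    · push Not at hδ0
      have hd0 : 0 < δ * n i := mul_pos hδ0 (hnR i)
      have hδn : 2 * (δ * n i) = (1 - R) * n i - 2 * g i := by
        rw [hδ, hnq]; field_simp
      have hc1 := Nat.le_ceil (δ * n i)
      have hc2 := Nat.ceil_lt_add_one hd0.le
      have hr0 : 0 ≤ R * n i := mul_nonneg hR0 (hnR i).le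
      have hf1 := Nat.floor_le hr0
      have hf2 := Nat.lt_floor_add_one (R * n i)
      set d := ⌈δ * n i⌉₊
      set r := ⌊R * n i⌋₊
      have hdpos : 0 < d := Nat.ceil_pos.2 hd0
      have hgR : (1 : ℝ) ≤ g i := by exact_mod_cast hg1 i
      have hmain : 2 * d + 2 * g i + r < n i + 2 := by
        have : (2 * d + 2 * g i + r : ℝ) < n i + 2 := by nlinarith
        exact_mod_cast this
      have := hg1 i
      obtain ⟨C, h1, h2, h3⟩ := H i (n i - d) (n i - d - (r + 1)) d (by omega) (by omega) hdpos (by omega)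
      refine ⟨C, h1, ?_, ?_⟩
      · have h4 : n i + (r + 1) ≤ Module.finrank F C := by omega
        have h5 : (n i + (r + 1) : ℝ) ≤ Module.finrank F C := by exact_mod_cast h4
        linarith
      · exact hc1.trans (by exact_mod_cast h3)
  choose C h1 h2 h3 using key
  refine ⟨n, C, h1, hn, ?_, ?_⟩
  · refine le_liminf_of_le (isCoboundedUnder_ge_of_le (x := 1) atTop ?_) (Eventually.of_forall ?_)
    · intro i
      rw [div_le_one (hnR i)]
      have : Module.finrank F (C i) ≤ n i + n i := by
        simpa using (C i).finrank_le
      have : (Module.finrank F (C i) : ℝ) ≤ n i + n i := by exact_mod_cast this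
      linarith
    · intro i
      rw [le_div_iff₀ (hnR i)]; exact h2 i
  · refine le_liminf_of_le (isCoboundedUnder_ge_of_le (x := 1) atTop ?_) (Eventually.of_forall ?_)
    · intro i
      rw [div_le_one (hnR i)]
      exact_mod_cast minSympDist_le _ _
    · intro i
      rw [le_div_iff₀ (hnR i)]; exact h3 i

end GS


set_option linter.unusedSectionVars false

namespace GS

/-- the Garcia--Stichtenoth tower, as a sequence of elements of a field -/
structure Tow (K : Type*) [Field K] (q L : ℕ) where
  m : ℕ
  hm : 1 ≤ m
  hq : q = 2 ^ m
  x : ℕ → K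
  ne : ∀ i, i ≤ L → x i ≠ 0
  rel : ∀ i, i < L → (x (i + 1) ^ q + x (i + 1)) * (x i ^ q + x i) = x i ^ (q + 1)

section tower
variable {K : Type*} [Field K] [CharP K 2] {q L : ℕ} (T : Tow K q L)

namespace Tow

include T

lemma two_le : 2 ≤ q := by
  rw [T.hq]
  calc 2 = 2 ^ 1 := rfl
    _ ≤ 2 ^ T.m := Nat.pow_le_pow_right (by norm_num) T.hm

def ww (i : ℕ) : K := T.x i ^ (q - 1) + 1

lemma pow_q (z : K) : z ^ q = z * z ^ (q - 1) := by
  rw [← pow_succ', Nat.sub_add_cancel (by have := T.two_le; omega)]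

lemma phi_eq (i : ℕ) : T.x i ^ q + T.x i = T.x i * T.ww i := by
  rw [ww, T.pow_q]; ring

lemma add_pow_q (a b : K) : (a + b) ^ q = a ^ q + b ^ q := by
  rw [T.hq]
  exact add_pow_char_pow a b 2 T.m

lemma rel' (i : ℕ) (hi : i < L) : (T.x (i + 1) ^ q + T.x (i + 1)) * T.ww i = T.x i ^ q := by
  have h := T.rel i hi
  rw [T.phi_eq i, pow_succ] at h
  have h0 := T.ne i hi.le
  apply mul_left_cancel₀ h0
  linear_combination h

lemma ww_ne (i : ℕ) (hi : i < L) : T.ww i ≠ 0 := by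
  intro h
  have h1 := T.rel' i hi
  rw [h, mul_zero] at h1
  exact pow_ne_zero q (T.ne i hi.le) h1.symm

lemma phi_ne (i : ℕ) (hi : i < L) : T.x i ^ q + T.x i ≠ 0 := by
  rw [T.phi_eq]; exact mul_ne_zero (T.ne i hi.le) (T.ww_ne i hi)

section val
variable {Γ : Type*} [LinearOrderedCommGroupWithZero Γ] (v : Valuation K Γ)

lemma v_phi_lt (z : K) (hz : v z < 1) : v (z ^ q + z) = v z := by
  by_cases h0 : z = 0
  · have := T.two_le
    simp [h0, show q ≠ 0 by omega]
  have h1 : v (z ^ (q - 1)) < 1 := by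
    rw [map_pow]; exact pow_lt_one₀ zero_le hz (by have := T.two_le; omega)
  have : z ^ q + z = z * (1 + z ^ (q - 1)) := by rw [T.pow_q]; ring
  rw [this, map_mul, v.map_one_add_of_lt h1, mul_one]

lemma v_phi_gt (z : K) (hz : 1 < v z) : v (z ^ q + z) = v z ^ q := by
  have h0 : z ≠ 0 := by rintro rfl; simp at hz
  have h2 := T.two_le
  have h1 : v z < v (z ^ q) := by
    rw [map_pow]
    exact lt_self_pow₀ hz (by omega)
  rw [Valuation.map_add_eq_of_lt_left v h1, map_pow]

lemma v_phi_le (z : K) (hz : v z ≤ 1) : v (z ^ q + z) ≤ 1 :=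
  (v.map_add _ _).trans (max_le (by rw [map_pow]; exact pow_le_one₀ zero_le hz) hz)

lemma v_le_of_phi (z : K) (hz : v (z ^ q + z) ≤ 1) : v z ≤ 1 := by
  by_contra! h
  rw [T.v_phi_gt v z h] at hz
  exact absurd hz (not_le.2 (one_lt_pow₀ h (by have := T.two_le; omega)))

lemma v_of_phi_gt (z : K) (hz : 1 < v (z ^ q + z)) : 1 < v z ∧ v z ^ q = v (z ^ q + z) := by
  have h : 1 < v z := by
    by_contra! h
    exact absurd (T.v_phi_le v z h) (not_le.2 hz)
  exact ⟨h, (T.v_phi_gt v z h).symm⟩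

lemma v_ww_lt (i : ℕ) (h : v (T.x i) < 1) : v (T.ww i) = 1 := by
  rw [ww, add_comm]
  apply v.map_one_add_of_lt
  rw [map_pow]; exact pow_lt_one₀ zero_le h (by have := T.two_le; omega)

lemma v_ww_gt (i : ℕ) (h : 1 < v (T.x i)) : v (T.ww i) = v (T.x i) ^ (q - 1) := by
  rw [ww, ← map_pow]
  apply v.map_add_eq_of_lt_left
  rw [map_one, map_pow]
  exact one_lt_pow₀ h (by have := T.two_le; omega)

/-- the zeros of `w_i` -/
def Ty (i : ℕ) : Prop := (∀ j < i, v (T.x j) < 1) ∧ v (T.x i) = 1 ∧ v (T.ww i) < 1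

/-- value of `φ(x_0)` -/
def eps : Γ := v (T.x 0 ^ q + T.x 0)

lemma v_rel (i : ℕ) (hi : i < L) :
    v (T.x (i + 1) ^ q + T.x (i + 1)) * v (T.ww i) = v (T.x i) ^ q := by
  rw [← map_mul, T.rel' i hi, map_pow]

lemma tri (h0 : v (T.x 0) ≤ 1) (N : ℕ) (hN : N ≤ L) :
    (∀ j ≤ N, v (T.x j) = 1 ∧ v (T.ww j) = 1) ∨
    (T.eps v < 1 ∧ ∀ j ≤ N, v (T.x j) = T.eps v ^ q ^ j) ∨
    ∃ i ≤ N, T.Ty v i ∧ T.eps v < 1 ∧ v (T.ww i) = T.eps v ^ q ^ i ∧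
      ∀ j < i, v (T.x j) = T.eps v ^ q ^ j := by
  have hq2 := T.two_le
  induction N with
  | zero =>
    rcases h0.lt_or_eq with h | h
    · right; left
      have := T.v_phi_lt v _ h
      refine ⟨by rw [eps, this]; exact h, ?_⟩
      intro j hj
      obtain rfl : j = 0 := by omega
      rw [eps, this]; simp
    · have hw : v (T.ww 0) ≤ 1 := by
        rw [ww]
        refine (v.map_add _ _).trans ?_
        simp [h]
      have he : T.eps v = v (T.ww 0) := by rw [eps, T.phi_eq, map_mul, h, one_mul]
      rcases hw.lt_or_eq with h' | h'
      · right; right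
        refine ⟨0, le_rfl, ⟨by simp, h, h'⟩, he ▸ h', by simp [he], by simp⟩
      · left
        intro j hj
        obtain rfl : j = 0 := by omega
        exact ⟨h, h'⟩
  | succ N ih =>
    rcases ih (by omega) with h | h | h
    · left
      intro j hj
      rcases Nat.lt_or_eq_of_le hj with h1 | rfl
      · exact h j (by omega)
      · have hr := T.v_rel v N (by omega)
        rw [(h N le_rfl).1, (h N le_rfl).2, mul_one, one_pow] at hr
        have hle := T.v_le_of_phi v _ hr.le
        have hw : v (T.ww (N + 1)) ≤ 1 := by
          rw [ww]
          refine (v.map_add _ _).trans ?_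
          simp only [map_pow, map_one]
          exact max_le (pow_le_one₀ zero_le hle) le_rfl
        rw [T.phi_eq, map_mul] at hr
        constructor
        · apply le_antisymm hle
          rw [← hr]
          exact mul_le_of_le_one_right' hw
        · apply le_antisymm hw
          rw [← hr]
          exact mul_le_of_le_one_left' hle
    · obtain ⟨he, h⟩ := h
      have hN1 : v (T.x N) < 1 := by
        rw [h N le_rfl]; exact pow_lt_one₀ zero_le he (by positivity)
      have hr := T.v_rel v N (by omega)
      rw [T.v_ww_lt v N hN1, mul_one, h N le_rfl, ← pow_mul, ← pow_succ] at hr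
      have hlt : v (T.x (N + 1) ^ q + T.x (N + 1)) < 1 := by
        rw [hr]; exact pow_lt_one₀ zero_le he (by positivity)
      have hle := T.v_le_of_phi v _ hlt.le
      right
      rcases hle.lt_or_eq with h1 | h1
      · left
        refine ⟨he, fun j hj => ?_⟩
        rcases Nat.lt_or_eq_of_le hj with h2 | rfl
        · exact h j (by omega)
        · rw [← hr, T.v_phi_lt v _ h1]
      · right
        rw [T.phi_eq, map_mul, h1, one_mul] at hr hlt
        refine ⟨N + 1, le_rfl, ⟨fun j hj => ?_, h1, hlt⟩, he, hr, fun j hj => h j (by omega)⟩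
        rw [h j (by omega)]; exact pow_lt_one₀ zero_le he (by positivity)
    · obtain ⟨i, hi, h⟩ := h
      right; right
      exact ⟨i, by omega, h⟩

/-- beyond index `i` at type `i` -/
lemma ty_gt (i : ℕ) (hT : T.Ty v i) (j : ℕ) (hj : i + j + 1 ≤ L) :
    1 < v (T.x (i + j + 1)) ∧ v (T.x (i + j + 1)) ^ q ^ (j + 1) * v (T.ww i) = 1 := by
  have hq2 := T.two_le
  have hwi : v (T.ww i) ≠ 0 := (v.ne_zero_iff).2 (T.ww_ne i (by omega))
  induction j with
  | zero =>
    have hr := T.v_rel v i (by omega)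
    rw [hT.2.1, one_pow] at hr
    have : 1 < v (T.x (i + 1) ^ q + T.x (i + 1)) := by
      by_contra! h
      have := mul_lt_one_of_nonneg_of_lt_one_right h zero_le hT.2.2
      rw [hr] at this
      exact lt_irrefl _ this
    have h2 := T.v_of_phi_gt v _ this
    refine ⟨h2.1, ?_⟩
    simp only [add_zero, zero_add, pow_one]
    rw [h2.2, hr]
  | succ j ih =>
    obtain ⟨h1, h2⟩ := ih (by omega)
    have hr := T.v_rel v (i + j + 1) (by omega)
    rw [T.v_ww_gt v _ h1] at hr
    have hp : v (T.x (i + j + 1)) ^ (q - 1) ≠ 0 := pow_ne_zero _ (by rintro h; simp [h] at h1)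
    have hr2 : v (T.x (i + j + 1 + 1) ^ q + T.x (i + j + 1 + 1)) = v (T.x (i + j + 1)) := by
      apply mul_right_cancel₀ hp
      rw [hr, ← pow_succ', Nat.sub_add_cancel (by omega)]
    have h3 := T.v_of_phi_gt v _ (hr2 ▸ h1)
    refine ⟨h3.1, ?_⟩
    rw [show i + (j + 1) + 1 = i + j + 1 + 1 by ring, pow_succ q, mul_comm (q ^ (j + 1)), pow_mul,
      h3.2, hr2, h2]

/-- partial products of the `w_j` for `j < n` -/
def hh (n : ℕ) : K := ∏ j ∈ Finset.range n, T.ww j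

lemma hh_sub_one (n : ℕ) (e : Γ) (he1 : e ≤ 1) (h : ∀ j < n, v (T.x j) ≤ e) :
    v (T.hh n + 1) ≤ e := by
  have hq2 := T.two_le
  induction n with
  | zero => simp [hh, CharTwo.add_self_eq_zero]
  | succ n ih =>
    have h1 := ih fun j hj => h j (by omega)
    have h2 := h n (by omega)
    have : T.hh (n + 1) + 1 = (T.hh n + 1) * T.ww n + T.x n ^ (q - 1) := by
      rw [hh, Finset.prod_range_succ, ← hh, ww]
      linear_combination (-(T.x n) ^ (q - 1)) * CharTwo.two_eq_zero (R := K)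
    rw [this]
    have h3 : v (T.x n ^ (q - 1)) ≤ e := by
      rw [map_pow]
      refine (pow_le_of_le_one zero_le (h2.trans he1) (by omega)).trans h2
    refine (v.map_add _ _).trans (max_le ?_ h3)
    rw [map_mul]
    refine (mul_le_of_le_one_right' ?_).trans h1
    rw [ww]
    exact (v.map_add _ _).trans (max_le (h3.trans he1) (by simp))

/-- at type `i` the product `h_{n}`, `n = i + 1 + j`, has small value -/
lemma hh_ty (i : ℕ) (hT : T.Ty v i) (j : ℕ) (hj : i + j < L) (e : Γ) (he1 : e < 1)
    (hlt : ∀ j < i, v (T.x j) ≤ e) :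
    v (T.hh (i + j + 1)) ^ q ^ j = v (T.ww i) := by
  have hq2 := T.two_le
  induction j with
  | zero =>
    have h1 := T.hh_sub_one v i e he1.le hlt
    have h2 : v (T.hh i) = 1 := by
      have : T.hh i = 1 + (T.hh i + 1) := by
        linear_combination (-1) * CharTwo.two_eq_zero (R := K)
      rw [this]
      exact v.map_one_add_of_lt (h1.trans_lt he1)
    rw [hh, add_zero, Finset.prod_range_succ, ← hh, map_mul, h2]
    simp
  | succ j ih =>
    have h1 := ih (by omega)
    obtain ⟨h2, h3⟩ := T.ty_gt v i hT j (by omega)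
    rw [show i + (j + 1) + 1 = (i + j + 1) + 1 by ring, hh, Finset.prod_range_succ, ← hh, map_mul,
      T.v_ww_gt v _ h2, mul_pow, pow_succ q, mul_comm (q ^ j), pow_mul, pow_mul]
    have hne : v (T.x (i + j + 1)) ^ q ^ (j + 1) ≠ 0 := by
      intro h; rw [h, zero_mul] at h3; exact zero_ne_one h3
    have e1 : ((v (T.hh (i + j + 1))) ^ q) ^ q ^ j = v (T.ww i) ^ q := by
      rw [← h1, ← pow_mul, ← pow_mul, mul_comm]
    have e2 : ((v (T.x (i + j + 1)) ^ (q - 1)) ^ q) ^ q ^ j =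
        (v (T.x (i + j + 1)) ^ q ^ (j + 1)) ^ (q - 1) := by
      rw [← pow_mul, ← pow_mul, ← pow_mul, pow_succ q]; congr 1; ring
    rw [e1, e2]
    have : v (T.ww i) ^ q = v (T.ww i) * v (T.ww i) ^ (q - 1) := by
      rw [← pow_succ', Nat.sub_add_cancel (by omega)]
    rw [this, mul_assoc, ← mul_pow, mul_comm (v (T.ww i)) (v (T.x (i + j + 1)) ^ q ^ (j + 1)), h3, one_pow, mul_one]

end val
end Tow
end tower
end GS


set_option linter.unusedSectionVars false

namespace GS
section tower
variable {K : Type*} [Field K] [CharP K 2] {q L : ℕ} (T : Tow K q L)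

namespace Tow

include T

/-- the inverse relation -/
lemma inv_rel (j : ℕ) (hj : j < L) :
    (1 / T.x j) ^ q + 1 / T.x j = 1 / (T.x (j + 1) ^ q + T.x (j + 1)) := by
  have h := T.rel j hj
  have h0 := T.ne j hj.le
  have h1 : T.x (j + 1) ^ q + T.x (j + 1) ≠ 0 := by
    intro h1; rw [h1, zero_mul] at h
    exact pow_ne_zero _ h0 h.symm
  have e : (T.x j ^ q + T.x j) / T.x j ^ (q + 1) = 1 / (T.x (j + 1) ^ q + T.x (j + 1)) := by
    rw [div_eq_div_iff (pow_ne_zero _ h0) h1]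
    linear_combination h
  rw [← e, div_pow, one_pow, pow_succ]
  field_simp
  ring

section val
variable {Γ : Type*} [LinearOrderedCommGroupWithZero Γ] (v : Valuation K Γ)

/-- key computation -/
lemma phi_D (i l : ℕ) (hl : l + 1 ≤ i) (hi : i + l + 1 ≤ L) :
    (T.x (i + l + 1) + T.x i ^ 2 / T.x (i - l - 1)) ^ q + (T.x (i + l + 1) + T.x i ^ 2 / T.x (i - l - 1)) =
    (T.x (i + l) ^ q / T.ww (i + l)) + (T.x i * T.ww i) ^ 2 / T.x (i - l - 1) ^ q
      + T.x i ^ 2 / (T.x (i - l) * T.ww (i - l)) := by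
  have h1 := T.rel' (i + l) (by omega)
  have h2 := T.inv_rel (i - l - 1) (by omega)
  rw [show i - l - 1 + 1 = i - l by omega, T.phi_eq] at h2
  have h3 := T.phi_eq i
  have hw := T.ww_ne (i + l) (by omega)
  have e1 : T.x (i + l) ^ q / T.ww (i + l) = T.x (i + l + 1) ^ q + T.x (i + l + 1) := by
    rw [← h1]; field_simp
  rw [e1, T.add_pow_q, ← h3, div_pow]
  have e2 : T.x i ^ 2 / (T.x (i - l) * T.ww (i - l)) = T.x i ^ 2 * ((1 / T.x (i - l - 1)) ^ q + 1 / T.x (i - l - 1)) := by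
    rw [h2]; ring
  rw [e2, div_pow, one_pow]
  have := T.ne (i - l - 1) (by omega)
  field_simp
  linear_combination (-(T.x i ^ 2) - (T.x i) ^ (q + 1)) * T.x (i - l - 1) * CharTwo.two_eq_zero (R := K)

lemma lemR (i : ℕ) (hT : T.Ty v i) (hwi : v (T.ww i) = T.eps v ^ q ^ i) (he : T.eps v < 1)
    (hx : ∀ j < i, v (T.x j) = T.eps v ^ q ^ j) (l : ℕ) (hl : l + 1 ≤ i) (hi : i + l + 1 ≤ L) :
    v (T.x (i + l + 1) + T.x i ^ 2 / T.x (i - l - 1)) ≤ 1 := by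
  have hq2 := T.two_le
  have hbound : ∀ l, l + 1 ≤ i → v ((T.x i * T.ww i) ^ 2 / T.x (i - l - 1) ^ q) ≤ 1 := by
    intro l hl
    rw [map_div₀, map_pow, map_mul, hT.2.1, one_mul, map_pow, hx (i - l - 1) (by omega), hwi]
    have hne : T.eps v ≠ 0 := by
      intro h
      have := hx (i - l - 1) (by omega)
      rw [h, zero_pow (by positivity)] at this
      exact (v.ne_zero_iff).2 (T.ne (i - l - 1) (by omega)) this
    apply div_le_one_of_le₀ _ zero_le
    rw [← pow_mul, ← pow_mul, ← pow_succ]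
    apply pow_le_pow_of_le_one zero_le he.le
    calc q ^ (i - l - 1 + 1) ≤ q ^ i := Nat.pow_le_pow_right (by omega) (by omega)
      _ ≤ q ^ i * 2 := by omega
  induction l with
  | zero =>
    apply T.v_le_of_phi v
    rw [T.phi_D i 0 hl hi]
    have hw := T.ww_ne i (by omega)
    have hxi := T.ne i (by omega)
    have : T.x (i + 0) ^ q / T.ww (i + 0) + (T.x i * T.ww i) ^ 2 / T.x (i - 0 - 1) ^ q
      + T.x i ^ 2 / (T.x (i - 0) * T.ww (i - 0)) = T.x i + (T.x i * T.ww i) ^ 2 / T.x (i - 0 - 1) ^ q := by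
      have e : T.x i ^ q / T.ww i + T.x i ^ 2 / (T.x i * T.ww i) = T.x i := by
        field_simp
        rw [T.phi_eq]; ring
      simp only [add_zero, Nat.sub_zero]
      linear_combination e
    rw [this]
    exact (v.map_add _ _).trans (max_le hT.2.1.le (hbound 0 hl))
  | succ l ih =>
    have ih := ih (by omega) (by omega)
    apply T.v_le_of_phi v
    rw [show i + (l + 1) + 1 = i + (l + 1) + 1 by rfl, T.phi_D i (l + 1) hl hi]
    have hw := T.ww_ne (i + (l + 1)) (by omega)
    have hw' := T.ww_ne (i - (l + 1)) (by omega)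
    have hx' := T.ne (i - (l + 1)) (by omega)
    have e1 : T.x (i + (l + 1)) ^ q / T.ww (i + (l + 1)) =
        T.x (i + (l + 1)) + T.x (i + (l + 1)) / T.ww (i + (l + 1)) := by
      field_simp
      rw [T.pow_q, ww]
      linear_combination (-T.x (i + (l + 1))) * CharTwo.two_eq_zero (R := K)
    have e2 : T.x i ^ 2 / (T.x (i - (l + 1)) * T.ww (i - (l + 1))) = T.x i ^ 2 / T.x (i - (l + 1)) +
        T.x i ^ 2 * T.x (i - (l + 1)) ^ (q - 2) / T.ww (i - (l + 1)) := by
      have : T.x (i - (l + 1)) ^ (q - 1) = T.x (i - (l + 1)) * T.x (i - (l + 1)) ^ (q - 2) := by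
        rw [← pow_succ']; congr 1; omega
      field_simp
      rw [ww, this]
      linear_combination (-T.x i ^ 2 * T.x (i - (l + 1)) * T.x (i - (l + 1)) ^ (q - 2)) * CharTwo.two_eq_zero (R := K)
    have e3 : T.x (i + (l + 1)) ^ q / T.ww (i + (l + 1)) +
        (T.x i * T.ww i) ^ 2 / T.x (i - (l + 1) - 1) ^ q +
        T.x i ^ 2 / (T.x (i - (l + 1)) * T.ww (i - (l + 1))) =
        ((T.x (i + l + 1) + T.x i ^ 2 / T.x (i - l - 1)) + T.x (i + (l + 1)) / T.ww (i + (l + 1))) +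
        ((T.x i * T.ww i) ^ 2 / T.x (i - (l + 1) - 1) ^ q +
        T.x i ^ 2 * T.x (i - (l + 1)) ^ (q - 2) / T.ww (i - (l + 1))) := by
      rw [e1, e2, show i + l + 1 = i + (l + 1) by ring, show i - l - 1 = i - (l + 1) by omega]
      ring
    rw [e3]
    have b1 : v (T.x (i + (l + 1)) / T.ww (i + (l + 1))) ≤ 1 := by
      have h1 := (T.ty_gt v i hT l (by omega)).1
      rw [add_assoc] at h1
      rw [map_div₀, T.v_ww_gt v _ h1]
      apply div_le_one_of_le₀ _ zero_le
      exact le_self_pow₀ h1.le (by omega)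
    have b2 : v (T.x i ^ 2 * T.x (i - (l + 1)) ^ (q - 2) / T.ww (i - (l + 1))) ≤ 1 := by
      have h1 := hT.1 (i - (l + 1)) (by omega)
      rw [map_div₀, T.v_ww_lt v _ h1, map_mul, map_pow, hT.2.1, map_pow]
      simp only [one_pow, one_mul, div_one]
      exact pow_le_one₀ zero_le h1.le
    refine (v.map_add _ _).trans (max_le ((v.map_add _ _).trans (max_le ih b1))
      ((v.map_add _ _).trans (max_le (hbound (l + 1) hl) b2)))

def HH (n : ℕ) : K := T.hh n ^ q ^ (2 * L + 2)

def theta (i : ℕ) : K := T.HH i + T.HH (i + 1)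

/-- the correction term -/
def rr (k : ℕ) : K :=
  ∑ i ∈ (Finset.range k).filter (fun i => k ≤ 2 * i), T.x i ^ 2 * T.theta i / T.x (2 * i - k)

lemma HH_add_one (n : ℕ) : T.HH n + 1 = (T.hh n + 1) ^ q ^ (2 * L + 2) := by
  have e : q ^ (2 * L + 2) = 2 ^ (T.m * (2 * L + 2)) := by rw [pow_mul, ← T.hq]
  rw [HH, e, add_pow_char_pow _ _ 2, one_pow]

lemma three_le : 3 * q ^ L ≤ q ^ (L + 2) := by
  have := T.two_le
  rw [pow_add, mul_comm]
  exact Nat.mul_le_mul_left _ (by nlinarith)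

lemma HH_near (n : ℕ) (he1 : T.eps v ≤ 1) (h : ∀ j < n, v (T.x j) ≤ T.eps v) :
    v (T.HH n + 1) ≤ (T.eps v ^ q ^ L) ^ 3 := by
  have h1 := T.hh_sub_one v n _ he1 h
  have := T.two_le
  rw [T.HH_add_one, map_pow]
  refine (pow_le_pow_left₀ zero_le h1 _).trans ?_
  rw [← pow_mul]
  apply pow_le_pow_of_le_one zero_le he1
  calc q ^ L * 3 = 3 * q ^ L := by ring
    _ ≤ q ^ (L + 2) := T.three_le
    _ ≤ q ^ (2 * L + 2) := Nat.pow_le_pow_right (by omega) (by omega)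

lemma HH_small (i : ℕ) (hT : T.Ty v i) (hwi : v (T.ww i) = T.eps v ^ q ^ i) (he : T.eps v < 1)
    (hx : ∀ j < i, v (T.x j) ≤ T.eps v) (n : ℕ) (hn : i < n) (hnL : n ≤ L) :
    v (T.HH n) ≤ (T.eps v ^ q ^ L) ^ 3 := by
  have := T.two_le
  obtain ⟨j, rfl⟩ := Nat.exists_eq_add_of_lt hn
  have h1 := T.hh_ty v i hT j (by omega) _ he hx
  rw [HH, map_pow, show 2 * L + 2 = j + (2 * L + 2 - j) by omega, pow_add, pow_mul, h1, hwi, ← pow_mul,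
    ← pow_mul]
  apply pow_le_pow_of_le_one zero_le he.le
  calc q ^ L * 3 = 3 * q ^ L := by ring
    _ ≤ q ^ (L + 2) := T.three_le
    _ ≤ q ^ (i + (2 * L + 2 - j)) := Nat.pow_le_pow_right (by omega) (by omega)
    _ = _ := by rw [pow_add]

lemma term_le (a b : ℕ) (t : K) (P : Γ) (_hb : T.x b ≠ 0) (ha : v (T.x a) * P ≤ 1) (hP : P ≤ v (T.x b))
    (ht : v t ≤ P ^ 3) : v (T.x a ^ 2 * t / T.x b) ≤ 1 := by
  rw [map_div₀, map_mul, map_pow]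
  apply div_le_one_of_le₀ _ zero_le
  calc v (T.x a) ^ 2 * v t ≤ v (T.x a) ^ 2 * P ^ 3 := mul_le_mul_right ht _
    _ = (v (T.x a) * P) ^ 2 * P := by rw [mul_pow, mul_assoc, ← pow_succ]
    _ ≤ 1 * P := mul_le_mul_left (pow_le_one₀ zero_le ha) _
    _ ≤ v (T.x b) := by rw [one_mul]; exact hP

theorem main_r (h0 : v (T.x 0) ≤ 1) (k : ℕ) (hk : 1 ≤ k) (hkL : k ≤ L) :
    v (T.x k + T.rr k) ≤ 1 ∨
    (v (T.rr k) ≤ 1 ∧ (v (T.x k ^ q + T.x k) ≤ 1 ∨ ∃ i, 2 * i < k ∧ T.Ty v i)) := by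
  have hq2 := T.two_le
  have hsum : ∀ (s : Finset ℕ) (f : ℕ → K), (∀ i ∈ s, v (f i) ≤ 1) → v (∑ i ∈ s, f i) ≤ 1 :=
    fun s f h => v.map_sum_le h
  rcases T.tri v h0 (k - 1) (by omega) with h | ⟨he, h⟩ | ⟨i, hi, hT, he, hw, hx⟩
  · right
    have hr := T.v_rel v (k - 1) (by omega)
    rw [(h _ le_rfl).1, (h _ le_rfl).2, mul_one, one_pow, Nat.sub_add_cancel hk] at hr
    refine ⟨hsum _ _ ?_, Or.inl hr.le⟩
    intro i hi
    simp only [Finset.mem_filter, Finset.mem_range] at hi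
    apply T.term_le v i (2 * i - k) _ 1 (T.ne _ (by omega)) (by rw [(h i (by omega)).1, mul_one])
      (by rw [(h _ (by omega)).1])
    have hH : ∀ n ≤ k, v (T.HH n) = 1 := by
      intro n hn
      rw [HH, hh, map_pow, map_prod, Finset.prod_congr rfl (g := fun _ => (1 : Γ))]
      · simp
      · intro j hj
        rw [Finset.mem_range] at hj
        exact (h j (by omega)).2
    rw [theta, one_pow]
    exact (v.map_add _ _).trans (max_le (hH i (by omega)).le (hH (i + 1) (by omega)).le)
  · right
    have hxlt : ∀ j ≤ k - 1, v (T.x j) ≤ T.eps v := by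
      intro j hj
      rw [h j hj]; exact pow_le_of_le_one zero_le he.le (by positivity)
    have hr := T.v_rel v (k - 1) (by omega)
    rw [T.v_ww_lt v _ ((hxlt _ le_rfl).trans_lt he), mul_one, Nat.sub_add_cancel hk] at hr
    refine ⟨hsum _ _ ?_, Or.inl ?_⟩
    · intro i hi
      simp only [Finset.mem_filter, Finset.mem_range] at hi
      apply T.term_le v i (2 * i - k) _ (T.eps v ^ q ^ L) (T.ne _ (by omega))
      · exact mul_le_one' ((hxlt i (by omega)).trans he.le) (pow_le_one₀ zero_le he.le)
      · rw [h _ (by omega)]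
        exact pow_le_pow_of_le_one zero_le he.le (Nat.pow_le_pow_right (by omega) (by omega))
      · have e : T.theta i = (T.HH i + 1) + (T.HH (i + 1) + 1) := by
          rw [theta]; linear_combination (-1) * CharTwo.two_eq_zero (R := K)
        rw [e]
        exact (v.map_add _ _).trans (max_le (T.HH_near v _ he.le fun j hj => hxlt j (by omega))
          (T.HH_near v _ he.le fun j hj => hxlt j (by omega)))
    · rw [hr]; exact pow_le_one₀ zero_le ((hxlt _ le_rfl).trans he.le)
  · have hxlt : ∀ j < i, v (T.x j) ≤ T.eps v := by
      intro j hj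
      rw [hx j hj]; exact pow_le_of_le_one zero_le he.le (by positivity)
    have hP1 : T.eps v ^ q ^ L ≤ 1 := pow_le_one₀ zero_le he.le
    have hup : ∀ j < k, v (T.x j) * T.eps v ^ q ^ L ≤ 1 := by
      intro j hj
      rcases lt_trichotomy j i with h1 | h1 | h1
      · exact mul_le_one' ((hxlt j h1).trans he.le) hP1
      · rw [h1, hT.2.1, one_mul]; exact hP1
      · obtain ⟨l, rfl⟩ := Nat.exists_eq_add_of_lt h1
        obtain ⟨h2, h3⟩ := T.ty_gt v i hT l (by omega)
        rw [← h3, hw]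
        refine mul_le_mul' (le_self_pow₀ h2.le (by positivity)) ?_
        exact pow_le_pow_of_le_one zero_le he.le (Nat.pow_le_pow_right (by omega) (by omega))
    have hlo : ∀ j < k, T.eps v ^ q ^ L ≤ v (T.x j) := by
      intro j hj
      rcases lt_trichotomy j i with h1 | h1 | h1
      · rw [hx j h1]
        exact pow_le_pow_of_le_one zero_le he.le (Nat.pow_le_pow_right (by omega) (by omega))
      · rw [h1, hT.2.1]; exact hP1
      · obtain ⟨l, rfl⟩ := Nat.exists_eq_add_of_lt h1
        exact hP1.trans (T.ty_gt v i hT l (by omega)).1.le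
    have hth : ∀ j < k, j ≠ i → v (T.theta j) ≤ (T.eps v ^ q ^ L) ^ 3 := by
      intro j hj hji
      rcases lt_or_gt_of_ne hji with h1 | h1
      · have e : T.theta j = (T.HH j + 1) + (T.HH (j + 1) + 1) := by
          rw [theta]; linear_combination (-1) * CharTwo.two_eq_zero (R := K)
        rw [e]
        exact (v.map_add _ _).trans (max_le (T.HH_near v _ he.le fun j hj => hxlt j (by omega))
          (T.HH_near v _ he.le fun j hj => hxlt j (by omega)))
      · rw [theta]
        exact (v.map_add _ _).trans (max_le (T.HH_small v i hT hw he hxlt j h1 (by omega))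
          (T.HH_small v i hT hw he hxlt (j + 1) (by omega) (by omega)))
    have hthi : v (T.theta i + 1) ≤ (T.eps v ^ q ^ L) ^ 3 := by
      have e : T.theta i + 1 = (T.HH i + 1) + T.HH (i + 1) := by rw [theta]; ring
      rw [e]
      exact (v.map_add _ _).trans (max_le (T.HH_near v _ he.le fun j hj => hxlt j (by omega))
        (T.HH_small v i hT hw he hxlt (i + 1) (by omega) (by omega)))
    have hterm : ∀ j ∈ (Finset.range k).filter (fun i => k ≤ 2 * i), j ≠ i →
        v (T.x j ^ 2 * T.theta j / T.x (2 * j - k)) ≤ 1 := by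
      intro j hj hji
      simp only [Finset.mem_filter, Finset.mem_range] at hj
      exact T.term_le v j (2 * j - k) _ _ (T.ne _ (by omega)) (hup j (by omega)) (hlo _ (by omega))
        (hth j (by omega) hji)
    by_cases hki : k ≤ 2 * i
    · left
      have hmem : i ∈ (Finset.range k).filter (fun i => k ≤ 2 * i) := by
        simp only [Finset.mem_filter, Finset.mem_range]; omega
      have hR := T.lemR v i hT hw he hx (k - i - 1) (by omega) (by omega)
      rw [show i + (k - i - 1) + 1 = k by omega, show i - (k - i - 1) - 1 = 2 * i - k by omega] at hR
      have e : T.x k + T.rr k = (T.x k + T.x i ^ 2 / T.x (2 * i - k)) +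
          (T.x i ^ 2 * (T.theta i + 1) / T.x (2 * i - k) +
          ∑ j ∈ ((Finset.range k).filter (fun i => k ≤ 2 * i)).erase i,
            T.x j ^ 2 * T.theta j / T.x (2 * j - k)) := by
        rw [rr, ← Finset.add_sum_erase _ _ hmem]
        linear_combination (-(T.x i ^ 2 / T.x (2 * i - k))) * CharTwo.two_eq_zero (R := K)
      rw [e]
      refine (v.map_add _ _).trans (max_le hR ((v.map_add _ _).trans (max_le ?_ (hsum _ _ ?_))))
      · exact T.term_le v i (2 * i - k) _ _ (T.ne _ (by omega)) (hup i (by omega)) (hlo _ (by omega)) hthi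
      · intro j hj
        rw [Finset.mem_erase] at hj
        exact hterm j hj.2 hj.1
    · right
      refine ⟨hsum _ _ fun j hj => hterm j hj ?_, Or.inr ⟨i, by omega, hT⟩⟩
      simp only [Finset.mem_filter, Finset.mem_range] at hj
      omega

end val
end Tow
end tower
end GS


set_option linter.unusedSectionVars false

namespace GS
open Polynomial

/-- the tower together with a weight function, totally ramified -/
structure TowW (F K : Type*) [Field F] [Field K] [Algebra F K] (q L : ℕ) extends Tow K q L where
  w : WtF F K
  hw : ∀ i, i ≤ L → w.wt (x i) = (q : ℤ) ^ (L - i)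
  hL : 0 < L

/-- weights of sums `∑ c_e y^e` -/
lemma WtF.sum_pow {F K : Type*} [Field F] [Field K] [Algebra F K] (w : WtF F K) (q κ : ℕ) (hκ : 0 < κ)
    (y : K) (hy : y ≠ 0) (hyw : w.wt y = κ) (c : ℕ → K)
    (hc : ∀ e < q, c e ≠ 0 → ((q * κ : ℕ) : ℤ) ∣ w.wt (c e)) (hne : ∃ e < q, c e ≠ 0) :
    ∃ e < q, c e ≠ 0 ∧ ∑ j ∈ Finset.range q, c j * y ^ j ≠ 0 ∧
      w.wt (∑ j ∈ Finset.range q, c j * y ^ j) = w.wt (c e) + e * κ ∧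
      ∀ j < q, c j ≠ 0 → w.wt (c j) + j * κ ≤ w.wt (∑ j ∈ Finset.range q, c j * y ^ j) := by
  have hwt : ∀ e, c e ≠ 0 → w.wt (c e * y ^ e) = w.wt (c e) + e * κ := by
    intro e he
    rw [w.mul' _ _ he (pow_ne_zero _ hy), w.pow _ hy, hyw]
  have h0 : ∀ e, c e * y ^ e ≠ 0 → c e ≠ 0 := fun e h h' => h (by rw [h', zero_mul])
  obtain ⟨e, he, hce, h1, h2, h3⟩ := w.sum_distinct (Finset.range q) (fun e => c e * y ^ e) (by
    intro i hi j hj h1 h2 h3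
    have hi := Finset.mem_range.1 hi
    have hj := Finset.mem_range.1 hj
    rw [hwt i (h0 i h1), hwt j (h0 j h2)] at h3
    obtain ⟨a, ha⟩ := hc i hi (h0 i h1)
    obtain ⟨b, hb⟩ := hc j hj (h0 j h2)
    rw [ha, hb] at h3
    have h4 : (κ : ℤ) * (q * a + i) = κ * (q * b + j) := by push_cast at h3; linarith
    have h5 := mul_left_cancel₀ (by positivity) h4
    have h6 : ((i : ℤ) - j) = q * (b - a) := by linarith
    have h7 : (q : ℤ) ∣ (i : ℤ) - j := ⟨_, h6⟩
    have := Int.eq_zero_of_abs_lt_dvd h7 (by rw [abs_lt]; constructor <;> omega)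
    omega) (by
      obtain ⟨e, he, h⟩ := hne
      exact ⟨e, Finset.mem_range.2 he, mul_ne_zero h (pow_ne_zero _ hy)⟩)
  refine ⟨e, Finset.mem_range.1 he, h0 e hce, h1, h2.trans (hwt e (h0 e hce)), ?_⟩
  intro j hj hcj
  rw [h2, ← hwt j hcj]
  exact h3 j (Finset.mem_range.2 hj) (mul_ne_zero hcj (pow_ne_zero _ hy))

section tower
variable {F K : Type*} [Field F] [Finite F] [Field K] [Algebra F K] [CharP K 2] {q L : ℕ} (T : TowW F K q L)

namespace TowW

include T

def phi (i : ℕ) : K := T.x i ^ q + T.x i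

lemma q_pos : 0 < q := by have := T.toTow.two_le; omega

lemma phi_ne (i : ℕ) (hi : i ≤ L) : T.phi i ≠ 0 := by
  rcases Nat.lt_or_ge i L with h | h
  · exact T.toTow.phi_ne i h
  · obtain ⟨j, rfl⟩ : ∃ j, i = j + 1 := ⟨i - 1, by have := T.hL; omega⟩
    have h := T.rel j (by omega)
    intro h'
    rw [phi] at h'
    rw [h', zero_mul] at h
    exact pow_ne_zero _ (T.ne j (by omega)) h.symm

lemma phi_rel (i : ℕ) (hi : i < L) : T.phi (i + 1) * T.phi i = T.x i ^ (q + 1) := T.rel i hi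

def B (k : ℕ) : Subalgebra F K := Algebra.adjoin F (insert (T.phi 0)⁻¹ (T.x '' {i | i ≤ k}))

lemma x_mem {i k : ℕ} (h : i ≤ k) : T.x i ∈ T.B k :=
  Algebra.subset_adjoin (Set.mem_insert_of_mem _ ⟨i, h, rfl⟩)

lemma phi0_inv_mem (k : ℕ) : (T.phi 0)⁻¹ ∈ T.B k := Algebra.subset_adjoin (Set.mem_insert _ _)

lemma B_mono {i k : ℕ} (h : i ≤ k) : T.B i ≤ T.B k := by
  apply Algebra.adjoin_mono
  apply Set.insert_subset_insert
  apply Set.image_mono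
  intro j hj
  exact le_trans hj h

lemma phi_mem {i k : ℕ} (h : i ≤ k) : T.phi i ∈ T.B k :=
  add_mem (pow_mem (T.x_mem h) _) (T.x_mem h)

lemma ww_mem {i k : ℕ} (h : i ≤ k) : T.ww i ∈ T.B k :=
  add_mem (pow_mem (T.x_mem h) _) (one_mem _)

lemma x_inv (i : ℕ) (hi : i ≤ L) : (T.x i)⁻¹ = T.ww i * (T.phi i)⁻¹ := by
  have h := T.toTow.phi_eq i
  have h1 := T.phi_ne i hi
  have h2 := T.ne i hi
  rw [phi] at *
  rw [eq_mul_inv_iff_mul_eq₀ h1, h]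
  field_simp

lemma phi_succ (i : ℕ) (hi : i < L) : T.phi (i + 1) = T.x i ^ (q + 1) * (T.phi i)⁻¹ := by
  rw [eq_mul_inv_iff_mul_eq₀ (T.phi_ne i hi.le), T.phi_rel i hi]

lemma phi_succ_inv (i : ℕ) (hi : i < L) : (T.phi (i + 1))⁻¹ = (T.x i)⁻¹ ^ (q + 1) * (T.phi i) := by
  rw [T.phi_succ i hi]; simp [mul_comm]

lemma phi_inv_mem' (i : ℕ) (h : i ≤ L) : (T.phi i)⁻¹ ∈ T.B i := by
  induction i with
  | zero => exact T.phi0_inv_mem 0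
  | succ i ih =>
    have ih := T.B_mono (Nat.le_succ i) (ih (by omega))
    rw [T.phi_succ_inv i (by omega)]
    refine mul_mem (pow_mem ?_ _) (T.phi_mem (by omega))
    rw [T.x_inv i (by omega)]
    exact mul_mem (T.ww_mem (by omega)) ih

lemma phi_inv_mem {i k : ℕ} (h : i ≤ k) (hi : i ≤ L) : (T.phi i)⁻¹ ∈ T.B k :=
  T.B_mono h (T.phi_inv_mem' i hi)

lemma x_inv_mem {i k : ℕ} (h : i ≤ k) (hi : i ≤ L) : (T.x i)⁻¹ ∈ T.B k := by
  rw [T.x_inv i hi]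
  exact mul_mem (T.ww_mem h) (T.phi_inv_mem h hi)

lemma phi_succ_mem {i k : ℕ} (h : i ≤ k) (hi : i < L) : T.phi (i + 1) ∈ T.B k := by
  rw [T.phi_succ i hi]
  exact mul_mem (pow_mem (T.x_mem h) _) (T.phi_inv_mem h hi.le)

lemma B_zero (b : K) (hb : b ∈ T.B 0) : ∃ (c : ℕ) (p : F[X]), T.phi 0 ^ c * b = aeval (T.x 0) p := by
  have h0 := T.phi_ne 0 (Nat.zero_le _)
  have hphi : T.phi 0 = aeval (T.x 0) (X ^ q + X : F[X]) := by simp [phi]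
  refine Algebra.adjoin_induction (p := fun b _ => ∃ (c : ℕ) (p : F[X]), T.phi 0 ^ c * b = aeval (T.x 0) p)
    ?_ ?_ ?_ ?_ hb
  · rintro b (rfl | ⟨i, hi, rfl⟩)
    · exact ⟨1, 1, by simp [h0]⟩
    · obtain rfl : i = 0 := by simpa using hi
      exact ⟨0, X, by simp⟩
  · intro r
    exact ⟨0, C r, by simp⟩
  · rintro a b _ _ ⟨c, p, h⟩ ⟨d, r, h'⟩
    refine ⟨c + d, (X ^ q + X) ^ d * p + (X ^ q + X) ^ c * r, ?_⟩
    rw [map_add, map_mul, map_mul, ← h, ← h', map_pow, map_pow, ← hphi]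
    ring
  · rintro a b _ _ ⟨c, p, h⟩ ⟨d, r, h'⟩
    refine ⟨c + d, p * r, ?_⟩
    rw [map_mul, ← h, ← h']
    ring

lemma B_succ (k : ℕ) (hk : k < L) (b : K) (hb : b ∈ T.B (k + 1)) :
    ∃ p : (T.B k)[X], p.degree < q ∧ aeval (T.x (k + 1)) p = b := by
  have h1 : T.B (k + 1) ≤ (Algebra.adjoin (T.B k) {T.x (k + 1)}).restrictScalars F := by
    apply Algebra.adjoin_le
    rintro _ (rfl | ⟨i, hi, rfl⟩)
    · exact Subalgebra.algebraMap_mem (Algebra.adjoin (T.B k) {T.x (k + 1)}) ⟨_, T.phi0_inv_mem k⟩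
    · rcases Nat.lt_or_ge k i with h | h
      · obtain rfl : i = k + 1 := le_antisymm hi h
        exact Algebra.subset_adjoin (R := T.B k) rfl
      · exact Subalgebra.algebraMap_mem (Algebra.adjoin (T.B k) {T.x (k + 1)}) ⟨_, T.x_mem h⟩
  have h2 : b ∈ Algebra.adjoin (T.B k) {T.x (k + 1)} := h1 hb
  rw [Algebra.adjoin_singleton_eq_range_aeval] at h2
  obtain ⟨p, rfl⟩ := h2
  have hq := T.toTow.two_le
  let u : T.B k := ⟨T.phi (k + 1), T.phi_succ_mem le_rfl hk⟩
  have hd : (X + C u : (T.B k)[X]).degree < q := by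
    rw [degree_X_add_C]; exact_mod_cast hq
  have hm : (X ^ q + (X + C u) : (T.B k)[X]).Monic := monic_X_pow_add hd
  have hdeg : (X ^ q + (X + C u) : (T.B k)[X]).degree = q := by
    rw [degree_add_eq_left_of_degree_lt (by rw [degree_X_pow]; exact hd), degree_X_pow]
  refine ⟨p %ₘ (X ^ q + (X + C u)), ?_, ?_⟩
  · rw [← hdeg]; exact degree_modByMonic_lt _ hm
  · change _ = aeval (T.x (k + 1)) p
    conv_rhs => rw [← modByMonic_add_div p (X ^ q + (X + C u))]
    have : aeval (T.x (k + 1)) (X ^ q + (X + C u) : (T.B k)[X]) = 0 := by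
      simp only [map_add, map_pow, aeval_X, aeval_C]
      change T.x (k + 1) ^ q + (T.x (k + 1) + (T.x (k + 1) ^ q + T.x (k + 1))) = 0
      linear_combination (T.x (k + 1) ^ q + T.x (k + 1)) * CharTwo.two_eq_zero (R := K)
    rw [map_add, map_mul, this]
    simp

lemma B_succ' (k : ℕ) (hk : k < L) (b : K) (hb : b ∈ T.B (k + 1)) :
    ∃ c : ℕ → K, (∀ e, c e ∈ T.B k) ∧ b = ∑ e ∈ Finset.range q, c e * T.x (k + 1) ^ e := by
  obtain ⟨p, hp, rfl⟩ := T.B_succ k hk b hb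
  refine ⟨fun e => p.coeff e, fun e => (p.coeff e).2, ?_⟩
  rw [aeval_eq_sum_range' (n := q)]
  · rfl
  · by_cases h0 : p = 0
    · simp [h0, T.q_pos]
    · exact (natDegree_lt_iff_degree_lt h0).2 hp

lemma wt_poly (p : F[X]) (hp : aeval (T.x 0) p ≠ 0) : ∃ l : ℕ, T.w.wt (aeval (T.x 0) p) = (q : ℤ) ^ L * l := by
  have hx := T.ne 0 (Nat.zero_le _)
  have hq := T.q_pos
  have hwt : ∀ e, algebraMap F K (p.coeff e) ≠ 0 → T.w.wt (algebraMap F K (p.coeff e) * T.x 0 ^ e) = (q : ℤ) ^ L * e := by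
    intro e he
    rw [T.w.mul' _ _ he (pow_ne_zero _ hx), T.w.pow _ hx, T.hw 0 (Nat.zero_le _), T.w.alg', Nat.sub_zero]
    · ring
    · simpa using he
  have e1 : aeval (T.x 0) p = ∑ e ∈ Finset.range (p.natDegree + 1), algebraMap F K (p.coeff e) * T.x 0 ^ e := by
    rw [aeval_eq_sum_range]; simp [Algebra.smul_def]
  obtain ⟨e, -, hce, -, h2, -⟩ := T.w.sum_distinct (Finset.range (p.natDegree + 1))
      (fun e => algebraMap F K (p.coeff e) * T.x 0 ^ e) (by
    intro i _ j _ h1 h2 h3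
    rw [hwt i (left_ne_zero_of_mul h1), hwt j (left_ne_zero_of_mul h2)] at h3
    have h5 := mul_left_cancel₀ (by positivity) h3
    exact_mod_cast h5) (by
      by_contra! h
      rw [e1, Finset.sum_eq_zero h] at hp
      exact hp rfl)
  rw [e1, h2, hwt e (left_ne_zero_of_mul hce)]
  exact ⟨e, rfl⟩

lemma wt_phi0 : T.w.wt (T.phi 0) = q * (q : ℤ) ^ L := by
  have hx := T.ne 0 (Nat.zero_le _)
  have hq := T.toTow.two_le
  have h := T.w.add_of_lt (T.x 0 ^ q) (T.x 0) (pow_ne_zero _ hx) (Or.inr (by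
    rw [T.w.pow _ hx, T.hw 0 (Nat.zero_le _)]
    have : (0 : ℤ) < q ^ (L - 0) := by positivity
    have : (2 : ℤ) ≤ q := by exact_mod_cast hq
    nlinarith))
  rw [phi, h.2, T.w.pow _ hx, T.hw 0 (Nat.zero_le _), Nat.sub_zero]

lemma wt_dvd (k : ℕ) (hk : k ≤ L) (b : K) (hb : b ∈ T.B k) (h0 : b ≠ 0) : ((q ^ (L - k) : ℕ) : ℤ) ∣ T.w.wt b := by
  induction k generalizing b with
  | zero =>
    obtain ⟨c, p, h⟩ := T.B_zero b hb
    have hp0 := T.phi_ne 0 (Nat.zero_le _)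
    obtain ⟨l, hl⟩ := T.wt_poly p (by rw [← h]; exact mul_ne_zero (pow_ne_zero _ hp0) h0)
    rw [← h, T.w.mul' _ _ (pow_ne_zero _ hp0) h0, T.w.pow _ hp0, T.wt_phi0] at hl
    refine ⟨l - c * q, ?_⟩
    push_cast
    rw [Nat.sub_zero]
    linear_combination hl
  | succ k ih =>
    obtain ⟨c, hc, rfl⟩ := T.B_succ' k (by omega) b hb
    have e : L - k = (L - (k + 1)) + 1 := by omega
    obtain ⟨e, he, h1, h2, h3, -⟩ := T.w.sum_pow q (q ^ (L - (k + 1))) (pow_pos T.q_pos _) (T.x (k + 1))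
      (T.ne _ hk) (by rw [T.hw _ hk]; push_cast; rfl) c (by
        intro j _ hj
        have := ih (by omega) (c j) (hc j) hj
        rwa [e, pow_succ'] at this) (by
        by_contra! h
        apply h0
        apply Finset.sum_eq_zero
        intro j hj
        rw [h j (Finset.mem_range.1 hj), zero_mul])
    rw [h3]
    refine dvd_add ?_ (Dvd.intro_left _ rfl)
    refine dvd_trans ?_ (ih (by omega) (c e) (hc e) h1)
    exact_mod_cast pow_dvd_pow q (by omega)

end TowW
end tower
end GS


set_option linter.unusedSectionVars false

namespace GS
open Polynomial
section tower
variable {F K : Type*} [Field F] [Finite F] [Field K] [Algebra F K] [CharP K 2] {q L : ℕ} (T : TowW F K q L)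

lemma alg_mem_val (V : ValuationSubring K) (c : F) : algebraMap F K c ∈ V := by
  cases nonempty_fintype F
  by_cases h : c = 0
  · simp [h, V.zero_mem]
  rw [← V.valuation_le_one_iff]
  have h1 : c ^ (Fintype.card F - 1) = 1 := FiniteField.pow_card_sub_one_eq_one c h
  have h2 : V.valuation (algebraMap F K c) ^ (Fintype.card F - 1) = 1 := by
    rw [← map_pow, ← map_pow, h1, map_one, map_one]
  have h3 : Fintype.card F - 1 ≠ 0 := by
    have := Fintype.one_lt_card (α := F); omega
  exact ((pow_le_one_iff_of_nonneg zero_le h3).1 h2.le)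

namespace TowW

include T

def Ab : Subalgebra F K where
  carrier := {f | ∀ V : ValuationSubring K, T.x 0 ∈ V → f ∈ V}
  mul_mem' := fun ha hb V hV => V.mul_mem _ _ (ha V hV) (hb V hV)
  add_mem' := fun ha hb V hV => V.add_mem _ _ (ha V hV) (hb V hV)
  algebraMap_mem' := fun c V _ => alg_mem_val V c

lemma mem_Ab (f : K) : f ∈ T.Ab ↔ ∀ V : ValuationSubring K, T.x 0 ∈ V → f ∈ V := Iff.rfl

def A (k : ℕ) : Subalgebra F K := T.B k ⊓ T.Ab

lemma x0_Ab : T.x 0 ∈ T.Ab := fun _ h => h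

lemma phi0_Ab : T.phi 0 ∈ T.Ab := add_mem (pow_mem T.x0_Ab _) T.x0_Ab

/-- elements which become integral after multiplication by a power of `phi 0` -/
def Pb : Subalgebra F K where
  carrier := {f | ∃ c : ℕ, T.phi 0 ^ c * f ∈ T.Ab}
  mul_mem' := by
    rintro a b ⟨c, hc⟩ ⟨d, hd⟩
    refine ⟨c + d, ?_⟩
    have := mul_mem hc hd
    convert this using 1; ring
  add_mem' := by
    rintro a b ⟨c, hc⟩ ⟨d, hd⟩
    refine ⟨c + d, ?_⟩
    have := add_mem (mul_mem (pow_mem T.phi0_Ab d) hc) (mul_mem (pow_mem T.phi0_Ab c) hd)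
    convert this using 1; ring
  algebraMap_mem' := fun c => ⟨0, by simpa using T.Ab.algebraMap_mem c⟩

lemma Pb_phi (z : K) (h : z ^ q + z ∈ T.Pb) : z ∈ T.Pb := by
  obtain ⟨c, hc⟩ := h
  refine ⟨c, fun V hV => ?_⟩
  rw [← V.valuation_le_one_iff]
  have h1 := (V.valuation_le_one_iff _).2 (hc V hV)
  have h2 := (V.valuation_le_one_iff _).2 (pow_mem T.phi0_Ab c V hV)
  rw [map_mul] at *
  rcases le_or_gt (V.valuation z) 1 with h | h
  · exact mul_le_one' h2 h
  · refine le_trans (mul_le_mul_right ?_ _) h1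
    rw [T.toTow.v_phi_gt _ z h]
    exact le_self_pow₀ h.le (by have := T.q_pos; omega)

lemma Pb_mem (i : ℕ) (hi : i ≤ L) : T.x i ∈ T.Pb ∧ (T.phi i)⁻¹ ∈ T.Pb := by
  induction i with
  | zero =>
    refine ⟨⟨0, by simpa using T.x0_Ab⟩, ⟨1, ?_⟩⟩
    rw [pow_one, mul_inv_cancel₀ (T.phi_ne 0 hi)]
    exact one_mem _
  | succ i ih =>
    obtain ⟨h1, h2⟩ := ih (by omega)
    have h3 : T.phi (i + 1) ∈ T.Pb := by
      rw [T.phi_succ i (by omega)]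
      exact mul_mem (pow_mem h1 _) h2
    refine ⟨T.Pb_phi _ h3, ?_⟩
    rw [T.phi_succ_inv i (by omega), T.x_inv i (by omega)]
    refine mul_mem (pow_mem (mul_mem ?_ h2) _) (add_mem (pow_mem h1 _) h1)
    exact add_mem (pow_mem h1 _) (one_mem _)

lemma B_le_Pb (k : ℕ) (hk : k ≤ L) : T.B k ≤ T.Pb := by
  apply Algebra.adjoin_le
  rintro _ (rfl | ⟨i, hi, rfl⟩)
  · exact (T.Pb_mem 0 (Nat.zero_le _)).2
  · exact (T.Pb_mem i (le_trans hi hk)).1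

lemma exists_A (k : ℕ) (hk : k ≤ L) (b : K) (hb : b ∈ T.B k) : ∃ c, T.phi 0 ^ c * b ∈ T.A k := by
  obtain ⟨c, hc⟩ := T.B_le_Pb k hk hb
  exact ⟨c, mul_mem (pow_mem (T.phi_mem (Nat.zero_le _)) _) hb, hc⟩

/-- the free module with basis the monomials -/
noncomputable def M : ℕ → Submodule F K
  | 0 => (aeval (R := F) (T.x 0)).toLinearMap.range
  | k + 1 =>
    { carrier := {f | ∃ c : ℕ → K, (∀ e, c e ∈ M k) ∧ f = ∑ e ∈ Finset.range q, c e * T.x (k + 1) ^ e}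
      zero_mem' := ⟨0, fun _ => zero_mem _, by simp⟩
      add_mem' := by
        rintro a b ⟨c, hc, rfl⟩ ⟨d, hd, rfl⟩
        exact ⟨c + d, fun e => add_mem (hc e) (hd e), by simp [add_mul, Finset.sum_add_distrib]⟩
      smul_mem' := by
        rintro r a ⟨c, hc, rfl⟩
        exact ⟨r • c, fun e => Submodule.smul_mem _ _ (hc e), by simp [Finset.smul_sum]⟩ }

lemma M_mul (k : ℕ) (f : K) (hf : f ∈ T.M k) (p : F[X]) : aeval (T.x 0) p * f ∈ T.M k := by
  induction k generalizing f with
  | zero =>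
    obtain ⟨r, rfl⟩ := hf
    exact ⟨p * r, by simp⟩
  | succ k ih =>
    obtain ⟨c, hc, rfl⟩ := hf
    exact ⟨fun e => aeval (T.x 0) p * c e, fun e => ih _ (hc e), by
      rw [Finset.mul_sum]; simp only [mul_assoc]⟩

lemma M_le_B (k : ℕ) : ∀ f ∈ T.M k, f ∈ T.B k := by
  induction k with
  | zero =>
    rintro _ ⟨r, rfl⟩
    have h : Algebra.adjoin F {T.x 0} ≤ T.B 0 := by
      apply Algebra.adjoin_le
      rintro _ rfl
      exact T.x_mem le_rfl
    exact h (aeval_mem_adjoin_singleton _ _)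
  | succ k ih =>
    rintro _ ⟨c, hc, rfl⟩
    exact sum_mem fun e _ => mul_mem (T.B_mono (Nat.le_succ k) (ih _ (hc e))) (pow_mem (T.x_mem le_rfl) _)

lemma M_wt (k : ℕ) (hk : k ≤ L) (f : K) (hf : f ∈ T.M k) (h0 : f ≠ 0) : 0 ≤ T.w.wt f := by
  have hq := T.q_pos
  induction k generalizing f with
  | zero =>
    obtain ⟨r, rfl⟩ := hf
    obtain ⟨l, hl⟩ := T.wt_poly r h0
    change 0 ≤ T.w.wt (aeval (T.x 0) r)
    rw [hl]; positivity
  | succ k ih =>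
    obtain ⟨c, hc, rfl⟩ := hf
    have e : L - k = (L - (k + 1)) + 1 := by omega
    obtain ⟨e, he, h1, h2, h3, -⟩ := T.w.sum_pow q (q ^ (L - (k + 1))) (pow_pos T.q_pos _) (T.x (k + 1))
      (T.ne _ hk) (by rw [T.hw _ hk]; push_cast; rfl) c (by
        intro j _ hj
        have := T.wt_dvd k (by omega) (c j) (T.M_le_B k _ (hc j)) hj
        rwa [e, pow_succ'] at this) (by
        by_contra! h
        apply h0
        apply Finset.sum_eq_zero
        intro j hj
        rw [h j (Finset.mem_range.1 hj), zero_mul])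
    rw [h3]
    have := ih (by omega) (c e) (hc e) h1
    positivity

lemma phi0_poly (c : ℕ) : T.phi 0 ^ c = aeval (T.x 0) ((X ^ q + X) ^ c : F[X]) := by simp [phi]

lemma M_up (k : ℕ) (b : K) (c d : ℕ) (h : T.phi 0 ^ c * b ∈ T.M k) (hcd : c ≤ d) : T.phi 0 ^ d * b ∈ T.M k := by
  obtain ⟨e, rfl⟩ := Nat.exists_eq_add_of_le hcd
  rw [show T.phi 0 ^ (c + e) * b = T.phi 0 ^ e * (T.phi 0 ^ c * b) by ring, T.phi0_poly e]
  exact T.M_mul k _ h _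

lemma exists_M (k : ℕ) (hk : k ≤ L) (b : K) (hb : b ∈ T.B k) : ∃ c, T.phi 0 ^ c * b ∈ T.M k := by
  induction k generalizing b with
  | zero =>
    obtain ⟨c, p, h⟩ := T.B_zero b hb
    exact ⟨c, p, h.symm⟩
  | succ k ih =>
    obtain ⟨c, hc, rfl⟩ := T.B_succ' k (by omega) b hb
    choose d hd using fun e => ih (by omega) (c e) (hc e)
    let D := (Finset.range q).sup d
    refine ⟨D, fun e => if e ∈ Finset.range q then T.phi 0 ^ D * c e else 0, ?_, ?_⟩
    · intro e
      beta_reduce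
      split_ifs with h
      · exact T.M_up k _ _ _ (hd e) (Finset.le_sup (f := d) h)
      · exact zero_mem _
    · rw [Finset.mul_sum]
      apply Finset.sum_congr rfl
      intro e he
      beta_reduce
      rw [if_pos he, mul_assoc]

lemma A_wt (k : ℕ) (hk : k ≤ L) (f : K) (hf : f ∈ T.A k) (h0 : f ≠ 0) : 0 ≤ T.w.wt f := by
  have hIntg : f ∈ (integralClosure (Subring.closure {T.x 0}) K).toSubring := by
    rw [← iInf_valuationSubring_superset, Subring.mem_iInf]
    rintro ⟨V, hV⟩
    exact hf.2 V (hV rfl)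
  obtain ⟨p, hp, hpf⟩ : IsIntegral (Subring.closure {T.x 0}) f := hIntg
  have hcl : ∀ a ∈ Subring.closure {T.x 0}, ∃ r : F[X], a = aeval (T.x 0) r := by
    intro a ha
    have h : Subring.closure {T.x 0} ≤ (Algebra.adjoin F {T.x 0}).toSubring := by
      rw [Subring.closure_le]; exact Algebra.subset_adjoin
    have h1 : a ∈ Algebra.adjoin F {T.x 0} := h ha
    rw [Algebra.adjoin_singleton_eq_range_aeval] at h1
    obtain ⟨r, rfl⟩ := h1
    exact ⟨r, rfl⟩
  choose c hc using fun j : ℕ => T.exists_M k hk (f ^ j) (pow_mem hf.1 j)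
  let D := (Finset.range p.natDegree).sup c
  have key : ∀ n, T.phi 0 ^ D * f ^ n ∈ T.M k := by
    intro n
    induction n using Nat.strong_induction_on with
    | _ n ih =>
      rcases Nat.lt_or_ge n p.natDegree with h | h
      · exact T.M_up k _ _ _ (hc n) (Finset.le_sup (f := c) (Finset.mem_range.2 h))
      · rw [eval₂_eq_sum_range, Finset.sum_range_succ, hp.coeff_natDegree, map_one, one_mul] at hpf
        have e : T.phi 0 ^ D * f ^ n = - ∑ j ∈ Finset.range p.natDegree,
            (algebraMap (Subring.closure {T.x 0}) K (p.coeff j)) * (T.phi 0 ^ D * f ^ (n - p.natDegree + j)) := by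
          have e1 : f ^ n = f ^ (n - p.natDegree) * f ^ p.natDegree := by
            rw [← pow_add]; congr 1; omega
          rw [e1, eq_neg_of_add_eq_zero_right hpf, mul_neg, mul_neg, Finset.mul_sum, Finset.mul_sum]
          congr 1
          apply Finset.sum_congr rfl
          intro j _
          rw [pow_add]; ring
        rw [e]
        refine neg_mem (sum_mem fun j hj => ?_)
        obtain ⟨r, hr⟩ := hcl _ (p.coeff j).2
        have : algebraMap (Subring.closure {T.x 0}) K (p.coeff j) = aeval (T.x 0) r := hr
        rw [this]
        refine T.M_mul k _ (ih _ ?_) _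
        have := Finset.mem_range.1 hj
        omega
  by_contra hneg
  have hp0 := T.phi_ne 0 (Nat.zero_le _)
  let n := D * (q * q ^ L) + 1
  have h1 := T.M_wt k hk _ (key n) (mul_ne_zero (pow_ne_zero _ hp0) (pow_ne_zero _ h0))
  rw [T.w.mul' _ _ (pow_ne_zero _ hp0) (pow_ne_zero _ h0), T.w.pow _ hp0, T.w.pow _ h0, T.wt_phi0] at h1
  have h2 : T.w.wt f ≤ -1 := by omega
  have h3 : (n : ℤ) * T.w.wt f ≤ n * (-1) := mul_le_mul_of_nonneg_left h2 (by positivity)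
  have h4 : (n : ℤ) = D * (q * q ^ L) + 1 := by simp [n]
  linarith

lemma A_good (k : ℕ) (hk : k ≤ L) : Good T.w (q ^ (L - k)) (T.A k).toSubmodule := by
  intro f hf h0
  obtain ⟨l, hl⟩ := T.wt_dvd k hk f hf.1 h0
  have h1 := T.A_wt k hk f hf h0
  rw [hl] at h1
  have : 0 ≤ l := nonneg_of_mul_nonneg_right h1 (by have := T.q_pos; positivity)
  exact ⟨l.toNat, by rw [hl, Int.toNat_of_nonneg this]⟩

lemma gaps_zero : gaps T.w (q ^ L) (T.A 0).toSubmodule = ∅ := by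
  rw [Set.eq_empty_iff_forall_notMem]
  intro l hl
  have hx := T.ne 0 (Nat.zero_le _)
  apply hl
  refine ⟨T.x 0 ^ l, ⟨pow_mem (T.x_mem le_rfl) _, pow_mem T.x0_Ab _⟩, pow_ne_zero _ hx, ?_⟩
  rw [T.w.pow _ hx, T.hw 0 (Nat.zero_le _)]
  push_cast; rw [Nat.sub_zero]; ring

lemma A_mono {i k : ℕ} (h : i ≤ k) : T.A i ≤ T.A k := inf_le_inf_right _ (T.B_mono h)

end TowW
end tower
end GS


set_option linter.unusedSectionVars false

namespace GS
open Polynomial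

/-- adjoining a root multiplies the degree by at most the degree of the polynomial -/
lemma adjoin_step {E K : Type*} [Field E] [Field K] [Algebra E K] (G : IntermediateField E K)
    [FiniteDimensional E G] (y : K) (p : G[X]) (hp : p.Monic) (h : aeval y p = 0) (d n : ℕ)
    (hd : p.natDegree ≤ d) (hn : Module.finrank E G ≤ n) :
    ∃ G' : IntermediateField E K, G ≤ G' ∧ y ∈ G' ∧ FiniteDimensional E G' ∧ Module.finrank E G' ≤ n * d := by
  have hIntg : IsIntegral G y := ⟨p, hp, h⟩
  have h1 := IntermediateField.adjoin.finrank hIntg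
  have h2 : (minpoly G y).natDegree ≤ d :=
    (natDegree_le_natDegree (minpoly.min G y hp h)).trans hd
  have : FiniteDimensional G (IntermediateField.adjoin G {y}) := IntermediateField.adjoin.finiteDimensional hIntg
  have hfd : FiniteDimensional E (IntermediateField.adjoin G {y}) := FiniteDimensional.trans E G _
  refine ⟨(IntermediateField.adjoin G {y}).restrictScalars E, ?_, ?_, hfd, ?_⟩
  · intro z hz
    exact IntermediateField.algebraMap_mem (IntermediateField.adjoin G {y}) ⟨z, hz⟩
  · exact IntermediateField.mem_adjoin_simple_self G y
  · have : Module.Free G (IntermediateField.adjoin G {y}) := Module.Free.of_divisionRing _ _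
    have h3 := Module.finrank_mul_finrank E G (IntermediateField.adjoin G {y})
    change Module.finrank E (IntermediateField.adjoin G {y}) ≤ n * d
    rw [← h3, h1]
    exact Nat.mul_le_mul hn h2

/-- the Artin--Schreier step -/
lemma adjoin_as {E K : Type*} [Field E] [Field K] [Algebra E K] (G : IntermediateField E K)
    [FiniteDimensional E G] (y : K) (q n : ℕ) (hq : 2 ≤ q) (h : y ^ q + y ∈ G) (hn : Module.finrank E G ≤ n) :
    ∃ G' : IntermediateField E K, G ≤ G' ∧ y ∈ G' ∧ FiniteDimensional E G' ∧ Module.finrank E G' ≤ n * q := by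
  have hd : (X - C (⟨_, h⟩ : G) : G[X]).degree < q := by
    rw [degree_X_sub_C]; exact_mod_cast hq
  refine adjoin_step G y (X ^ q + (X - C (⟨_, h⟩ : G))) (monic_X_pow_add hd) ?_ q n ?_ hn
  · simp only [map_add, map_sub, map_pow, aeval_X, aeval_C]
    change y ^ q + (y - (y ^ q + y)) = 0
    ring
  · apply natDegree_le_of_degree_le
    refine (degree_add_le _ _).trans (max_le (by rw [degree_X_pow]) hd.le)

lemma comm_aux {Γ : Type*} [CommMonoid Γ] (U W : Γ) (a M b c : ℕ) :
    W ^ a * U ^ b * U ^ (a * M + c) = (U ^ M * W) ^ a * U ^ (b + c) := by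
  rw [pow_add, pow_add, mul_pow, mul_comm a M, pow_mul]
  ac_rfl

lemma comm_aux2 {Γ : Type*} [CommMonoid Γ] (U g W X : Γ) (t : ℕ) :
    W * X * U ^ t * (g * U) = g * (W * X) * U ^ (t + 1) := by
  rw [pow_succ]
  ac_rfl

section tower
variable {F K : Type*} [Field F] [Finite F] [Field K] [Algebra F K] [CharP K 2] {q L : ℕ} (T : TowW F K q L)

namespace TowW

include T

lemma deg_up (i n : ℕ) (h : i + n ≤ L) : ∃ G : IntermediateField (IntermediateField.adjoin F {T.ww i}) K,
    (∀ j, i ≤ j → j ≤ i + n → T.x j ∈ G) ∧ FiniteDimensional (IntermediateField.adjoin F {T.ww i}) G ∧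
    Module.finrank (IntermediateField.adjoin F {T.ww i}) G ≤ (q - 1) * q ^ n := by
  have hq := T.toTow.two_le
  induction n with
  | zero =>
    let E := IntermediateField.adjoin F {T.ww i}
    let wE : E := ⟨T.ww i, IntermediateField.mem_adjoin_simple_self F _⟩
    let w0 : (⊥ : IntermediateField E K) := algebraMap E _ wE
    have hd : (C (1 - w0) : (⊥ : IntermediateField E K)[X]).degree < (q - 1 : ℕ) := by
      refine lt_of_le_of_lt degree_C_le ?_
      have : 0 < q - 1 := by omega
      exact_mod_cast this
    obtain ⟨G, -, h1, h2, h3⟩ := adjoin_step (⊥ : IntermediateField E K) (T.x i) (X ^ (q - 1) + C (1 - w0))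
      (monic_X_pow_add hd) (by
        simp only [map_add, map_pow, aeval_X, aeval_C, map_sub, map_one]
        change T.x i ^ (q - 1) + (1 - (T.x i ^ (q - 1) + 1)) = 0
        ring) (q - 1) 1 (by
        apply natDegree_le_of_degree_le
        refine (degree_add_le _ _).trans (max_le (by rw [degree_X_pow]) hd.le)) (by simp)
    refine ⟨G, ?_, h2, by simpa using h3⟩
    intro j h4 h5
    obtain rfl : j = i := by omega
    exact h1
  | succ n ih =>
    obtain ⟨G, h1, h2, h3⟩ := ih (by omega)
    have hx := h1 (i + n) (by omega) le_rfl
    obtain ⟨G', h4, h5, h6, h7⟩ := adjoin_as G (T.x (i + n + 1)) q _ hq (by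
      change T.phi (i + n + 1) ∈ G
      rw [T.phi_succ _ (by omega)]
      exact mul_mem (pow_mem hx _) (inv_mem (add_mem (pow_mem hx _) hx))) h3
    refine ⟨G', ?_, h6, by rw [pow_succ, ← mul_assoc]; exact h7⟩
    intro j hj1 hj2
    rcases Nat.lt_or_ge (i + n) j with h | h
    · obtain rfl : j = i + n + 1 := by omega
      exact h5
    · exact h4 (h1 j hj1 h)

lemma deg_down (i N n : ℕ) (hiN : i ≤ N) (h : N ≤ L) (hn : n ≤ i) :
    ∃ G : IntermediateField (IntermediateField.adjoin F {T.ww i}) K,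
    (∀ j, i - n ≤ j → j ≤ N → T.x j ∈ G) ∧ FiniteDimensional (IntermediateField.adjoin F {T.ww i}) G ∧
    Module.finrank (IntermediateField.adjoin F {T.ww i}) G ≤ (q - 1) * q ^ (N - i + n) := by
  have hq := T.toTow.two_le
  induction n with
  | zero =>
    have := T.deg_up i (N - i) (by omega)
    rwa [show i + (N - i) = N by omega] at this
  | succ n ih =>
    obtain ⟨G, h1, h2, h3⟩ := ih (by omega)
    have hx := h1 (i - n) (by omega) (by omega)
    obtain ⟨G', h4, h5, h6, h7⟩ := adjoin_as G (1 / T.x (i - (n + 1))) q _ hq (by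
      rw [T.toTow.inv_rel _ (by omega), show i - (n + 1) + 1 = i - n by omega]
      exact div_mem (one_mem _) (add_mem (pow_mem hx _) hx)) h3
    refine ⟨G', ?_, h6, by rw [← add_assoc, pow_succ, ← mul_assoc]; exact h7⟩
    intro j hj1 hj2
    rcases Nat.lt_or_ge j (i - n) with h | h
    · obtain rfl : j = i - (n + 1) := by omega
      have := inv_mem h5
      simpa using this
    · exact h4 (h1 j h hj2)

lemma deg_bound (i N : ℕ) (hiN : i ≤ N) (h : N ≤ L) {ι : Type*} [Fintype ι] (b : ι → K)
    (hb : ∀ a, b a ∈ T.B N) (hli : LinearIndependent (IntermediateField.adjoin F {T.ww i}) b) :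
    Fintype.card ι ≤ (q - 1) * q ^ N := by
  obtain ⟨G, h1, h2, h3⟩ := T.deg_down i N i hiN h le_rfl
  rw [show N - i + i = N by omega] at h3
  have hx : ∀ j ≤ N, T.x j ∈ G := fun j hj => h1 j (by omega) hj
  have hBG : ∀ z ∈ T.B N, z ∈ G := by
    intro z hz
    have : T.B N ≤ (G.restrictScalars F).toSubalgebra := by
      apply Algebra.adjoin_le
      rintro _ (rfl | ⟨j, hj, rfl⟩)
      · change (T.phi 0)⁻¹ ∈ G
        exact inv_mem (add_mem (pow_mem (hx 0 (Nat.zero_le _)) _) (hx 0 (Nat.zero_le _)) : T.phi 0 ∈ G)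
      · exact hx j hj
    exact this hz
  let b' : ι → G := fun a => ⟨b a, hBG _ (hb a)⟩
  have hli' : LinearIndependent (IntermediateField.adjoin F {T.ww i}) b' :=
    LinearIndependent.of_comp G.val.toLinearMap hli
  exact hli'.fintype_card_le_finrank.trans h3

/-- elements whose product with `phi (N+1)` is regular at the places of type `i` -/
def J (N i : ℕ) : Submodule F K where
  carrier := {f | ∀ V : ValuationSubring K, T.x 0 ∈ V → T.Ty V.valuation i → f * T.phi (N + 1) ∈ V}
  zero_mem' := fun V _ _ => by simp [V.zero_mem]
  add_mem' := fun ha hb V h1 h2 => by rw [add_mul]; exact V.add_mem _ _ (ha V h1 h2) (hb V h1 h2)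
  smul_mem' := fun c f hf V h1 h2 => by
    rw [Algebra.smul_def, mul_assoc]
    exact V.mul_mem _ _ (alg_mem_val V c) (hf V h1 h2)

lemma J_indep (N i : ℕ) (hiN : i ≤ N) (hN : N < L) (S : Submodule F K) (hSA : ∀ f ∈ S, f ∈ T.A N)
    (hSJ : ∀ f ∈ S, f ∈ T.J N i → f = 0) (D : ℕ) (g : ℕ × ℕ → K) (hg : ∀ a, g a ∈ S)
    (hsum : ∑ a ∈ Finset.range D ×ˢ Finset.range (q ^ (N - i)),
      g a * (T.ww i ^ a.1 * T.phi (N + 1) ^ (q ^ (N - i) - 1 - a.2)) = 0) :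
    ∀ a ∈ Finset.range D ×ˢ Finset.range (q ^ (N - i)), g a = 0 := by
  classical
  by_contra! hne
  set M := q ^ (N - i) with hM
  set P := Finset.range D ×ˢ Finset.range M with hP
  obtain ⟨a0, ha0, hmin⟩ := (P.filter fun a => g a ≠ 0).exists_min_image (fun a => a.1 * M + a.2) (by
    obtain ⟨a, h1, h2⟩ := hne
    exact ⟨a, by simp [h1, h2]⟩)
  rw [Finset.mem_filter] at ha0
  have h1 : g a0 ∉ T.J N i := fun h => ha0.2 (hSJ _ (hg _) h)
  obtain ⟨V, hV0, hVT, hV⟩ : ∃ V : ValuationSubring K, T.x 0 ∈ V ∧ T.Ty V.valuation i ∧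
      g a0 * T.phi (N + 1) ∉ V := by
    by_contra! h
    exact h1 h
  rw [← V.valuation_le_one_iff, not_le, map_mul] at hV
  set v := V.valuation
  obtain ⟨h2, h3⟩ := T.toTow.ty_gt v i hVT (N - i) (by omega)
  rw [show i + (N - i) + 1 = N + 1 by omega] at h2 h3
  have hU : v (T.phi (N + 1)) = v (T.x (N + 1)) ^ q := T.toTow.v_phi_gt v _ h2
  have hUW : v (T.phi (N + 1)) ^ M * v (T.ww i) = 1 := by
    rw [hU, ← pow_mul, hM, ← pow_succ', h3]
  have hU1 : 1 < v (T.phi (N + 1)) := by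
    rw [hU]; exact one_lt_pow₀ h2 (by have := T.q_pos; omega)
  set U := v (T.phi (N + 1))
  set W := v (T.ww i)
  have hX : ∀ a ∈ P, W ^ a.1 * U ^ (M - 1 - a.2) * U ^ (a.1 * M + a.2) = U ^ (M - 1) := by
    intro a ha
    rw [hP, Finset.mem_product, Finset.mem_range, Finset.mem_range] at ha
    have e : M - 1 = M - 1 - a.2 + a.2 := by omega
    calc W ^ a.1 * U ^ (M - 1 - a.2) * U ^ (a.1 * M + a.2)
        = (U ^ M * W) ^ a.1 * U ^ (M - 1 - a.2 + a.2) := by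
          exact comm_aux U W a.1 M (M - 1 - a.2) a.2
      _ = U ^ (M - 1) := by rw [hUW, one_pow, one_mul, ← e]
  have hUpos : 0 < U := lt_trans zero_lt_one hU1
  rw [← Finset.add_sum_erase P _ ha0.1] at hsum
  have hlt := v.map_sum_lt (s := P.erase a0)
    (f := fun a => g a * (T.ww i ^ a.1 * T.phi (N + 1) ^ (M - 1 - a.2)))
    (g := v (g a0 * (T.ww i ^ a0.1 * T.phi (N + 1) ^ (M - 1 - a0.2)))) (by
      rw [v.ne_zero_iff]
      exact mul_ne_zero ha0.2 (mul_ne_zero (pow_ne_zero _ (T.toTow.ww_ne i (by omega)))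
        (pow_ne_zero _ (T.phi_ne _ (by omega))))) (by
      intro a ha
      rw [Finset.mem_erase] at ha
      have hv0 : v (g a0) ≠ 0 := v.ne_zero_iff.2 ha0.2
      have hA0 : 0 < v (g a0) * (W ^ a0.1 * U ^ (M - 1 - a0.2)) := by
        refine mul_pos (zero_lt_iff.2 hv0) (mul_pos (pow_pos ?_ _) (pow_pos hUpos _))
        exact zero_lt_iff.2 (v.ne_zero_iff.2 (T.toTow.ww_ne i (by omega)))
      by_cases hga : g a = 0
      · rw [hga, zero_mul, map_zero, map_mul, map_mul, map_pow, map_pow]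
        exact hA0
      have hm := hmin a (by simp [ha.2, hga])
      have hlt : a0.1 * M + a0.2 + 1 ≤ a.1 * M + a.2 := by
        rcases hm.lt_or_eq with h | h
        · exact h
        · exfalso
          apply ha.1
          have ha1 := ha.2
          have ha2 := ha0.1
          rw [hP, Finset.mem_product, Finset.mem_range, Finset.mem_range] at ha1 ha2
          have hMpos : 0 < M := by omega
          have e1 : a.2 = a0.2 := by
            have := congrArg (· % M) h
            simpa [Nat.mul_add_mod', Nat.mod_eq_of_lt ha1.2, Nat.mod_eq_of_lt ha2.2] using this.symm
          have e2 : a.1 = a0.1 := by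
            rw [e1] at h
            exact (Nat.eq_of_mul_eq_mul_right hMpos (by omega)).symm
          exact Prod.ext e2 e1
      have hga1 : v (g a) ≤ 1 := (V.valuation_le_one_iff _).2 ((hSA _ (hg a)).2 V hV0)
      have e1 := hX a ha.2
      have e0 := hX a0 ha0.1
      simp only [map_mul, map_pow]
      change v (g a) * (W ^ a.1 * U ^ (M - 1 - a.2)) < v (g a0) * (W ^ a0.1 * U ^ (M - 1 - a0.2))
      refine lt_of_le_of_lt (mul_le_of_le_one_left' hga1) ?_
      refine lt_of_mul_lt_mul_right (a := U ^ (a0.1 * M + a0.2 + 1)) ?_ zero_le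
      calc W ^ a.1 * U ^ (M - 1 - a.2) * U ^ (a0.1 * M + a0.2 + 1)
          ≤ W ^ a.1 * U ^ (M - 1 - a.2) * U ^ (a.1 * M + a.2) :=
            mul_le_mul_right (pow_le_pow_right₀ hU1.le hlt) _
        _ = U ^ (M - 1) * 1 := by rw [e1, mul_one]
        _ < U ^ (M - 1) * (v (g a0) * U) := by
            exact mul_lt_mul_of_pos_left hV (pow_pos hUpos _)
        _ = v (g a0) * (W ^ a0.1 * U ^ (M - 1 - a0.2)) * U ^ (a0.1 * M + a0.2 + 1) := by
            rw [← e0]; exact comm_aux2 _ _ _ _ _)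
  rw [eq_neg_of_add_eq_zero_left hsum, Valuation.map_neg] at hlt
  exact lt_irrefl _ hlt

end TowW
end tower
end GS


set_option linter.unusedSectionVars false

namespace GS
open Polynomial

/-- Submodules meeting an intersection trivially. -/
lemma finrank_inter {F K : Type*} [Field F] [AddCommGroup K] [Module F K] (A : Submodule F K)
    (J : ℕ → Submodule F K) (d : ℕ → ℕ) (I : Finset ℕ)
    (hJ : ∀ i ∈ I, ∀ S : Submodule F K, FiniteDimensional F S → S ≤ A → S ⊓ J i = ⊥ → Module.finrank F S ≤ d i)
    (S : Submodule F K) (hfd : FiniteDimensional F S) (hSA : S ≤ A)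
    (hS : ∀ f ∈ S, (∀ i ∈ I, f ∈ J i) → f = 0) : Module.finrank F S ≤ ∑ i ∈ I, d i := by
  classical
  induction I using Finset.induction_on generalizing S with
  | empty =>
    have : S = ⊥ := by
      rw [Submodule.eq_bot_iff]; intro f hf; exact hS f hf (by simp)
    subst this
    simp
  | insert i I hi ih =>
    rw [Finset.sum_insert hi]
    have hfd1 : FiniteDimensional F (S ⊓ J i : Submodule F K) :=
      Submodule.finiteDimensional_of_le (S₂ := S) inf_le_left
    have h1 := ih (fun j hj => hJ j (by simp [hj])) (S ⊓ J i) hfd1 (inf_le_left.trans hSA) (by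
      intro f hf h
      refine hS f hf.1 ?_
      intro j hj
      rcases Finset.mem_insert.1 hj with rfl | hj
      · exact hf.2
      · exact h j hj)
    obtain ⟨C, hC⟩ := Submodule.exists_isCompl ((J i).submoduleOf S)
    have hfdC : FiniteDimensional F (C.map S.subtype) := inferInstance
    have h2 := hJ i (by simp) (C.map S.subtype) hfdC (by
      rintro _ ⟨c, -, rfl⟩; exact hSA c.2) (by
      rw [Submodule.eq_bot_iff]
      rintro _ ⟨⟨c, hc, rfl⟩, h⟩
      have : c ∈ (J i).submoduleOf S ⊓ C := ⟨h, hc⟩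
      rw [hC.inf_eq_bot, Submodule.mem_bot] at this
      simp [this])
    have h3 := Submodule.finrank_add_eq_of_isCompl hC
    have h4 : Module.finrank F ((J i).submoduleOf S) = Module.finrank F (S ⊓ J i : Submodule F K) := by
      rw [← Submodule.finrank_map_subtype_eq S ((J i).submoduleOf S)]
      rw [Submodule.submoduleOf, Submodule.map_comap_subtype]
    rw [Submodule.finrank_map_subtype_eq] at h2
    omega

/-- gap sets and colength -/
lemma gaps_colen {F K : Type*} [Field F] [Field K] [Algebra F K] (w : WtF F K) (κ : ℕ) (hκ : 0 < κ)
    (A J : Submodule F K) (d : ℕ) (hJA : J ≤ A)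
    (hJ : ∀ S : Submodule F K, FiniteDimensional F S → S ≤ A → (∀ f ∈ S, f ∈ J → f = 0) → Module.finrank F S ≤ d)
    (hfin : (gaps w κ A).Finite) : (gaps w κ J).Finite ∧ (gaps w κ J).ncard ≤ (gaps w κ A).ncard + d := by
  classical
  have key : ∀ t : Finset ℕ, (t : Set ℕ) ⊆ gaps w κ J \ gaps w κ A → t.card ≤ d := by
    intro t ht
    have hex : ∀ l : t, ∃ v ∈ A, v ≠ 0 ∧ w.wt v = κ * (l : ℕ) := by
      rintro ⟨l, hl⟩
      have := (ht hl).2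
      simpa [gaps] using this
    choose v hvA hv0 hvw using hex
    have hκ' : (κ : ℤ) ≠ 0 := by positivity
    have main : ∀ c : t → F, (∃ i, c i ≠ 0) → ∑ l, c l • v l ∉ J ∧ ∑ l, c l • v l ≠ 0 := by
      rintro c ⟨i, hi⟩
      obtain ⟨j, -, hj0, hs0, hsw, -⟩ := w.sum_distinct Finset.univ (fun l => c l • v l) (by
        intro i _ j _ hi hj hij
        have hi' : c i ≠ 0 := by rintro h; simp [h] at hi
        have hj' : c j ≠ 0 := by rintro h; simp [h] at hj
        rw [w.smul _ hi' _ (hv0 i), w.smul _ hj' _ (hv0 j), hvw, hvw] at hij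
        have := mul_left_cancel₀ hκ' hij
        exact Subtype.ext (by exact_mod_cast this)) ⟨i, Finset.mem_univ _, smul_ne_zero hi (hv0 i)⟩
      have hj' : c j ≠ 0 := by rintro h; simp [h] at hj0
      rw [w.smul _ hj' _ (hv0 j), hvw] at hsw
      exact ⟨fun h => (ht j.2).1 ⟨_, h, hs0, hsw⟩, hs0⟩
    have hli : LinearIndependent F v := by
      rw [Fintype.linearIndependent_iff]
      intro c hc
      by_contra! h
      exact (main c h).2 hc
    have h1 := finrank_span_eq_card hli
    have h2 := hJ (Submodule.span F (Set.range v)) (FiniteDimensional.span_of_finite F (Set.finite_range v))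
      (by rw [Submodule.span_le]; rintro _ ⟨l, rfl⟩; exact hvA l) (by
        intro f hf hfJ
        rw [Submodule.mem_span_range_iff_exists_fun] at hf
        obtain ⟨c, rfl⟩ := hf
        by_cases h : ∃ i, c i ≠ 0
        · exact absurd hfJ (main c h).1
        · push Not at h
          simp [h])
    rw [h1] at h2
    simpa using h2
  have hdfin : (gaps w κ J \ gaps w κ A).Finite := by
    by_contra hinf
    obtain ⟨t, ht1, ht2⟩ := Set.Infinite.exists_subset_card_eq hinf (d + 1)
    have := key t ht1
    omega
  have hdc : (gaps w κ J \ gaps w κ A).ncard ≤ d := by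
    rw [Set.ncard_eq_toFinset_card _ hdfin]
    exact key _ (by simp)
  have hJfin : (gaps w κ J).Finite := by
    refine (hdfin.union hfin).subset ?_
    intro l hl
    by_cases h : l ∈ gaps w κ A
    · exact Or.inr h
    · exact Or.inl ⟨hl, h⟩
  refine ⟨hJfin, ?_⟩
  have := Set.ncard_sdiff_add_ncard_of_subset (gaps_anti w hJA) hJfin
  omega

section tower
variable {F K : Type*} [Field F] [Finite F] [Field K] [Algebra F K] [CharP K 2] {q L : ℕ} (T : TowW F K q L)

namespace TowW

include T

open IntermediateField.algebraAdjoinAdjoin in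
lemma J_colen (N i : ℕ) (hiN : i ≤ N) (hN : N < L) (S : Submodule F K) (hfd : FiniteDimensional F S)
    (hSA : S ≤ (T.A N).toSubmodule) (hSJ : S ⊓ T.J N i = ⊥) :
    Module.finrank F S ≤ (q - 1) * q ^ i := by
  classical
  have hqp := T.q_pos
  let M := q ^ (N - i)
  have hM : 0 < M := pow_pos hqp _
  let b := Module.finBasis F S
  let s := Module.finrank F S
  let fam : Fin s × Fin M → K := fun a => (b a.1 : K) * T.phi (N + 1) ^ (M - 1 - a.2)
  have hli : LinearIndependent (Algebra.adjoin F {T.ww i}) fam := by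
    rw [Fintype.linearIndependent_iff]
    intro c hc
    have hex : ∀ a, ∃ p : F[X], (c a : K) = aeval (T.ww i) p := by
      intro a
      have h1 : ∀ z ∈ Algebra.adjoin F {T.ww i}, ∃ p : F[X], aeval (T.ww i) p = z := by
        intro z hz
        rw [Algebra.adjoin_singleton_eq_range_aeval] at hz
        exact hz
      obtain ⟨p, hp⟩ := h1 _ (c a).2
      exact ⟨p, hp.symm⟩
    choose p hp using hex
    let D := Finset.univ.sup (fun a => (p a).natDegree) + 1
    have hD : ∀ a, (p a).natDegree < D := fun a =>
      Nat.lt_succ_of_le (Finset.le_sup (f := fun a => (p a).natDegree) (Finset.mem_univ a))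
    let g : ℕ × ℕ → K := fun a => if h : a.2 < M then ∑ j, (p (j, ⟨a.2, h⟩)).coeff a.1 • (b j : K) else 0
    have hz := T.J_indep N i hiN hN S hSA (by
      intro f h1 h2
      have : f ∈ S ⊓ T.J N i := ⟨h1, h2⟩
      rw [hSJ] at this
      simpa using this) D g (by
        intro a
        simp only [g]
        split_ifs
        · exact sum_mem fun j _ => Submodule.smul_mem _ _ (b j).2
        · exact zero_mem _) (by
      rw [← hc, Finset.sum_product, Fintype.sum_prod_type_right, Finset.sum_comm, Finset.sum_range]
      apply Finset.sum_congr rfl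
      intro e _
      have e1 : ∀ n, g (n, (e : ℕ)) = ∑ j, (p (j, e)).coeff n • (b j : K) := by
        intro n
        simp only [g]
        rw [dif_pos e.2]
      simp only [e1, Finset.sum_mul]
      rw [Finset.sum_comm]
      apply Finset.sum_congr rfl
      intro j _
      rw [Subalgebra.smul_def, hp, aeval_eq_sum_range' (hD (j, e)), smul_eq_mul, Finset.sum_mul]
      apply Finset.sum_congr rfl
      intro n _
      simp only [fam, Algebra.smul_def]
      ring)
    rintro ⟨j, e⟩
    apply Subtype.ext
    rw [hp]
    suffices p (j, e) = 0 by simp [this]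
    ext n
    rcases Nat.lt_or_ge n D with h | h
    · have h1 := hz (n, e) (by simp [h]; exact e.2)
      simp only [g] at h1
      rw [dif_pos e.2] at h1
      have h2 : ∑ j, (p (j, e)).coeff n • b j = 0 := by
        apply Subtype.ext
        push_cast
        exact h1
      simpa using Fintype.linearIndependent_iff.1 b.linearIndependent _ h2 j
    · rw [coeff_eq_zero_of_natDegree_lt (lt_of_lt_of_le (hD _) h)]; simp
  have hli' : LinearIndependent (IntermediateField.adjoin F {T.ww i}) fam :=
    (LinearIndependent.iff_fractionRing (Algebra.adjoin F {T.ww i}) (IntermediateField.adjoin F {T.ww i})).1 hli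
  have h := T.deg_bound i N hiN hN.le fam (by
    intro a
    exact mul_mem (hSA (b a.1).2).1 (pow_mem (T.phi_succ_mem le_rfl hN) _)) hli'
  rw [Fintype.card_prod, Fintype.card_fin, Fintype.card_fin] at h
  have e : q ^ N = q ^ i * M := by simp only [M]; rw [← pow_add]; congr 1; omega
  rw [e, ← mul_assoc] at h
  exact Nat.le_of_mul_le_mul_right h hM

/-- the total conductor -/
def JJ (N : ℕ) : Submodule F K := (T.A N).toSubmodule ⊓ ⨅ i ∈ Finset.range (N / 2 + 1), T.J N i

lemma JJ_gaps (N : ℕ) (hN : N < L) (κ : ℕ) (hκ : 0 < κ) (hfin : (gaps T.w κ (T.A N).toSubmodule).Finite) :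
    (gaps T.w κ (T.JJ N)).Finite ∧ (gaps T.w κ (T.JJ N)).ncard + 1 ≤
      (gaps T.w κ (T.A N).toSubmodule).ncard + q ^ (N / 2 + 1) := by
  have hs : ∀ n, ∑ i ∈ Finset.range n, (q - 1) * q ^ i + 1 = q ^ n := by
    intro n
    induction n with
    | zero => simp
    | succ n ih =>
      rw [Finset.sum_range_succ]
      obtain ⟨r, hr⟩ : ∃ r, q = r + 1 := ⟨q - 1, by have := T.q_pos; omega⟩
      have : (q - 1) * q ^ n + q ^ n = q ^ (n + 1) := by
        rw [hr, Nat.add_sub_cancel]; ring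
      omega
  have h := gaps_colen T.w κ hκ (T.A N).toSubmodule (T.JJ N) (∑ i ∈ Finset.range (N / 2 + 1), (q - 1) * q ^ i)
    inf_le_left (by
      intro S hfd hSA hSJ
      refine finrank_inter (T.A N).toSubmodule (T.J N) _ _ (fun i hi S h1 h2 h3 =>
        T.J_colen N i ?_ hN S h1 h2 h3) S hfd hSA ?_
      · have := Finset.mem_range.1 hi; omega
      · intro f hf h
        refine hSJ f hf ⟨hSA hf, ?_⟩
        simpa [Submodule.mem_iInf] using h) hfin
  refine ⟨h.1, ?_⟩
  rw [← hs]
  omega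

end TowW
end tower
end GS


set_option linter.unusedSectionVars false

namespace GS
open Polynomial

section polymod
variable {F K : Type*} [Field F] [Field K] [Algebra F K]

/-- polynomials with prescribed coefficient modules -/
def DD (N : ℕ → Submodule F K) : Submodule F K[X] where
  carrier := {p | ∀ e, p.coeff e ∈ N e}
  zero_mem' := fun e => by simp
  add_mem' := fun ha hb e => by rw [coeff_add]; exact add_mem (ha e) (hb e)
  smul_mem' := fun c p hp e => by rw [coeff_smul]; exact Submodule.smul_mem _ _ (hp e)

lemma DD_mono {N N' : ℕ → Submodule F K} (h : ∀ e, N e ≤ N' e) : DD N ≤ DD N' := fun _ hp e => h e (hp e)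

/-- evaluation -/
noncomputable def evz (F : Type*) {K : Type*} [Field F] [Field K] [Algebra F K] (z : K) : K[X] →ₗ[F] K :=
  (aeval (R := K) z).toLinearMap.restrictScalars F

lemma evz_apply (z : K) (p : K[X]) : evz F z p = p.eval z := by
  simp [evz, coe_aeval_eq_eval]

lemma evz_sum (q : ℕ) (hq : 0 < q) (N : ℕ → Submodule F K) (hN : ∀ e, q ≤ e → N e = ⊥) (p : K[X]) (hp : p ∈ DD N) (z : K) :
    evz F z p = ∑ e ∈ Finset.range q, p.coeff e * z ^ e := by
  rw [evz_apply, eval_eq_sum_range']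
  by_cases h0 : p = 0
  · simp [h0, hq]
  rw [natDegree_lt_iff_degree_lt h0, degree_lt_iff_coeff_zero]
  intro e he
  have := hp e
  rw [hN e he] at this
  simpa using this

lemma taylor_DD (q : ℕ) (N : ℕ → Submodule F K) (hN : ∀ e, q ≤ e → N e = ⊥) (r : K)
    (hr : ∀ e j, j ≤ e → e < q → ∀ c ∈ N e, c * r ^ (e - j) ∈ N j) (p : K[X]) (hp : p ∈ DD N) :
    taylor r p ∈ DD N := by
  rw [p.as_sum_range_C_mul_X_pow, map_sum]
  refine sum_mem fun e _ => ?_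
  intro j
  rw [taylor_mul, taylor_C, taylor_X_pow, coeff_C_mul, coeff_X_add_C_pow]
  rcases Nat.lt_or_ge e q with h | h
  · rcases Nat.lt_or_ge e j with h1 | h1
    · rw [Nat.choose_eq_zero_of_lt h1]; simp
    · rw [← mul_assoc, mul_comm _ ((_ : ℕ) : K), ← nsmul_eq_mul]
      exact nsmul_mem (hr e j h1 h _ (hp e)) _
  · have := hp e
    rw [hN e h] at this
    have h0 : p.coeff e = 0 := by simpa using this
    rw [h0]; simp

lemma finrank_map_quot {E : Type*} [AddCommGroup E] [Module F E] (f : E →ₗ[F] K) (P P' : Submodule F E)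
    (hP : P' ≤ P) (hf : ∀ p ∈ P, f p = 0 → p = 0) :
    Module.finrank F (P.map f ⧸ (P'.map f).submoduleOf (P.map f)) = Module.finrank F (P ⧸ P'.submoduleOf P) := by
  have hinj : Function.Injective (f.submoduleMap P) := by
    rw [← LinearMap.ker_eq_bot, LinearMap.ker_eq_bot']
    intro p h
    have := congrArg Subtype.val h
    exact Subtype.ext (hf p p.2 this)
  let e : P ≃ₗ[F] P.map f := LinearEquiv.ofBijective (f.submoduleMap P) ⟨hinj, f.submoduleMap_surjective P⟩
  refine (LinearEquiv.finrank_eq (Submodule.Quotient.equiv (P'.submoduleOf P) ((P'.map f).submoduleOf (P.map f)) e ?_)).symm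
  ext ⟨z, hz⟩
  constructor
  · rintro ⟨⟨p, hp⟩, hp', h⟩
    have h1 : f p = z := congrArg Subtype.val h
    exact ⟨p, hp', h1⟩
  · rintro ⟨p, hp', h⟩
    exact ⟨⟨p, hP hp'⟩, hp', Subtype.ext h⟩

variable (w : WtF F K) (q κ : ℕ) (hq : 0 < q) (hκ : 0 < κ) (y : K) (hy : y ≠ 0) (hyw : w.wt y = κ)
  (N : ℕ → Submodule F K) (hN : ∀ e, q ≤ e → N e = ⊥) (hG : ∀ e < q, Good w (q * κ) (N e))
include hq hκ hy hyw hN hG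

lemma DD_wt (p : K[X]) (hp : p ∈ DD N) (h0 : p ≠ 0) :
    ∃ e < q, p.coeff e ≠ 0 ∧ evz F y p ≠ 0 ∧ w.wt (evz F y p) = w.wt (p.coeff e) + e * κ := by
  rw [evz_sum q hq N hN p hp y]
  obtain ⟨e, h1, h2, h3, h4, -⟩ := w.sum_pow q κ hκ y hy hyw p.coeff (by
    intro e he hc
    obtain ⟨l, hl⟩ := hG e he _ (hp e) hc
    exact ⟨l, hl⟩) (by
    by_contra! h
    apply h0
    ext e
    rcases Nat.lt_or_ge e q with h' | h'
    · simpa using h e h'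
    · have := hp e
      rw [hN e h'] at this
      simpa using this)
  exact ⟨e, h1, h2, h3, h4⟩

lemma DD_inj (p : K[X]) (hp : p ∈ DD N) (h : evz F y p = 0) : p = 0 := by
  by_contra h0
  obtain ⟨e, h1, h2, h3, h4⟩ := DD_wt w q κ hq hκ y hy hyw N hN hG p hp h0
  exact h3 h

lemma DD_good : Good w κ ((DD N).map (evz F y)) := by
  rintro _ ⟨p, hp, rfl⟩ h0
  obtain ⟨e, h1, h2, h3, h4⟩ := DD_wt w q κ hq hκ y hy hyw N hN hG p hp (by rintro rfl; simp at h0)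
  obtain ⟨l, hl⟩ := hG e h1 _ (hp e) h2
  refine ⟨q * l + e, ?_⟩
  rw [h4, hl]; push_cast; ring

lemma DD_gaps_iff (e : ℕ) (he : e < q) (l : ℕ) :
    e + q * l ∈ gaps w κ ((DD N).map (evz F y)) ↔ l ∈ gaps w (q * κ) (N e) := by
  have hκ' : (κ : ℤ) ≠ 0 := by positivity
  rw [gaps, gaps, Set.mem_ofPred_eq, Set.mem_ofPred_eq, not_iff_not]
  constructor
  · rintro ⟨_, ⟨p, hp, rfl⟩, h0, h⟩
    obtain ⟨e', h1, h2, h3, h4⟩ := DD_wt w q κ hq hκ y hy hyw N hN hG p hp (by rintro rfl; simp at h0)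
    obtain ⟨l', hl'⟩ := hG e' h1 _ (hp e') h2
    rw [h4, hl'] at h
    have h5 : (κ : ℤ) * ((e' + q * l' : ℕ) : ℤ) = κ * ((e + q * l : ℕ) : ℤ) := by
      rw [← h]; push_cast; ring
    have h6 : e' + q * l' = e + q * l := by exact_mod_cast mul_left_cancel₀ hκ' h5
    have h7 : e' = e := by
      have := congrArg (· % q) h6
      simpa [Nat.mod_eq_of_lt he, Nat.mod_eq_of_lt h1] using this
    subst h7
    have h8 : l' = l := Nat.eq_of_mul_eq_mul_left hq (by omega)
    subst h8
    exact ⟨_, hp e', h2, hl'⟩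
  · rintro ⟨c, hc, h0, h⟩
    have hmem : C c * X ^ e ∈ DD N := by
      intro j
      rw [coeff_C_mul, coeff_X_pow]
      split_ifs with hj
      · subst hj; simpa using hc
      · simp
    refine ⟨evz F y (C c * X ^ e), ⟨_, hmem, rfl⟩, ?_, ?_⟩
    · rw [evz_apply]; simp [h0, hy]
    · rw [evz_apply, eval_mul, eval_C, eval_pow, eval_X, w.mul' _ _ h0 (pow_ne_zero _ hy), h, w.pow _ hy, hyw]
      push_cast; ring

lemma DD_gaps (hfin : ∀ e < q, (gaps w (q * κ) (N e)).Finite) :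
    (gaps w κ ((DD N).map (evz F y))).Finite ∧
    (gaps w κ ((DD N).map (evz F y))).ncard = ∑ e ∈ Finset.range q, (gaps w (q * κ) (N e)).ncard := by
  classical
  let f : ℕ → Finset ℕ := fun e => if h : e < q then (hfin e h).toFinset.image (fun l => e + q * l) else ∅
  have heq : gaps w κ ((DD N).map (evz F y)) = ((Finset.range q).biUnion f : Finset ℕ) := by
    ext l
    rw [Finset.mem_coe, Finset.mem_biUnion]
    constructor
    · intro hl
      have he := Nat.mod_lt l hq
      refine ⟨l % q, Finset.mem_range.2 he, ?_⟩
      simp only [f]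
      rw [dif_pos he, Finset.mem_image]
      refine ⟨l / q, ?_, Nat.mod_add_div l q⟩
      rw [Set.Finite.mem_toFinset, ← DD_gaps_iff w q κ hq hκ y hy hyw N hN hG _ he, Nat.mod_add_div]
      exact hl
    · rintro ⟨e, he, h⟩
      have he := Finset.mem_range.1 he
      simp only [f] at h
      rw [dif_pos he, Finset.mem_image] at h
      obtain ⟨l', h1, rfl⟩ := h
      rw [Set.Finite.mem_toFinset] at h1
      exact (DD_gaps_iff w q κ hq hκ y hy hyw N hN hG _ he _).2 h1
  rw [heq]
  refine ⟨Finset.finite_toSet _, ?_⟩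
  rw [Set.ncard_coe_finset, Finset.card_biUnion]
  · apply Finset.sum_congr rfl
    intro e he
    have he := Finset.mem_range.1 he
    simp only [f]
    rw [dif_pos he, Finset.card_image_of_injective, Set.ncard_eq_toFinset_card _ (hfin e he)]
    intro a b hab
    exact Nat.eq_of_mul_eq_mul_left hq (by simpa using hab)
  · intro e he e' he' hne
    have he := Finset.mem_range.1 he
    have he' := Finset.mem_range.1 he'
    change Disjoint (f e) (f e')
    rw [Finset.disjoint_left]
    intro l h1 h2
    simp only [f] at h1 h2
    rw [dif_pos he, Finset.mem_image] at h1
    rw [dif_pos he', Finset.mem_image] at h2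
    obtain ⟨a, -, rfl⟩ := h1
    obtain ⟨b, -, hb⟩ := h2
    apply hne
    have := congrArg (· % q) hb
    simpa [Nat.mod_eq_of_lt he, Nat.mod_eq_of_lt he'] using this.symm

end polymod
end GS


set_option linter.unusedSectionVars false

namespace GS
open Polynomial

section tower
variable {F K : Type*} [Field F] [Finite F] [Field K] [Algebra F K] [CharP K 2] {q L : ℕ} (T : TowW F K q L)

namespace TowW

include T

lemma rr_mem (N : ℕ) (hN : N < L) : T.rr (N + 1) ∈ T.B N := by
  rw [Tow.rr]
  refine sum_mem fun i hi => ?_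
  rw [Finset.mem_filter, Finset.mem_range] at hi
  have hH : ∀ n, n ≤ N + 1 → T.HH n ∈ T.B N := by
    intro n hn
    refine pow_mem (prod_mem fun j hj => T.ww_mem ?_) _
    have := Finset.mem_range.1 hj
    omega
  rw [div_eq_mul_inv]
  refine mul_mem (mul_mem (pow_mem (T.x_mem (by omega)) _) (add_mem (hH _ (by omega)) (hH _ (by omega))))
    (T.x_inv_mem (by omega) (by omega))

lemma JJ_mul (N : ℕ) (f j : K) (hf : f ∈ T.A N) (hj : j ∈ T.JJ N) : f * j ∈ T.JJ N := by
  refine ⟨(T.A N).mul_mem hf hj.1, ?_⟩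
  have h := hj.2
  simp only [SetLike.mem_coe, Submodule.mem_iInf] at h ⊢
  intro i hi V h1 h2
  rw [mul_assoc]
  exact V.mul_mem _ _ (hf.2 V h1) (h i hi V h1 h2)

lemma JJ_eta (N : ℕ) (hN : N < L) (j : K) (hj : j ∈ T.JJ N) (e : ℕ) (he : e < q) :
    j * (T.x (N + 1) + T.rr (N + 1)) ^ e ∈ T.A (N + 1) := by
  refine ⟨mul_mem (T.B_mono (Nat.le_succ N) hj.1.1) (pow_mem (add_mem (T.x_mem le_rfl)
    (T.B_mono (Nat.le_succ N) (T.rr_mem N hN))) _), ?_⟩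
  intro V hV
  rw [← V.valuation_le_one_iff, map_mul, map_pow]
  have h0 := (V.valuation_le_one_iff _).2 hV
  have hj1 := (V.valuation_le_one_iff _).2 (hj.1.2 V hV)
  have hm := T.toTow.main_r V.valuation h0 (N + 1) (by omega) (by omega)
  set v := V.valuation
  set η := T.x (N + 1) + T.rr (N + 1) with hη
  rcases le_or_gt (v η) 1 with h | h
  · exact mul_le_one' hj1 (pow_le_one' h e)
  obtain ⟨h1, h2⟩ := hm.resolve_left (not_le.2 h)
  have e1 : η ^ q + η = T.phi (N + 1) + (T.rr (N + 1) ^ q + T.rr (N + 1)) := by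
    rw [hη, T.toTow.add_pow_q, phi]; ring
  have h3 := T.toTow.v_phi_le v _ h1
  have h4 := T.toTow.v_phi_gt v η h
  refine le_trans (b := v j * v η ^ q) (mul_le_mul_right (pow_le_pow_right₀ h.le he.le) _) ?_
  rw [← h4, ← map_mul, e1, mul_add]
  refine v.map_add_le ?_ ?_
  · rcases h2 with h2 | ⟨i, hi, hT⟩
    · rw [map_mul]; exact mul_le_one' hj1 h2
    · have hji := hj.2
      simp only [SetLike.mem_coe, Submodule.mem_iInf] at hji
      exact (V.valuation_le_one_iff _).2 (hji i (Finset.mem_range.2 (by omega)) V hV hT)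
  · rw [map_mul]; exact mul_le_one' hj1 h3

/-- multiplication by an element as a linear map -/
lemma step (N : ℕ) (hN : N < L) (hfin : (gaps T.w (q ^ (L - N)) (T.A N).toSubmodule).Finite) :
    (gaps T.w (q ^ (L - (N + 1))) (T.A (N + 1)).toSubmodule).Finite ∧
    (gaps T.w (q ^ (L - (N + 1))) (T.A (N + 1)).toSubmodule).ncard + (q - 1) ≤
      q * (gaps T.w (q ^ (L - N)) (T.A N).toSubmodule).ncard + (q - 1) * q ^ (N / 2 + 1) := by
  classical
  have hq := T.q_pos
  set κ := q ^ (L - (N + 1)) with hκdef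
  have hκ : 0 < κ := pow_pos hq _
  have eκ : q ^ (L - N) = q * κ := by rw [hκdef, ← pow_succ']; congr 1; omega
  rw [eκ] at hfin ⊢
  have hGA : Good T.w (q * κ) (T.A N).toSubmodule := by rw [← eκ]; exact T.A_good N hN.le
  obtain ⟨hJf, hJc⟩ := T.JJ_gaps N hN (q * κ) (by positivity) hfin
  set y := T.x (N + 1) with hydef
  have hy : y ≠ 0 := T.ne _ hN
  have hyw : T.w.wt y = κ := by rw [hydef, T.hw _ hN, hκdef]; push_cast; rfl
  set r := T.rr (N + 1) with hrdef
  have hrB : r ∈ T.B N := T.rr_mem N hN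
  obtain ⟨c, hc⟩ := T.exists_A N hN.le r hrB
  set ω := T.phi 0 ^ c with hω
  have hω0 : ω ≠ 0 := pow_ne_zero _ (T.phi_ne 0 (Nat.zero_le _))
  have hωA : ω ∈ T.A N := ⟨pow_mem (T.phi_mem (Nat.zero_le _)) _, pow_mem T.phi0_Ab _⟩
  -- the three families
  let N1 : ℕ → Submodule F K := fun e => if e < q then (if e = 0 then (T.A N).toSubmodule else T.JJ N) else ⊥
  let N2 : ℕ → Submodule F K := fun e => if e < q then (T.JJ N).map (LinearMap.mulLeft F (ω ^ e)) else ⊥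
  let N3 : ℕ → Submodule F K := fun e => if e < q then (T.B N).toSubmodule else ⊥
  have hN1 : ∀ e, q ≤ e → N1 e = ⊥ := fun e he => if_neg (not_lt.2 he)
  have hN2 : ∀ e, q ≤ e → N2 e = ⊥ := fun e he => if_neg (not_lt.2 he)
  have hN3 : ∀ e, q ≤ e → N3 e = ⊥ := fun e he => if_neg (not_lt.2 he)
  have hJA : T.JJ N ≤ (T.A N).toSubmodule := inf_le_left
  have hN2J : ∀ e, N2 e ≤ T.JJ N := by
    intro e
    simp only [N2]
    split_ifs
    · rintro _ ⟨j, hj, rfl⟩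
      exact T.JJ_mul N _ _ (pow_mem hωA e) hj
    · exact bot_le
  have hN21 : ∀ e, N2 e ≤ N1 e := by
    intro e
    by_cases he : e < q
    · refine (hN2J e).trans ?_
      simp only [N1]
      rw [if_pos he]
      split_ifs
      · exact hJA
      · exact le_rfl
    · rw [hN2 e (not_lt.1 he)]; exact bot_le
  have hN1A : ∀ e, N1 e ≤ (T.A N).toSubmodule := by
    intro e
    simp only [N1]
    split_ifs
    · exact le_rfl
    · exact hJA
    · exact bot_le
  have hAB : ∀ f ∈ T.A N, f ∈ T.B N := fun f hf => hf.1
  have hN13 : ∀ e, N1 e ≤ N3 e := by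
    intro e
    by_cases he : e < q
    · refine (hN1A e).trans ?_
      simp only [N3]
      rw [if_pos he]
      exact hAB
    · rw [hN1 e (not_lt.1 he)]; exact bot_le
  have hG1 : ∀ e < q, Good T.w (q * κ) (N1 e) := fun e _ f hf => hGA f (hN1A e hf)
  have hG2 : ∀ e < q, Good T.w (q * κ) (N2 e) := fun e _ f hf => hGA f (hJA (hN2J e hf))
  -- taylor shifts
  have ht3 : ∀ p ∈ DD N3, taylor r p ∈ DD N3 := by
    intro p hp
    refine taylor_DD q N3 hN3 r ?_ p hp
    intro e j hje he c hc
    simp only [N3] at hc ⊢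
    rw [if_pos he] at hc
    rw [if_pos (by omega)]
    exact (T.B N).mul_mem hc (pow_mem hrB _)
  have ht2 : ∀ p ∈ DD N2, taylor r p ∈ DD N2 := by
    intro p hp
    refine taylor_DD q N2 hN2 r ?_ p hp
    intro e j hje he c hc'
    simp only [N2] at hc' ⊢
    rw [if_pos he] at hc'
    rw [if_pos (by omega)]
    obtain ⟨z, hz, rfl⟩ := hc'
    refine ⟨(ω * r) ^ (e - j) * z, T.JJ_mul N _ _ (pow_mem hc _) hz, ?_⟩
    simp only [LinearMap.mulLeft_apply]
    obtain ⟨d, rfl⟩ := Nat.exists_eq_add_of_le hje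
    rw [Nat.add_sub_cancel_left]
    ring
  have hrr : y + r + r = y := by linear_combination r * CharTwo.two_eq_zero (R := K)
  -- injectivity
  have hinj : ∀ p ∈ DD N3, evz F y p = 0 → p = 0 := by
    intro p hp h
    by_contra h0
    rw [evz_sum q hq N3 hN3 p hp y] at h
    obtain ⟨e, _, _, h3, _, _⟩ := T.w.sum_pow q κ hκ y hy hyw p.coeff (by
      intro e he hc
      rw [← eκ]
      refine T.wt_dvd N hN.le _ ?_ hc
      have := hp e
      simp only [N3] at this
      rwa [if_pos he] at this) (by
      by_contra! h
      apply h0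
      ext e
      rcases Nat.lt_or_ge e q with h' | h'
      · simpa using h e h'
      · have := hp e
        rw [hN3 e h'] at this
        simpa using this)
    exact h3 h
  have hinj' : ∀ p ∈ DD N3, evz F (y + r) p = 0 → p = 0 := by
    intro p hp h
    have h1 := hinj _ (ht3 p hp) (by rw [evz_apply, taylor_eval, ← h, evz_apply])
    exact taylor_injective r (by rw [h1, map_zero])
  have hWeq : (DD N2).map (evz F (y + r)) = (DD N2).map (evz F y) := by
    apply le_antisymm
    · rintro _ ⟨p, hp, rfl⟩
      exact ⟨taylor r p, ht2 p hp, by rw [evz_apply, evz_apply, taylor_eval]⟩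
    · rintro _ ⟨p, hp, rfl⟩
      exact ⟨taylor r p, ht2 p hp, by rw [evz_apply, evz_apply, taylor_eval, hrr]⟩
  have hq1 := finrank_map_quot (evz F y) (DD N1) (DD N2) (DD_mono hN21) (fun p hp => hinj p (DD_mono hN13 hp))
  have hq2 := finrank_map_quot (evz F (y + r)) (DD N1) (DD N2) (DD_mono hN21) (fun p hp => hinj' p (DD_mono hN13 hp))
  -- gaps
  have hf1 : ∀ e < q, (gaps T.w (q * κ) (N1 e)).Finite := by
    intro e he
    simp only [N1]
    rw [if_pos he]
    split_ifs
    · exact hfin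
    · exact hJf
  have hf2 : ∀ e < q, (gaps T.w (q * κ) (N2 e)).Finite := by
    intro e he
    have hωe : ω ^ e ≠ 0 := pow_ne_zero _ hω0
    obtain ⟨a, ha⟩ := hGA _ (pow_mem hωA e) hωe
    have hsub : gaps T.w (q * κ) (N2 e) ⊆ Set.Iio a ∪ (fun l => l + a) '' gaps T.w (q * κ) (T.JJ N) := by
      intro l hl
      rcases Nat.lt_or_ge l a with h | h
      · exact Or.inl h
      · right
        refine ⟨l - a, ?_, Nat.sub_add_cancel h⟩
        rintro ⟨z, hz, hz0, hzw⟩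
        apply hl
        refine ⟨ω ^ e * z, ?_, mul_ne_zero hωe hz0, ?_⟩
        · simp only [N2]
          rw [if_pos he]
          exact ⟨z, hz, rfl⟩
        · rw [T.w.mul' _ _ hωe hz0, ha, hzw]
          push_cast [Nat.cast_sub h]
          ring
    exact ((Set.finite_Iio a).union (hJf.image _)).subset hsub
  obtain ⟨hV0f, hV0c⟩ := DD_gaps T.w q κ hq hκ y hy hyw N1 hN1 hG1 hf1
  obtain ⟨hWf, -⟩ := DD_gaps T.w q κ hq hκ y hy hyw N2 hN2 hG2 hf2
  have hGV0 := DD_good T.w q κ hq hκ y hy hyw N1 hN1 hG1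
  have hd1 := (dim_quot T.w hκ (Submodule.map_mono (DD_mono hN21)) hGV0 hWf).2
  -- V'
  have hV'A : (DD N1).map (evz F (y + r)) ≤ (T.A (N + 1)).toSubmodule := by
    rintro _ ⟨p, hp, rfl⟩
    rw [evz_sum q hq N1 hN1 p hp]
    refine sum_mem fun e he => ?_
    have he := Finset.mem_range.1 he
    have h := hp e
    simp only [N1] at h
    rw [if_pos he] at h
    split_ifs at h with h0
    · subst h0
      rw [pow_zero, mul_one]
      exact T.A_mono (Nat.le_succ N) h
    · exact T.JJ_eta N hN _ h e he
  have hGV' : Good T.w κ ((DD N1).map (evz F (y + r))) :=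
    fun f hf => T.A_good (N + 1) hN f (hV'A hf)
  have hWf' : (gaps T.w κ ((DD N2).map (evz F (y + r)))).Finite := by rw [hWeq]; exact hWf
  have hd2 := (dim_quot T.w hκ (Submodule.map_mono (f := evz F (y + r)) (DD_mono hN21)) hGV' hWf').2
  rw [hq2] at hd2
  rw [hq1] at hd1
  rw [hWeq] at hd2
  have hVf : (gaps T.w κ ((DD N1).map (evz F (y + r)))).Finite :=
    hWf'.subset (gaps_anti T.w (Submodule.map_mono (DD_mono hN21)))
  have hsub := gaps_anti T.w (κ := κ) hV'A
  refine ⟨hVf.subset hsub, ?_⟩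
  have hle := Set.ncard_le_ncard hsub hVf
  have hsum : ∑ e ∈ Finset.range q, (gaps T.w (q * κ) (N1 e)).ncard =
      (gaps T.w (q * κ) (T.A N).toSubmodule).ncard + (q - 1) * (gaps T.w (q * κ) (T.JJ N)).ncard := by
    obtain ⟨s, hs⟩ : ∃ s, q = s + 1 := ⟨q - 1, by omega⟩
    have e1 : ∀ Q : ℕ, Q = q → ∑ e ∈ Finset.range q, (gaps T.w (Q * κ) (N1 e)).ncard =
        (gaps T.w (Q * κ) (T.A N).toSubmodule).ncard + (q - 1) * (gaps T.w (Q * κ) (T.JJ N)).ncard := by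
      intro Q _
      have e2 : Finset.range q = Finset.range (s + 1) := by rw [hs]
      have e3 : q - 1 = s := by omega
      rw [e2, e3, Finset.sum_range_succ', add_comm]
      congr 1
      · simp [N1, hq]
      · rw [Finset.sum_congr rfl (g := fun _ => (gaps T.w (Q * κ) (T.JJ N)).ncard)]
        · simp
        · intro e he
          have he := Finset.mem_range.1 he
          simp only [N1]
          rw [if_pos (by omega), if_neg (by omega)]
    exact e1 q rfl
  have h5 : (q - 1) * ((gaps T.w (q * κ) (T.JJ N)).ncard + 1) ≤
      (q - 1) * ((gaps T.w (q * κ) (T.A N).toSubmodule).ncard + q ^ (N / 2 + 1)) := Nat.mul_le_mul_left _ hJc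
  have h6 : q * (gaps T.w (q * κ) (T.A N).toSubmodule).ncard = (gaps T.w (q * κ) (T.A N).toSubmodule).ncard
      + (q - 1) * (gaps T.w (q * κ) (T.A N).toSubmodule).ncard := by
    obtain ⟨s, hs⟩ : ∃ s, q = s + 1 := ⟨q - 1, by omega⟩
    generalize (gaps T.w (q * κ) (T.A N).toSubmodule).ncard = G
    rw [hs, Nat.add_sub_cancel]; ring
  rw [mul_add, mul_add, mul_one] at h5
  rw [h6]
  rw [hsum] at hV0c
  omega

lemma gaps_fin (k : ℕ) (hk : k ≤ L) : (gaps T.w (q ^ (L - k)) (T.A k).toSubmodule).Finite := by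
  induction k with
  | zero => rw [Nat.sub_zero, T.gaps_zero]; exact Set.finite_empty
  | succ k ih => exact (T.step k hk (ih (by omega))).1

lemma gaps_bound_aux (a : ℕ) :
    (2 * a ≤ L → ((gaps T.w (q ^ (L - 2 * a)) (T.A (2 * a)).toSubmodule).ncard : ℤ) ≤ ((q : ℤ) ^ (a + 1) - 1) * ((q : ℤ) ^ a - 1)) ∧
    (2 * a + 1 ≤ L → ((gaps T.w (q ^ (L - (2 * a + 1))) (T.A (2 * a + 1)).toSubmodule).ncard : ℤ) ≤ ((q : ℤ) ^ (a + 1) - 1) ^ 2) := by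
  have hq := T.q_pos
  have hstep : ∀ N, N < L → ((gaps T.w (q ^ (L - (N + 1))) (T.A (N + 1)).toSubmodule).ncard : ℤ) + (q - 1) ≤
      q * ((gaps T.w (q ^ (L - N)) (T.A N).toSubmodule).ncard : ℤ) + (q - 1) * q ^ (N / 2 + 1) := by
    intro N hN
    have := (T.step N hN (T.gaps_fin N hN.le)).2
    zify [hq] at this
    push_cast [Nat.cast_sub (show 1 ≤ q from hq)] at this
    exact this
  have hodd : ∀ a, (2 * a ≤ L → ((gaps T.w (q ^ (L - 2 * a)) (T.A (2 * a)).toSubmodule).ncard : ℤ) ≤ ((q : ℤ) ^ (a + 1) - 1) * ((q : ℤ) ^ a - 1)) →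
      (2 * a + 1 ≤ L → ((gaps T.w (q ^ (L - (2 * a + 1))) (T.A (2 * a + 1)).toSubmodule).ncard : ℤ) ≤ ((q : ℤ) ^ (a + 1) - 1) ^ 2) := by
    intro a h1 h
    have h2 := hstep (2 * a) (by omega)
    rw [show 2 * a / 2 = a by omega] at h2
    have h3 := mul_le_mul_of_nonneg_left (h1 (by omega)) (show (0 : ℤ) ≤ q by positivity)
    refine le_trans (le_sub_iff_add_le.2 (h2.trans (add_le_add_left h3 _))) ?_
    apply le_of_eq
    rw [pow_succ]; ring
  induction a with
  | zero =>
    have h0 : (2 * 0 ≤ L → ((gaps T.w (q ^ (L - 2 * 0)) (T.A (2 * 0)).toSubmodule).ncard : ℤ) ≤ ((q : ℤ) ^ (0 + 1) - 1) * ((q : ℤ) ^ 0 - 1)) := by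
      intro _
      simp only [Nat.mul_zero, Nat.sub_zero]
      rw [T.gaps_zero]; simp
    exact ⟨h0, hodd 0 h0⟩
  | succ a ih =>
    have h0 : (2 * (a + 1) ≤ L → ((gaps T.w (q ^ (L - 2 * (a + 1))) (T.A (2 * (a + 1))).toSubmodule).ncard : ℤ) ≤ ((q : ℤ) ^ (a + 1 + 1) - 1) * ((q : ℤ) ^ (a + 1) - 1)) := by
      intro h
      have h2 := hstep (2 * a + 1) (by omega)
      rw [show (2 * a + 1) / 2 = a by omega] at h2
      have h3 := mul_le_mul_of_nonneg_left (ih.2 (by omega)) (show (0 : ℤ) ≤ q by positivity)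
      refine le_trans (le_sub_iff_add_le.2 (h2.trans (add_le_add_left h3 _))) ?_
      apply le_of_eq
      rw [pow_succ, pow_succ]; ring
    exact ⟨h0, hodd _ h0⟩

theorem gaps_bound : (gaps T.w 1 (T.A L).toSubmodule).Finite ∧ (gaps T.w 1 (T.A L).toSubmodule).ncard ≤ q ^ (L + 1) := by
  have hq := T.q_pos
  have hf := T.gaps_fin L le_rfl
  rw [Nat.sub_self, pow_zero] at hf
  refine ⟨hf, ?_⟩
  have hq1 : ∀ n, (1 : ℤ) ≤ q ^ n := fun n => by exact_mod_cast Nat.one_le_pow n q hq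
  rcases Nat.even_or_odd' L with ⟨a, ha | ha⟩
  · have h := (T.gaps_bound_aux a).1 (by omega)
    rw [← ha, Nat.sub_self, pow_zero] at h
    zify
    refine h.trans ?_
    have h1 := hq1 a
    have h2 := hq1 (a + 1)
    have : (q : ℤ) ^ (L + 1) = q ^ (a + 1) * q ^ a := by rw [← pow_add]; congr 1; omega
    rw [this]
    nlinarith
  · have h := (T.gaps_bound_aux a).2 (by omega)
    rw [← ha, Nat.sub_self, pow_zero] at h
    zify
    refine h.trans ?_
    have h2 := hq1 (a + 1)
    have : (q : ℤ) ^ (L + 1) = q ^ (a + 1) * q ^ (a + 1) := by rw [← pow_add]; congr 1; omega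
    rw [this]
    nlinarith

end TowW
end tower
end GS


set_option linter.unusedSectionVars false

namespace GS
open Polynomial

/-- counting in the finite field -/
lemma trace_count {F : Type*} [Field F] [Fintype F] [DecidableEq F] (q : ℕ) (hq : 2 ≤ q)
    (hcard : Fintype.card F = q * q) (hadd : ∀ a b : F, (a + b) ^ q = a ^ q + b ^ q) :
    (∀ c : F, c ^ q = c → q ≤ (Finset.univ.filter fun a : F => a ^ q + a = c).card) ∧
    q * q - q ≤ (Finset.univ.filter fun a : F => a ^ q + a ≠ 0).card := by
  have hqq : ∀ a : F, (a ^ q) ^ q = a := by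
    intro a
    rw [← pow_mul, ← hcard, FiniteField.pow_card]
  have hroot : ∀ s : F, s ≠ 0 → (Finset.univ.filter fun a : F => a ^ q + s * a = 0).card ≤ q := by
    intro s _
    have hd : (C s * X : F[X]).degree < q := lt_of_le_of_lt (degree_C_mul_X_le s) (by exact_mod_cast hq)
    have hm : (X ^ q + C s * X : F[X]).Monic := monic_X_pow_add hd
    have hdeg : (X ^ q + C s * X : F[X]).natDegree = q := by
      apply natDegree_eq_of_degree_eq_some
      rw [degree_add_eq_left_of_degree_lt (by rw [degree_X_pow]; exact hd), degree_X_pow]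
    have h1 := card_roots' (X ^ q + C s * X : F[X])
    rw [hdeg] at h1
    refine le_trans ?_ (le_trans (Multiset.toFinset_card_le _) h1)
    apply Finset.card_le_card
    intro a ha
    rw [Multiset.mem_toFinset, mem_roots hm.ne_zero]
    simpa using (Finset.mem_filter.1 ha).2
  have hk := hroot 1 one_ne_zero
  simp only [one_mul] at hk
  have hneg : ∀ a : F, (-a) ^ q = -a ^ q := by
    intro a
    have := hadd a (-a)
    rw [add_neg_cancel, zero_pow (by omega)] at this
    exact eq_neg_of_add_eq_zero_right this.symm
  let φ : F → F := fun a => a ^ q + a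
  have hsub : ∀ a b : F, φ (a - b) = φ a - φ b := by
    intro a b
    simp only [φ]
    rw [sub_eq_add_neg, hadd, hneg]; ring
  have hS := hroot (-1) (by simp)
  let S := Finset.univ.filter fun c : F => c ^ q = c
  have hS : S.card ≤ q := by
    refine le_trans (Finset.card_le_card ?_) hS
    intro a ha
    have := (Finset.mem_filter.1 ha).2
    simp [this]
  let Z := Finset.univ.filter fun a : F => a ^ q + a = 0
  have hZ : Z.card ≤ q := hk
  have hmap : ∀ a ∈ (Finset.univ : Finset F), φ a ∈ S := by
    intro a _
    simp only [S, Finset.mem_filter, Finset.mem_univ, true_and, φ]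
    rw [hadd, hqq, add_comm]
  have hfib : ∀ c, (Finset.univ.filter fun a : F => φ a = c).card ≤ Z.card := by
    intro c
    rcases (Finset.univ.filter fun a : F => φ a = c).eq_empty_or_nonempty with h | ⟨b, hb⟩
    · rw [h]; simp
    · apply Finset.card_le_card_of_injOn (fun a => a - b)
      · intro a ha
        have h1 := (Finset.mem_filter.1 ha).2
        have h2 := (Finset.mem_filter.1 hb).2
        have := hsub a b
        rw [h1, h2, sub_self] at this
        simp only [Z, Finset.coe_filter, Finset.mem_univ, true_and, Set.mem_ofPred_eq]
        exact this
      · intro a _ a' _ h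
        simpa using h
  have hsum := Finset.card_eq_sum_card_fiberwise (s := Finset.univ) (t := S) (f := φ) hmap
  rw [Finset.card_univ, hcard] at hsum
  constructor
  · intro c hc
    by_contra! hlt
    have hcS : c ∈ S := by simp [S, hc]
    have : ∑ b ∈ S, (Finset.univ.filter fun a : F => φ a = b).card < ∑ b ∈ S, q := by
      apply Finset.sum_lt_sum
      · intro b _
        exact (hfib b).trans hZ
      · exact ⟨c, hcS, hlt⟩
    rw [← hsum, Finset.sum_const, smul_eq_mul] at this
    have := Nat.mul_le_mul_right q hS
    omega
  · have h := Finset.card_filter_add_card_filter_not (s := (Finset.univ : Finset F)) (fun a => a ^ q + a = 0)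
    rw [Finset.card_univ, hcard] at h
    have hZ' : (Finset.univ.filter fun a : F => a ^ q + a = 0).card ≤ q := hk
    change q * q - q ≤ (Finset.univ.filter fun a : F => ¬ (a ^ q + a = 0)).card
    omega

section tower
variable {F K : Type*} [Field F] [Finite F] [Field K] [Algebra F K] [CharP K 2] {q L : ℕ} (T : TowW F K q L)

namespace TowW

include T

lemma x0_trans (p : F[X]) (hp : aeval (T.x 0) p = 0) : p = 0 := by
  by_contra h0
  have hx := T.ne 0 (Nat.zero_le _)
  have hq := T.q_pos
  have hwt : ∀ e, algebraMap F K (p.coeff e) ≠ 0 → T.w.wt (algebraMap F K (p.coeff e) * T.x 0 ^ e) = (q : ℤ) ^ L * e := by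
    intro e he
    rw [T.w.mul' _ _ he (pow_ne_zero _ hx), T.w.pow _ hx, T.hw 0 (Nat.zero_le _), T.w.alg', Nat.sub_zero]
    · ring
    · simpa using he
  have e1 : aeval (T.x 0) p = ∑ e ∈ Finset.range (p.natDegree + 1), algebraMap F K (p.coeff e) * T.x 0 ^ e := by
    rw [aeval_eq_sum_range]; simp [Algebra.smul_def]
  obtain ⟨e, -, hce, h1, h2, -⟩ := T.w.sum_distinct (Finset.range (p.natDegree + 1))
      (fun e => algebraMap F K (p.coeff e) * T.x 0 ^ e) (by
    intro i _ j _ h1 h2 h3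
    rw [hwt i (left_ne_zero_of_mul h1), hwt j (left_ne_zero_of_mul h2)] at h3
    have h5 := mul_left_cancel₀ (by positivity) h3
    exact_mod_cast h5) (by
      refine ⟨p.natDegree, by simp, mul_ne_zero ?_ (pow_ne_zero _ hx)⟩
      simpa using h0)
  exact h1 (by rw [← e1, hp])

lemma point_zero (a : F) (ha : a ^ q + a ≠ 0) : ∃ χ : T.B 0 →ₐ[F] F, χ ⟨T.x 0, T.x_mem le_rfl⟩ = a := by
  let x0 : T.B 0 := ⟨T.x 0, T.x_mem le_rfl⟩
  let y0 : T.B 0 := ⟨(T.phi 0)⁻¹, T.phi0_inv_mem 0⟩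
  have hphi : T.phi 0 = aeval (T.x 0) (X ^ q + X : F[X]) := by simp [phi]
  have h0 := T.phi_ne 0 (Nat.zero_le _)
  let π : F[X][X] →ₐ[F] T.B 0 := eval₂AlgHom (aeval x0) y0 (fun _ => Commute.all _ _)
  let g : F[X][X] →ₐ[F] F := eval₂AlgHom (aeval a) ((a ^ q + a)⁻¹) (fun _ => Commute.all _ _)
  have hcoe : ∀ p : F[X], ((aeval x0 p : T.B 0) : K) = aeval (T.x 0) p := by
    intro p
    exact (aeval_algHom_apply (T.B 0).val x0 p).symm
  have hπ : ∀ r, ((π r : T.B 0) : K) = ∑ j ∈ Finset.range (r.natDegree + 1), aeval (T.x 0) (r.coeff j) * (T.phi 0)⁻¹ ^ j := by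
    intro r
    change ((eval₂ ((aeval x0 : F[X] →ₐ[F] T.B 0) : F[X] →+* T.B 0) y0 r : T.B 0) : K) = _
    rw [eval₂_eq_sum_range]
    push_cast
    refine Finset.sum_congr rfl fun j _ => ?_
    rw [← hcoe]
  have hg : ∀ r, g r = ∑ j ∈ Finset.range (r.natDegree + 1), aeval a (r.coeff j) * (a ^ q + a)⁻¹ ^ j := by
    intro r
    change eval₂ ((aeval a : F[X] →ₐ[F] F) : F[X] →+* F) _ r = _
    rw [eval₂_eq_sum_range]
    rfl
  have hsurj : Function.Surjective π := by
    rintro ⟨b, hb⟩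
    obtain ⟨c, p, h⟩ := T.B_zero b hb
    refine ⟨C p * X ^ c, ?_⟩
    apply Subtype.ext
    have : π (C p * X ^ c) = aeval x0 p * y0 ^ c := by
      change eval₂ _ _ _ = _
      simp
    rw [this]
    change ((aeval x0 p : T.B 0) : K) * ((T.phi 0)⁻¹) ^ c = b
    rw [hcoe, ← h]
    try simp only [y0]
    rw [inv_pow]
    field_simp
  have hker : ∀ r, π r = 0 → g r = 0 := by
    intro r hr
    have h1 := hπ r
    rw [hr] at h1
    set N := r.natDegree
    have h2 : aeval (T.x 0) (∑ j ∈ Finset.range (N + 1), r.coeff j * (X ^ q + X) ^ (N - j)) = 0 := by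
      rw [map_sum]
      have : T.phi 0 ^ N * ∑ j ∈ Finset.range (N + 1), aeval (T.x 0) (r.coeff j) * (T.phi 0)⁻¹ ^ j = 0 := by
        rw [← h1]; simp
      rw [← this, Finset.mul_sum]
      refine Finset.sum_congr rfl fun j hj => ?_
      obtain ⟨d, hd⟩ := Nat.exists_eq_add_of_le (Nat.lt_succ_iff.1 (Finset.mem_range.1 hj))
      rw [map_mul, map_pow, ← hphi, hd, Nat.add_sub_cancel_left, pow_add, inv_pow]
      field_simp
    have h3 := congrArg (aeval a) (T.x0_trans _ h2)
    rw [map_zero, map_sum] at h3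
    have h4 : (a ^ q + a) ^ N * g r = 0 := by
      rw [← h3, hg, Finset.mul_sum]
      change ∑ j ∈ Finset.range (N + 1), _ = _
      refine Finset.sum_congr rfl fun j hj => ?_
      obtain ⟨d, hd⟩ := Nat.exists_eq_add_of_le (Nat.lt_succ_iff.1 (Finset.mem_range.1 hj))
      have e : aeval a (X ^ q + X : F[X]) = a ^ q + a := by simp
      rw [map_mul, map_pow, e, hd, Nat.add_sub_cancel_left, pow_add, inv_pow]
      field_simp
    exact (mul_eq_zero.1 h4).resolve_left (pow_ne_zero _ ha)
  refine ⟨AlgHom.liftOfSurjective π hsurj g (fun r hr => hker r hr), ?_⟩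
  have e1 : (⟨T.x 0, T.x_mem le_rfl⟩ : T.B 0) = π (C X) := by
    change x0 = eval₂ _ _ _
    simp
  rw [e1]
  refine (AlgHom.liftOfSurjective_apply _ _ _ _ _).trans ?_
  change eval₂ _ _ _ = _
  simp

lemma point_succ (k : ℕ) (hk : k < L) (χ : T.B k →ₐ[F] F) (b : F)
    (hb : b ^ q + b = χ ⟨T.phi (k + 1), T.phi_succ_mem le_rfl hk⟩) :
    ∃ χ' : T.B (k + 1) →ₐ[F] F, χ'.comp (Subalgebra.inclusion (T.B_mono (Nat.le_succ k))) = χ ∧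
      χ' ⟨T.x (k + 1), T.x_mem le_rfl⟩ = b := by
  let y : T.B (k + 1) := ⟨T.x (k + 1), T.x_mem le_rfl⟩
  let ι : T.B k →ₐ[F] T.B (k + 1) := Subalgebra.inclusion (T.B_mono (Nat.le_succ k))
  let π : (T.B k)[X] →ₐ[F] T.B (k + 1) := eval₂AlgHom ι y (fun _ => Commute.all _ _)
  let g : (T.B k)[X] →ₐ[F] F := eval₂AlgHom χ b (fun _ => Commute.all _ _)
  have hπ : ∀ r, ((π r : T.B (k + 1)) : K) = aeval (T.x (k + 1)) r := by
    intro r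
    change (T.B (k + 1)).val (eval₂ (ι : T.B k →+* T.B (k + 1)) y r) = _
    rw [aeval_def, eval₂_eq_sum_range, eval₂_eq_sum_range, map_sum]
    refine Finset.sum_congr rfl fun j _ => ?_
    rw [map_mul, map_pow]
    rfl
  have hsurj : Function.Surjective π := by
    rintro ⟨c, hc⟩
    obtain ⟨p, -, h⟩ := T.B_succ k hk c hc
    exact ⟨p, Subtype.ext ((hπ p).trans h)⟩
  have hq := T.toTow.two_le
  let u : T.B k := ⟨T.phi (k + 1), T.phi_succ_mem le_rfl hk⟩
  have hd : (X + C u : (T.B k)[X]).degree < q := by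
    rw [degree_X_add_C]; exact_mod_cast hq
  have hm : (X ^ q + (X + C u) : (T.B k)[X]).Monic := monic_X_pow_add hd
  have hdeg : (X ^ q + (X + C u) : (T.B k)[X]).degree = q := by
    rw [degree_add_eq_left_of_degree_lt (by rw [degree_X_pow]; exact hd), degree_X_pow]
  have h2K : (2 : K) = 0 := CharTwo.two_eq_zero
  have h2F : (2 : F) = 0 := by
    apply (algebraMap F K).injective
    rw [map_ofNat, map_zero, h2K]
  have hker : ∀ r, π r = 0 → g r = 0 := by
    intro r hr
    have h1 := hπ r
    rw [hr] at h1
    have hy0 : aeval (T.x (k + 1)) (X ^ q + (X + C u) : (T.B k)[X]) = 0 := by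
      simp only [map_add, map_pow, aeval_X, aeval_C]
      change T.x (k + 1) ^ q + (T.x (k + 1) + (T.x (k + 1) ^ q + T.x (k + 1))) = 0
      linear_combination (T.x (k + 1) ^ q + T.x (k + 1)) * h2K
    have hmod := modByMonic_add_div r (X ^ q + (X + C u))
    set s := r %ₘ (X ^ q + (X + C u)) with hs
    have hsd : s.degree < q := by rw [← hdeg]; exact degree_modByMonic_lt _ hm
    have hs0 : aeval (T.x (k + 1)) s = 0 := by
      have := congrArg (aeval (T.x (k + 1))) hmod
      rw [map_add, map_mul, hy0, zero_mul, add_zero, ← h1] at this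
      exact this
    have hsz : s = 0 := by
      by_contra hne
      have e : L - k = (L - (k + 1)) + 1 := by omega
      have hnd : s.natDegree < q := (natDegree_lt_iff_degree_lt hne).2 hsd
      rw [aeval_eq_sum_range' hnd] at hs0
      obtain ⟨e, -, -, h2, -, -⟩ := T.w.sum_pow q (q ^ (L - (k + 1))) (pow_pos T.q_pos _) (T.x (k + 1))
        (T.ne _ hk) (by rw [T.hw _ hk]; push_cast; rfl) (fun e => ((s.coeff e : T.B k) : K)) (by
          intro j _ hj
          have := T.wt_dvd k (by omega) _ (s.coeff j).2 hj
          rwa [e, pow_succ'] at this) (by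
          refine ⟨s.natDegree, hnd, ?_⟩
          have : s.coeff s.natDegree ≠ 0 := by simpa using hne
          intro h
          exact this (Subtype.ext h))
      exact h2 hs0
    rw [← hmod, hsz, zero_add, map_mul]
    have : g (X ^ q + (X + C u)) = 0 := by
      have e : g (X ^ q + (X + C u)) = b ^ q + (b + χ u) := by
        change eval₂ _ _ _ = _
        simp
      rw [e, ← hb]
      linear_combination (b ^ q + b) * h2F
    rw [this, zero_mul]
  have e0 : ∀ r, AlgHom.liftOfSurjective π hsurj g (fun r hr => hker r hr) (π r) = g r :=
    fun r => AlgHom.liftOfSurjective_apply _ _ _ _ r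
  refine ⟨AlgHom.liftOfSurjective π hsurj g (fun r hr => hker r hr), ?_, ?_⟩
  · ext c
    have e1 : ι c = π (C c) := by change _ = eval₂ _ _ _; simp
    change AlgHom.liftOfSurjective π hsurj g (fun r hr => hker r hr) (ι c) = _
    rw [e1, e0]
    change eval₂ _ _ _ = _
    simp
  · have e1 : y = π X := by change _ = eval₂ _ _ _; simp
    change AlgHom.liftOfSurjective π hsurj g (fun r hr => hker r hr) y = _
    rw [e1, e0]
    change eval₂ _ _ _ = _
    simp

lemma chi_phi_ne (k i : ℕ) (hk : i ≤ k) (hi : i ≤ L) (χ : T.B k →ₐ[F] F) : χ ⟨T.phi i, T.phi_mem hk⟩ ≠ 0 := by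
  intro h
  have : (⟨T.phi i, T.phi_mem hk⟩ : T.B k) * ⟨(T.phi i)⁻¹, T.phi_inv_mem hk hi⟩ = 1 :=
    Subtype.ext (mul_inv_cancel₀ (T.phi_ne i hi))
  have h2 := congrArg χ this
  rw [map_mul, h, zero_mul, map_one] at h2
  exact zero_ne_one h2

lemma points_B (hcard : Nat.card F = q * q) (k : ℕ) (hk : k ≤ L) :
    ∃ ψ : Fin ((q - 1) * q ^ (k + 1)) → (T.B k →ₐ[F] F), Function.Injective ψ := by
  classical
  have := Fintype.ofFinite F
  have h2K : (2 : K) = 0 := CharTwo.two_eq_zero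
  have hq2 := T.toTow.two_le
  have haddF : ∀ a b : F, (a + b) ^ q = a ^ q + b ^ q := by
    intro a b
    apply (algebraMap F K).injective
    simp only [map_pow, map_add]
    exact T.toTow.add_pow_q _ _
  obtain ⟨hfib, hbase⟩ := trace_count (F := F) q hq2 (by rw [← Nat.card_eq_fintype_card, hcard]) haddF
  have hqq : ∀ a : F, (a ^ q) ^ q = a := by
    intro a
    rw [← pow_mul, ← hcard, Nat.card_eq_fintype_card, FiniteField.pow_card]
  induction k with
  | zero =>
    obtain ⟨e⟩ : Nonempty (Fin ((q - 1) * q ^ (0 + 1)) ↪ (Finset.univ.filter fun a : F => a ^ q + a ≠ 0)) := by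
      apply Function.Embedding.nonempty_of_card_le
      rw [Fintype.card_fin, Fintype.card_coe]
      refine le_trans (le_of_eq ?_) hbase
      rw [Nat.sub_mul]; simp
    have hp : ∀ i, ∃ χ : T.B 0 →ₐ[F] F, χ ⟨T.x 0, T.x_mem le_rfl⟩ = (e i : F) :=
      fun i => T.point_zero _ (Finset.mem_filter.1 (e i).2).2
    choose ψ hψ using hp
    refine ⟨ψ, fun i j h => e.injective (Subtype.ext ?_)⟩
    rw [← hψ i, ← hψ j, h]
  | succ k ih =>
    obtain ⟨ψ, hψ⟩ := ih (by omega)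
    have hfix : ∀ χ : T.B k →ₐ[F] F, (χ ⟨T.phi (k + 1), T.phi_succ_mem le_rfl hk⟩) ^ q =
        χ ⟨T.phi (k + 1), T.phi_succ_mem le_rfl hk⟩ := by
      intro χ
      set u := χ ⟨T.phi (k + 1), T.phi_succ_mem le_rfl hk⟩
      set v := χ ⟨T.phi k, T.phi_mem le_rfl⟩ with hv
      set a := χ ⟨T.x k, T.x_mem le_rfl⟩
      have hv0 : v ≠ 0 := T.chi_phi_ne k k le_rfl (by omega) χ
      have h1 : u * v = a ^ (q + 1) := by
        rw [← map_mul, ← map_pow]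
        exact congrArg χ (Subtype.ext (T.phi_rel k hk))
      have h2 : v = a ^ q + a := by
        rw [hv, ← map_pow, ← map_add]
        rfl
      have h3 : v ^ q = v := by rw [h2, haddF, hqq, add_comm]
      have h4 : (u * v) ^ q = u * v := by rw [h1, ← pow_mul, add_mul, pow_add, ← hcard, Nat.card_eq_fintype_card, FiniteField.pow_card, one_mul, pow_succ, mul_comm]
      rw [mul_pow, h3] at h4
      exact mul_right_cancel₀ hv0 h4
    have hemb : ∀ χ : T.B k →ₐ[F] F, ∃ e : Fin q → F, Function.Injective e ∧
        ∀ j, e j ^ q + e j = χ ⟨T.phi (k + 1), T.phi_succ_mem le_rfl hk⟩ := by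
      intro χ
      obtain ⟨e⟩ : Nonempty (Fin q ↪ (Finset.univ.filter fun a : F => a ^ q + a =
          χ ⟨T.phi (k + 1), T.phi_succ_mem le_rfl hk⟩)) := by
        apply Function.Embedding.nonempty_of_card_le
        rw [Fintype.card_fin, Fintype.card_coe]
        exact hfib _ (hfix χ)
      exact ⟨fun j => e j, fun i j h => e.injective (Subtype.ext h), fun j => (Finset.mem_filter.1 (e j).2).2⟩
    choose e he1 he2 using hemb
    have hp := fun (i : Fin ((q - 1) * q ^ (k + 1)) × Fin q) => T.point_succ k hk (ψ i.1) (e (ψ i.1) i.2) (he2 _ _)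
    choose Ψ hΨ1 hΨ2 using hp
    have hinj : Function.Injective Ψ := by
      rintro ⟨i, j⟩ ⟨i', j'⟩ h
      have h1 : i = i' := hψ (by rw [← hΨ1 (i, j), ← hΨ1 (i', j'), h])
      subst h1
      have h2 : j = j' := he1 (ψ i) (by
        have := hΨ2 (i, j)
        rw [h, hΨ2 (i, j')] at this
        exact this.symm)
      rw [h2]
    have ec : (q - 1) * q ^ (k + 1 + 1) = (q - 1) * q ^ (k + 1) * q := by ring
    rw [ec]
    exact ⟨Ψ ∘ finProdFinEquiv.symm, hinj.comp finProdFinEquiv.symm.injective⟩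

theorem points (hcard : Nat.card F = q * q) :
    ∃ ψ : Fin ((q - 1) * q ^ (L + 1)) → (T.A L →ₐ[F] F), Function.Injective ψ := by
  obtain ⟨ψ, hψ⟩ := T.points_B hcard L le_rfl
  have hAB : T.A L ≤ T.B L := inf_le_left
  refine ⟨fun i => (ψ i).comp (Subalgebra.inclusion hAB), fun i j h => hψ ?_⟩
  have h' : ∀ (f : K) (hf : f ∈ T.A L), ψ i ⟨f, hAB hf⟩ = ψ j ⟨f, hAB hf⟩ :=
    fun f hf => DFunLike.congr_fun h ⟨f, hf⟩
  ext ⟨b, hb⟩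
  obtain ⟨c, hc⟩ := T.exists_A L le_rfl b hb
  have hA : T.phi 0 ∈ T.A L := ⟨T.phi_mem (Nat.zero_le _), T.phi0_Ab⟩
  have h1 := h' _ hc
  have h2 := h' _ hA
  have hne := T.chi_phi_ne L 0 (Nat.zero_le _) (Nat.zero_le _) (ψ j)
  have e : (⟨T.phi 0 ^ c * b, hAB hc⟩ : T.B L) = ⟨T.phi 0, hAB hA⟩ ^ c * ⟨b, hb⟩ := rfl
  rw [e, map_mul, map_mul, map_pow, map_pow, h2] at h1
  exact mul_left_cancel₀ (pow_ne_zero _ hne) h1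

end TowW
end tower
end GS


set_option linter.unusedSectionVars false

namespace GS

section laurent
variable {F : Type*} [Field F]

/-- the weight on Laurent series -/
noncomputable def lwt : WtF F (LaurentSeries F) where
  wt f := - f.order
  mul' f g hf hg := by rw [HahnSeries.order_mul hf hg]; ring
  add' f g hf hg h := by
    have := HahnSeries.min_order_le_order_add h
    rw [max_neg_neg]
    omega
  alg' c hc := by rw [LaurentSeries.algebraMap_apply, HahnSeries.order_C, neg_zero]
  lead' f g hf hg h := by
    have h : f.order = g.order := by omega
    have hg' : g.coeff g.order ≠ 0 := fun h => hg (HahnSeries.coeff_order_eq_zero.1 h)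
    refine ⟨f.coeff f.order / g.coeff g.order, ?_⟩
    rw [Algebra.smul_def, LaurentSeries.algebraMap_apply, HahnSeries.C_mul_eq_smul]
    by_cases h0 : f - (f.coeff f.order / g.coeff g.order) • g = 0
    · exact Or.inl h0
    right
    rw [neg_lt_neg_iff]
    by_contra! hle
    apply h0
    rw [← HahnSeries.coeff_order_eq_zero]
    generalize (f - (f.coeff f.order / g.coeff g.order) • g).order = n at hle ⊢
    rw [HahnSeries.coeff_sub, HahnSeries.coeff_smul, smul_eq_mul]
    rcases hle.lt_or_eq with h1 | rfl
    · rw [HahnSeries.coeff_eq_zero_of_lt_order h1, HahnSeries.coeff_eq_zero_of_lt_order (x := g) (h1.trans_eq h)]; simp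
    · rw [h, div_mul_cancel₀ _ hg', sub_self]

lemma lwt_coe_nonpos (u : PowerSeries F) (hu : u ≠ 0) :
    (lwt (F := F)).wt (HahnSeries.ofPowerSeries ℤ F u) ≤ 0 := by
  change - (HahnSeries.ofPowerSeries ℤ F u).order ≤ 0
  by_contra! h
  have h1 : (HahnSeries.ofPowerSeries ℤ F u).order < 0 := by omega
  have h2 : (HahnSeries.ofPowerSeries ℤ F u).coeff (HahnSeries.ofPowerSeries ℤ F u).order = 0 := by
    rw [PowerSeries.coeff_coe, if_pos h1]
  rw [HahnSeries.coeff_order_eq_zero] at h2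
  exact hu (HahnSeries.ofPowerSeries_injective (Γ := ℤ) (by rw [h2, map_zero]))

lemma lwt_unit (u : PowerSeries F) (hu : IsUnit u) :
    (lwt (F := F)).wt (HahnSeries.ofPowerSeries ℤ F u) = 0 := by
  obtain ⟨v, hv⟩ := hu.exists_right_inv
  have hu0 : u ≠ 0 := hu.ne_zero
  have hv0 : v ≠ 0 := by rintro rfl; simp at hv
  have h1 := lwt_coe_nonpos u hu0
  have h2 := lwt_coe_nonpos v hv0
  have hne : ∀ w : PowerSeries F, w ≠ 0 → HahnSeries.ofPowerSeries ℤ F w ≠ 0 := by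
    intro w hw h
    exact hw (HahnSeries.ofPowerSeries_injective (Γ := ℤ) (by rw [h, map_zero]))
  have h3 := (lwt (F := F)).mul' _ _ (hne u hu0) (hne v hv0)
  rw [← map_mul, hv, map_one, (lwt (F := F)).one] at h3
  omega

lemma lwt_X : (lwt (F := F)).wt (HahnSeries.ofPowerSeries ℤ F PowerSeries.X) = -1 := by
  rw [PowerSeries.coe_X]
  change - (HahnSeries.single (1 : ℤ) (1 : F)).order = -1
  rw [HahnSeries.order_single one_ne_zero]

lemma unit_add (q : ℕ) (hq : 2 ≤ q) (z : PowerSeries F) (hz : PowerSeries.X ∣ z) : IsUnit (1 + z ^ (q - 1)) := by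
  rw [PowerSeries.isUnit_iff_constantCoeff, map_add, map_pow, PowerSeries.X_dvd_iff.1 hz,
    zero_pow (by omega), add_zero, map_one]
  exact isUnit_one

open Polynomial in
lemma laurent_step (q : ℕ) (hq : 2 ≤ q) (z : PowerSeries F) (hz : PowerSeries.X ∣ z) :
    ∃ z' : PowerSeries F, PowerSeries.X ∣ z' ∧ (∃ u, IsUnit u ∧ z' = z ^ q * u) ∧
      (z' ^ q + z') * (1 + z ^ (q - 1)) = z ^ q := by
  obtain ⟨v, hv⟩ := (unit_add q hq z hz).exists_right_inv
  set w := z ^ q * v with hw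
  have hd : (X - C w : (PowerSeries F)[X]).degree < q := by
    rw [degree_X_sub_C]; exact_mod_cast hq
  have hm : (X ^ q + (X - C w) : (PowerSeries F)[X]).Monic := monic_X_pow_add hd
  have hwX : PowerSeries.X ∣ w := Dvd.dvd.mul_right (dvd_pow hz (by omega)) v
  obtain ⟨z', h1, h2⟩ := HenselianRing.is_henselian (I := Ideal.span {(PowerSeries.X : PowerSeries F)})
    (X ^ q + (X - C w)) hm 0 (by
      rw [Ideal.mem_span_singleton]
      simpa [zero_pow (show q ≠ 0 by omega)] using hwX) (by
      simp [derivative_X_pow, zero_pow (show q - 1 ≠ 0 by omega)])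
  rw [sub_zero, Ideal.mem_span_singleton] at h2
  have h3 : z' ^ q + z' = w := by
    have : z' ^ q + (z' - w) = 0 := by simpa [IsRoot] using h1
    linear_combination this
  obtain ⟨v', hv'⟩ := (unit_add q hq z' h2).exists_right_inv
  have hfac : z' ^ q = z' ^ (q - 1) * z' := by rw [← pow_succ]; congr 1; omega
  refine ⟨z', h2, ⟨v * v', ?_, ?_⟩, ?_⟩
  · exact (IsUnit.of_mul_eq_one_right _ hv).mul (IsUnit.of_mul_eq_one_right _ hv')
  · calc z' = z' * ((1 + z' ^ (q - 1)) * v') := by rw [hv', mul_one]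
      _ = (z' ^ q + z') * v' := by rw [hfac]; ring
      _ = _ := by rw [h3, hw]; ring
  · rw [h3, hw, mul_assoc, mul_comm v, hv, mul_one]

/-- the chain of power series -/
lemma laurent_chain (q : ℕ) (hq : 2 ≤ q) : ∃ zz : ℕ → PowerSeries F,
    (∀ j, ∃ u, IsUnit u ∧ zz j = PowerSeries.X ^ (q ^ j) * u) ∧
    ∀ j, (zz (j + 1) ^ q + zz (j + 1)) * (1 + zz j ^ (q - 1)) = zz j ^ q := by
  choose f h1 h2 h3 using fun z : {z : PowerSeries F // PowerSeries.X ∣ z} => laurent_step q hq z.1 z.2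
  let s : ℕ → {z : PowerSeries F // PowerSeries.X ∣ z} := fun j =>
    Nat.rec ⟨PowerSeries.X, dvd_rfl⟩ (fun _ z => ⟨f z, h1 z⟩) j
  refine ⟨fun j => (s j).1, fun j => ?_, fun j => h3 (s j)⟩
  induction j with
  | zero => exact ⟨1, isUnit_one, by simp [s]⟩
  | succ j ih =>
    obtain ⟨u, hu, h⟩ := ih
    change (s j).1 = _ at h
    obtain ⟨v, hv, h'⟩ := h2 (s j)
    refine ⟨u ^ q * v, (hu.pow q).mul hv, ?_⟩
    change f (s j) = _
    rw [h', h, mul_pow, ← pow_mul, pow_succ]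
    ring

theorem exists_tower (m : ℕ) (hm : 1 ≤ m) (L : ℕ) (hL : 0 < L) :
    Nonempty (TowW F (LaurentSeries F) (2 ^ m) L) := by
  have hq : 2 ≤ 2 ^ m := by
    calc 2 = 2 ^ 1 := rfl
      _ ≤ 2 ^ m := Nat.pow_le_pow_right (by norm_num) hm
  generalize hqq : 2 ^ m = q at *
  obtain ⟨zz, h1, h2⟩ := laurent_chain (F := F) q hq
  let c := HahnSeries.ofPowerSeries ℤ F
  have hcX : c PowerSeries.X ≠ 0 := by
    intro h
    exact PowerSeries.X_ne_zero (R := F) (HahnSeries.ofPowerSeries_injective (Γ := ℤ) (by rw [map_zero]; exact h))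
  have hne : ∀ j, c (zz j) ≠ 0 := by
    intro j h
    obtain ⟨u, hu, h'⟩ := h1 j
    have : zz j = 0 := HahnSeries.ofPowerSeries_injective (Γ := ℤ) (by rw [map_zero]; exact h)
    rw [h'] at this
    exact mul_ne_zero (pow_ne_zero _ PowerSeries.X_ne_zero) hu.ne_zero this
  have hwt : ∀ j, (lwt (F := F)).wt (c (zz j)) = - (q : ℤ) ^ j := by
    intro j
    obtain ⟨u, hu, h'⟩ := h1 j
    have hcu : c u ≠ 0 := by
      intro h
      apply hne j
      rw [h', map_mul, h, mul_zero]
    rw [h', map_mul, map_pow, (lwt (F := F)).mul' _ _ (pow_ne_zero _ hcX) hcu, (lwt (F := F)).pow _ hcX,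
      lwt_X, lwt_unit u hu]
    push_cast; ring
  refine ⟨{ m := m, hm := hm, hq := hqq.symm, x := fun i => (c (zz (L - i)))⁻¹, ne := ?_, rel := ?_, w := lwt, hw := ?_, hL := hL }⟩
  · intro i _
    exact inv_ne_zero (hne _)
  · intro i hi
    obtain ⟨j, hj⟩ : ∃ j, L - i = j + 1 := ⟨L - i - 1, by omega⟩
    have hj' : L - (i + 1) = j := by omega
    simp only [hj, hj']
    have h := congrArg c (h2 j)
    simp only [map_mul, map_add, map_pow, map_one] at h
    have a0 := hne j
    have b0 := hne (j + 1)
    generalize c (zz j) = a at *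
    generalize c (zz (j + 1)) = b at *
    obtain ⟨r, rfl⟩ : ∃ r, q = r + 1 := ⟨q - 1, by omega⟩
    rw [Nat.add_sub_cancel] at h
    simp only [inv_pow]
    have e1 : (a ^ (r + 1))⁻¹ + a⁻¹ = (1 + a ^ r) * (a ^ (r + 1))⁻¹ := by
      rw [eq_mul_inv_iff_mul_eq₀ (pow_ne_zero _ a0), add_mul, inv_mul_cancel₀ (pow_ne_zero _ a0), pow_succ,
        mul_comm (a ^ r), inv_mul_cancel_left₀ a0]
    have e2 : (b ^ (r + 1))⁻¹ + b⁻¹ = (b ^ (r + 1) + b) * (b ^ (r + 1 + 1))⁻¹ := by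
      rw [eq_mul_inv_iff_mul_eq₀ (pow_ne_zero _ b0), add_mul, pow_succ b (r + 1), inv_mul_cancel_left₀ (pow_ne_zero _ b0),
        mul_comm (b ^ (r + 1)), inv_mul_cancel_left₀ b0, add_comm]
    rw [e1, e2]
    calc _ = ((b ^ (r + 1) + b) * (1 + a ^ r)) * (a ^ (r + 1))⁻¹ * (b ^ (r + 1 + 1))⁻¹ := by ring
      _ = _ := by rw [h, mul_inv_cancel₀ (pow_ne_zero _ a0), one_mul]
  · intro i hi
    rw [(lwt (F := F)).inv _ (hne _), hwt]
    ring

end laurent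
end GS


set_option linter.unusedSectionVars false

namespace GS
open Filter

theorem assembly {F : Type} [Field F] [Finite F] [CharP F 2] (m : ℕ) (hm : 2 ≤ m)
    (hcard : Nat.card F = 2 ^ m * 2 ^ m) (R : ℝ) (hR0 : 0 ≤ R) (hR1 : R ≤ 1) :
    ∃ (n : ℕ → ℕ) (C : (i : ℕ) → Submodule F ((Fin (n i) ⊕ Fin (n i)) → F)),
      (∀ i, sympOrth ((C i : Set ((Fin (n i) ⊕ Fin (n i)) → F)))
              ⊆ (C i : Set ((Fin (n i) ⊕ Fin (n i)) → F))) ∧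
      Tendsto n atTop atTop ∧
      R ≤ liminf (fun i =>
            ((Module.finrank F (C i) : ℝ) - (n i : ℝ)) / (n i : ℝ)) atTop ∧
      (1 - R - 2 / ((2 : ℝ) ^ m - 1)) / 2
        ≤ liminf (fun i =>
            ((minSympDist (C i : Set ((Fin (n i) ⊕ Fin (n i)) → F)) : ℝ))
              / (n i : ℝ)) atTop := by
  have hq4 : 4 ≤ 2 ^ m := by
    calc 4 = 2 ^ 2 := rfl
      _ ≤ 2 ^ m := Nat.pow_le_pow_right (by norm_num) hm
  have : CharP (LaurentSeries F) 2 := charP_of_injective_algebraMap (algebraMap F (LaurentSeries F)).injective 2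
  have hcast : ((2 ^ m : ℕ) : ℝ) = (2 : ℝ) ^ m := by push_cast; rfl
  rw [← hcast]
  refine real_final (2 ^ m) hq4 R hR0 hR1 (fun i => (2 ^ m - 1) * (2 ^ m) ^ (i + 1 + 1)) (fun i => (2 ^ m) ^ (i + 1 + 1))
    (fun _ => rfl) (fun i => Nat.one_le_pow _ _ (by omega)) ?_ ?_
  · refine tendsto_atTop_mono (f := id) (fun i => ?_) tendsto_id
    have h1 : i + 1 + 1 < (2 ^ m) ^ (i + 1 + 1) := Nat.lt_pow_self (by omega)
    have h2 := Nat.mul_le_mul_right ((2 ^ m) ^ (i + 1 + 1)) (show 1 ≤ 2 ^ m - 1 by omega)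
    simp only [id]
    omega
  · intro i a b d h1 h2 h3 h4
    obtain ⟨T⟩ := exists_tower (F := F) m (by omega) (i + 1) (by omega)
    obtain ⟨ψ, hψ⟩ := T.points hcard
    obtain ⟨hf, hc⟩ := T.gaps_bound
    have hG := T.A_good (i + 1) le_rfl
    rw [Nat.sub_self, pow_zero] at hG
    exact ag_code T.w (T.A (i + 1)) _ ψ hψ hG hf _ a b d hc h1 h2 h3 h4

end GS

/-- For `q = 2^m` (`m ≥ 2`) and `0 ≤ R ≤ 1` there is a sequence of
symplectic self-orthogonal `F_{q^2}`-linear subspaces `C_i ⊆ F_{q^2}^{2 n_i}`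
with `n_i → ∞`, `liminf k_i/n_i ≥ R` and
`liminf d_i/n_i ≥ (1 − R − 2/(2^m − 1))/2`. -/
theorem good_sequence_GS (m : ℕ) (hm : 2 ≤ m) (R : ℝ) (hR0 : 0 ≤ R) (hR1 : R ≤ 1) :
    ∃ (n : ℕ → ℕ)
      (C : (i : ℕ) → Submodule (GaloisField 2 (2 * m))
              ((Fin (n i) ⊕ Fin (n i)) → GaloisField 2 (2 * m))),
      (∀ i, sympOrth ((C i : Set ((Fin (n i) ⊕ Fin (n i)) → GaloisField 2 (2 * m))))
              ⊆ (C i : Set ((Fin (n i) ⊕ Fin (n i)) → GaloisField 2 (2 * m)))) ∧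
      Tendsto n atTop atTop ∧
      R ≤ liminf (fun i =>
            ((Module.finrank (GaloisField 2 (2 * m)) (C i) : ℝ) - (n i : ℝ))
              / (n i : ℝ)) atTop ∧
      (1 - R - 2 / ((2 : ℝ) ^ m - 1)) / 2
        ≤ liminf (fun i =>
            ((minSympDist (C i : Set ((Fin (n i) ⊕ Fin (n i)) → GaloisField 2 (2 * m))) : ℝ))
              / (n i : ℝ)) atTop := by
  have : Fact (Nat.Prime 2) := ⟨Nat.prime_two⟩
  exact GS.assembly m hm (by
    rw [GaloisField.card 2 (2 * m) (by omega), ← pow_add, two_mul]) R hR0 hR1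
end
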